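/- Let p, q ∈ [2, ∞) and let Φ ∈ ℝ^{m×N} satisfy RIP_{p,q} of orders s, s', and s+s' with constants δ_s, δ_{s'}, δ_{s+s'} respectively and scaling μ_{p,q}. If u, v ∈ ℝ^N have disjoint supports with ‖u‖_0 = s and ‖v‖_0 = s', then |⟨J(Φu), Φv⟩| ≤ μ_{p,q}^2 · C_{p,q} · ‖u‖_q ‖v‖_q, where C_{p,q} = [(1+δ_s)^{2/q} − (1−δ_{s+s'})^{2/q}]^{1/2} · [(p−1)(1+δ_{s'})^{2/q} − (1−δ_{s+s'})^{2/q}]^{1/2}. -/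

import Mathlib

noncomputable section

/-- The ℓ_p norm on ℝ^m. -/
def pnorm (p : ℝ) {m : ℕ} (x : Fin m → ℝ) : ℝ :=
  (∑ i, |x i| ^ p) ^ (1 / p)

/-- The normalized duality map (J(x))_i = ‖x‖_p^{2-p} |x_i|^{p-1} sign(x_i). -/
def Jmap (p : ℝ) {m : ℕ} (x : Fin m → ℝ) : Fin m → ℝ :=
  fun i => pnorm p x ^ (2 - p) * |x i| ^ (p - 1) * Real.sign (x i)

/-- x is s-sparse: at most s nonzero entries. -/
def Sparse {N : ℕ} (s : ℕ) (x : Fin N → ℝ) : Prop :=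
  (Finset.univ.filter fun i => x i ≠ 0).card ≤ s

/-- Φ satisfies RIP_{p,q} of order s with constant δ and scaling μ. -/
def RIPpq {m N : ℕ} (p q μ δ : ℝ) (s : ℕ) (Φ : Matrix (Fin m) (Fin N) ℝ) : Prop :=
  ∀ x : Fin N → ℝ, Sparse s x →
    μ * (1 - δ) ^ (1 / q) * pnorm q x ≤ pnorm p (Φ.mulVec x) ∧
      pnorm p (Φ.mulVec x) ≤ μ * (1 + δ) ^ (1 / q) * pnorm q x


/-- monotonicity helper: f 0 = 0 style, derivative nonneg on (0,1) -/
lemma nonneg_of_deriv01 (f f' : ℝ → ℝ) (hc : ContinuousOn f (Set.Icc 0 1))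
    (hd : ∀ x, 0 < x → x < 1 → HasDerivAt f (f' x) x) (h0 : 0 ≤ f 0)
    (hn : ∀ x, 0 < x → x < 1 → 0 ≤ f' x) (x : ℝ) (hx0 : 0 ≤ x) (hx1 : x ≤ 1) : 0 ≤ f x := by
  have hm : MonotoneOn f (Set.Icc 0 1) := by
    apply monotoneOn_of_deriv_nonneg (convex_Icc 0 1) hc
    · intro y hy
      rw [interior_Icc] at hy
      exact (hd y hy.1 hy.2).differentiableAt.differentiableWithinAt
    · intro y hy
      rw [interior_Icc] at hy
      rw [(hd y hy.1 hy.2).deriv]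
      exact hn y hy.1 hy.2
  exact h0.trans (hm (by simp) ⟨hx0, hx1⟩ hx0)

lemma hasDeriv_one_add (e x : ℝ) (hx : 0 < 1 + x) :
    HasDerivAt (fun t : ℝ => (1 + t) ^ e) (e * (1 + x) ^ (e - 1)) x := by
  have := ((hasDerivAt_id x).const_add 1).rpow_const (p := e) (Or.inl hx.ne')
  simpa [mul_comm, mul_left_comm] using this

lemma hasDeriv_one_sub (e x : ℝ) (hx : 0 < 1 - x) :
    HasDerivAt (fun t : ℝ => (1 - t) ^ e) (-(e * (1 - x) ^ (e - 1))) x := by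
  have := ((hasDerivAt_id x).const_sub 1).rpow_const (p := e) (Or.inl hx.ne')
  simpa [mul_comm, mul_left_comm] using this

lemma cont_one_add (e : ℝ) (he : 0 ≤ e) : Continuous (fun t : ℝ => (1 + t) ^ e) :=
  (continuous_const.add continuous_id).rpow_const (fun _ => Or.inr he)
lemma cont_one_sub (e : ℝ) (he : 0 ≤ e) : Continuous (fun t : ℝ => (1 - t) ^ e) :=
  (continuous_const.sub continuous_id).rpow_const (fun _ => Or.inr he)

lemma two_le_add_neg_rpow (g x : ℝ) (hg : g ≤ 0) (h0 : 0 < x) (h1 : x < 1) :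
    2 ≤ (1 + x) ^ g + (1 - x) ^ g := by
  have h2 : 0 < 1 - x := by linarith
  have ha : 0 < (1 + x) ^ g := Real.rpow_pos_of_pos (by linarith) _
  have hb : 0 < (1 - x) ^ g := Real.rpow_pos_of_pos (by linarith) _
  have hprod : 1 ≤ (1 + x) ^ g * (1 - x) ^ g := by
    rw [← Real.mul_rpow (by linarith) h2.le]
    apply Real.one_le_rpow_of_pos_of_le_one_of_nonpos _ _ hg
    · nlinarith
    · nlinarith
  nlinarith [sq_nonneg ((1 + x) ^ g - (1 - x) ^ g)]

/-- s4 -/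
lemma s4 (e h : ℝ) (he0 : 0 ≤ e) (he1 : e ≤ 1) (h0 : 0 ≤ h) (h1 : h ≤ 1) :
    2 * e * h ≤ (1 + h) ^ e - (1 - h) ^ e := by
  have := nonneg_of_deriv01 (fun t => (1 + t) ^ e - (1 - t) ^ e - 2 * e * t)
    (fun x => e * (1 + x) ^ (e - 1) - (-(e * (1 - x) ^ (e - 1))) - 2 * e)
    (((cont_one_add e he0).sub (cont_one_sub e he0)).sub (by fun_prop)).continuousOn
    (fun x hx0 hx1 => ((hasDeriv_one_add e x (by linarith)).sub
      (hasDeriv_one_sub e x (by linarith))).sub (by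
        simpa using (hasDerivAt_id x).const_mul (2 * e)))
    (by simp)
    (fun x hx0 hx1 => by
      have := two_le_add_neg_rpow (e - 1) x (by linarith) hx0 hx1
      nlinarith) h h0 h1
  linarith

/-- cosh-type bounds for exponent n=1+κ -/
lemma even_lower (κ x : ℝ) (h0 : 0 ≤ κ) (h1 : κ ≤ 1) (hx0 : 0 ≤ x) (hx1 : x ≤ 1) :
    2 + κ * (1 + κ) * x ^ 2 ≤ (1 + x) ^ (1 + κ) + (1 - x) ^ (1 + κ) := by
  have := nonneg_of_deriv01 (fun t => (1 + t) ^ (1 + κ) + (1 - t) ^ (1 + κ) - κ * (1 + κ) * t ^ 2 - 2)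
    (fun x => (1 + κ) * (1 + x) ^ (1 + κ - 1) + (-((1 + κ) * (1 - x) ^ (1 + κ - 1)))
      - κ * (1 + κ) * (2 * x))
    ((((cont_one_add _ (by linarith)).add (cont_one_sub _ (by linarith))).sub (by fun_prop)).sub
      (by fun_prop)).continuousOn
    (fun x hx0 hx1 => (((hasDeriv_one_add _ x (by linarith)).add
      (hasDeriv_one_sub _ x (by linarith))).sub (by
        simpa using ((hasDerivAt_id x).pow 2).const_mul (κ * (1 + κ)))).sub_const 2)
    (by norm_num)
    (fun x hx0 hx1 => by
      have := s4 κ x h0 h1 hx0.le hx1.le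
      have e1 : 1 + κ - 1 = κ := by ring
      simp only [e1]
      nlinarith) x hx0 hx1
  linarith

lemma rpow_chord (z κ : ℝ) (hz : 0 ≤ z) (h0 : 0 ≤ κ) (h1 : κ ≤ 1) :
    z ^ (1 + κ) ≤ (1 - κ) * z + κ * z ^ 2 := by
  have := Real.geom_mean_le_arith_mean2_weighted (by linarith : 0 ≤ 1 - κ) h0 hz
    (sq_nonneg z) (by ring)
  refine le_trans (le_of_eq ?_) this
  rcases hz.eq_or_lt with rfl | hz
  · rw [Real.zero_rpow (by linarith)]
    rcases h0.eq_or_lt with rfl | h0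
    · simp
    · simp [Real.zero_rpow h0.ne']
  · rw [← Real.rpow_natCast z 2, ← Real.rpow_mul hz.le, ← Real.rpow_add hz]
    congr 1; push_cast; ring

lemma even_upper (κ x : ℝ) (h0 : 0 ≤ κ) (h1 : κ ≤ 1) (hx0 : 0 ≤ x) (hx1 : x ≤ 1) :
    (1 + x) ^ (1 + κ) + (1 - x) ^ (1 + κ) ≤ 2 + 2 * κ * x ^ 2 := by
  have := rpow_chord (1 + x) κ (by linarith) h0 h1
  have := rpow_chord (1 - x) κ (by linarith) h0 h1
  nlinarith

/-- o upper -/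
lemma s2 (κ x : ℝ) (h0 : 0 ≤ κ) (h1 : κ ≤ 1) (hx0 : 0 ≤ x) (hx1 : x ≤ 1) :
    (1 + x) ^ (2 + κ) - (1 - x) ^ (2 + κ) ≤ (2 + κ) / 2 * (4 * x + 4 / 3 * κ * x ^ 3) := by
  have := nonneg_of_deriv01 (fun t => (2 + κ) / 2 * (4 * t + 4 / 3 * κ * t ^ 3) - ((1 + t) ^ (2 + κ) - (1 - t) ^ (2 + κ)))
    (fun x => (2 + κ) / 2 * (4 * 1 + 4 / 3 * κ * (3 * x ^ 2)) - ((2 + κ) * (1 + x) ^ (2 + κ - 1) - (-((2 + κ) * (1 - x) ^ (2 + κ - 1)))))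
    ((Continuous.sub (by fun_prop) ((cont_one_add _ (by linarith)).sub (cont_one_sub _ (by linarith))))).continuousOn
    (fun x hx0 hx1 => HasDerivAt.sub (by
        simpa using (((hasDerivAt_id x).const_mul 4).add (((hasDerivAt_id x).pow 3).const_mul (4 / 3 * κ))).const_mul ((2 + κ) / 2))
       ((hasDeriv_one_add _ x (by linarith)).sub
      (hasDeriv_one_sub _ x (by linarith))))
    (by norm_num)
    (fun x hx0 hx1 => by
      have := even_upper κ x h0 h1 hx0.le hx1.le
      have e1 : 2 + κ - 1 = 1 + κ := by ring
      simp only [e1]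
      nlinarith) x hx0 hx1
  linarith

/-- o lower -/
lemma s3 (κ x : ℝ) (h0 : 0 ≤ κ) (h1 : κ ≤ 1) (hx0 : 0 ≤ x) (hx1 : x ≤ 1) :
    (2 + κ) / 2 * (4 * x + 2 / 3 * κ * (1 + κ) * x ^ 3) ≤ (1 + x) ^ (2 + κ) - (1 - x) ^ (2 + κ) := by
  have := nonneg_of_deriv01 (fun t => ((1 + t) ^ (2 + κ) - (1 - t) ^ (2 + κ)) - (2 + κ) / 2 * (4 * t + 2 / 3 * κ * (1 + κ) * t ^ 3))
    (fun x => ((2 + κ) * (1 + x) ^ (2 + κ - 1) - (-((2 + κ) * (1 - x) ^ (2 + κ - 1)))) - (2 + κ) / 2 * (4 * 1 + 2 / 3 * κ * (1 + κ) * (3 * x ^ 2)))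
    ((Continuous.sub ((cont_one_add _ (by linarith)).sub (cont_one_sub _ (by linarith))) (by fun_prop))).continuousOn
    (fun x hx0 hx1 => HasDerivAt.sub 
       ((hasDeriv_one_add _ x (by linarith)).sub
      (hasDeriv_one_sub _ x (by linarith))) (by
        simpa using (((hasDerivAt_id x).const_mul 4).add (((hasDerivAt_id x).pow 3).const_mul (2 / 3 * κ * (1 + κ)))).const_mul ((2 + κ) / 2)))
    (by norm_num)
    (fun x hx0 hx1 => by
      have := even_lower κ x h0 h1 hx0.le hx1.le
      have e1 : 2 + κ - 1 = 1 + κ := by ring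
      simp only [e1]
      nlinarith) x hx0 hx1
  linarith


lemma nonneg_of_derivab (a b : ℝ) (f f' : ℝ → ℝ)
    (hd : ∀ x, a ≤ x → x ≤ b → HasDerivAt f (f' x) x) (h0 : 0 ≤ f a)
    (hn : ∀ x, a < x → x < b → 0 ≤ f' x) (hab : a ≤ b) : 0 ≤ f b := by
  have hm : MonotoneOn f (Set.Icc a b) := by
    apply monotoneOn_of_deriv_nonneg (convex_Icc a b)
    · intro y hy
      exact (hd y hy.1 hy.2).continuousAt.continuousWithinAt
    · intro y hy
      rw [interior_Icc] at hy
      exact (hd y hy.1.le hy.2.le).differentiableAt.differentiableWithinAt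
    · intro y hy
      rw [interior_Icc] at hy
      rw [(hd y hy.1.le hy.2.le).deriv]
      exact hn y hy.1 hy.2
  exact h0.trans (hm ⟨le_refl a, hab⟩ ⟨hab, le_refl b⟩ hab)

lemma bon1 (n y : ℝ) (hn : 1 ≤ n) (h0 : 0 ≤ y) (h1 : y ≤ 1) :
    (1 + y) ^ n - (1 - y) ^ n ≤ n * y * ((1 + y) ^ n + (1 - y) ^ n) := by
  have := nonneg_of_deriv01 (fun t => (n * t) * ((1 + t) ^ n + (1 - t) ^ n) - ((1 + t) ^ n - (1 - t) ^ n))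
    (fun x => (n * 1 * ((1 + x) ^ n + (1 - x) ^ n) + (n * x) * (n * (1 + x) ^ (n - 1) + (-(n * (1 - x) ^ (n - 1))))) - (n * (1 + x) ^ (n - 1) - (-(n * (1 - x) ^ (n - 1)))))
    (by
      have := cont_one_add n (by linarith)
      have := cont_one_sub n (by linarith)
      fun_prop)
    (fun x hx0 hx1 => by
      have ha := hasDeriv_one_add n x (by linarith)
      have hb := hasDeriv_one_sub n x (by linarith)
      exact (((hasDerivAt_id x).const_mul n).mul (ha.add hb)).sub (ha.sub hb))
    (by norm_num)
    (fun x hx0 hx1 => by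
      have e1 : (1 + x) ^ n = (1 + x) * (1 + x) ^ (n - 1) := by
        rw [Real.rpow_sub_one (by linarith)]; field_simp
      have e2 : (1 - x) ^ n = (1 - x) * (1 - x) ^ (n - 1) := by
        rw [Real.rpow_sub_one (by linarith)]
        have : 1 - x ≠ 0 := by linarith
        field_simp
      have h : (1 - x) ^ (n - 1) ≤ (1 + x) ^ (n - 1) :=
        Real.rpow_le_rpow (by linarith) (by linarith) (by linarith)
      rw [e1, e2]
      have : 0 ≤ n * (n + 1) * x * ((1 + x) ^ (n - 1) - (1 - x) ^ (n - 1)) := by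
        apply mul_nonneg (by positivity) (by linarith)
      nlinarith) y h0 h1
  linarith

lemma bon2 (p y : ℝ) (hp : 2 ≤ p) (h0 : 0 ≤ y) (h1 : y ≤ 1) :
    ((1 + y) ^ p + (1 - y) ^ p) / 2 ≤ (1 + (p - 1) * y ^ 2) ^ (p / 2) := by
  have hpos : ∀ x : ℝ, 0 < 1 + (p - 1) * x ^ 2 := fun x => by nlinarith [sq_nonneg x]
  have := nonneg_of_deriv01 (fun t => 1 - ((1 + t) ^ p + (1 - t) ^ p) / 2 * (1 + (p - 1) * t ^ 2) ^ (-(p / 2)))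
    (fun x => -((p * (1 + x) ^ (p - 1) + (-(p * (1 - x) ^ (p - 1)))) / 2 * (1 + (p - 1) * x ^ 2) ^ (-(p / 2)) + ((1 + x) ^ p + (1 - x) ^ p) / 2 * (((p - 1) * (2 * x)) * (-(p / 2)) * (1 + (p - 1) * x ^ 2) ^ (-(p / 2) - 1))))
    (by
      have := cont_one_add p (by linarith)
      have := cont_one_sub p (by linarith)
      have : Continuous (fun t : ℝ => (1 + (p - 1) * t ^ 2) ^ (-(p / 2))) :=
        Continuous.rpow_const (by fun_prop) (fun x => Or.inl (hpos x).ne')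
      fun_prop)
    (fun x hx0 hx1 => by
      have ha := hasDeriv_one_add p x (by linarith)
      have hb := hasDeriv_one_sub p x (by linarith)
      have hc : HasDerivAt (fun t : ℝ => 1 + (p - 1) * t ^ 2) ((p - 1) * (2 * x)) x := by
        simpa using (((hasDerivAt_id x).pow 2).const_mul (p - 1)).const_add 1
      have hcc := hc.rpow_const (p := -(p / 2)) (Or.inl (hpos x).ne')
      exact (((ha.add hb).div_const 2).mul hcc).const_sub 1)
    (by norm_num)
    (fun x hx0 hx1 => by
      have hx' : 1 - x ≠ 0 := by linarith
      have e1 : (1 + x) ^ p = (1 + x) * (1 + x) ^ (p - 1) := by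
        rw [Real.rpow_sub_one (by linarith)]; field_simp
      have e2 : (1 - x) ^ p = (1 - x) * (1 - x) ^ (p - 1) := by
        rw [Real.rpow_sub_one (by linarith)]
        field_simp
      have e3 : (1 + (p - 1) * x ^ 2) ^ (-(p / 2)) = (1 + (p - 1) * x ^ 2) * (1 + (p - 1) * x ^ 2) ^ (-(p / 2) - 1) := by
        rw [Real.rpow_sub_one (hpos x).ne']
        have := (hpos x).ne'
        field_simp
      have hb := bon1 (p - 1) x (by linarith) hx0.le hx1.le
      have hH : 0 < (1 + (p - 1) * x ^ 2) ^ (-(p / 2) - 1) := Real.rpow_pos_of_pos (hpos x) _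
      rw [e1, e2, e3]
      set H := (1 + (p - 1) * x ^ 2) ^ (-(p / 2) - 1)
      set a := (1 + x) ^ (p - 1)
      set b := (1 - x) ^ (p - 1)
      have : 0 ≤ p / 2 * H * ((p - 1) * x * (a + b) - (a - b)) := by
        apply mul_nonneg (by positivity) (by linarith)
      nlinarith) y h0 h1
  simp only [Real.rpow_neg (hpos y).le] at this
  have hH : 0 < (1 + (p - 1) * y ^ 2) ^ (p / 2) := Real.rpow_pos_of_pos (hpos y) _
  rw [sub_nonneg, ← div_eq_mul_inv, div_le_one hH] at this
  exact this

lemma bon3 (p y : ℝ) (hp : 2 ≤ p) (h0 : 0 ≤ y) :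
    ((1 + y) ^ p + |1 - y| ^ p) / 2 ≤ (1 + (p - 1) * y ^ 2) ^ (p / 2) := by
  rcases le_total y 1 with h1 | h1
  · rw [abs_of_nonneg (by linarith)]; exact bon2 p y hp h0 h1
  · have hy : 0 < y := by linarith
    have := bon2 p (1 / y) hp (by positivity) (by rw [div_le_one hy]; exact h1)
    have e1 : 1 + y = y * (1 + 1 / y) := by field_simp; ring
    have e2 : |1 - y| = y * (1 - 1 / y) := by
      rw [abs_of_nonpos (by linarith)]; field_simp; ring
    have h1y : 1 / y ≤ 1 := by rw [div_le_one hy]; exact h1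
    rw [e2, e1, Real.mul_rpow hy.le (by positivity), Real.mul_rpow hy.le (by linarith)]
    have e3 : y ^ p = (y ^ 2) ^ (p / 2) := by
      rw [← Real.rpow_natCast y 2, ← Real.rpow_mul hy.le]; congr 1; push_cast; ring
    have hyp : 0 < y ^ p := Real.rpow_pos_of_pos hy _
    calc (y ^ p * (1 + 1 / y) ^ p + y ^ p * (1 - 1 / y) ^ p) / 2
        = y ^ p * (((1 + 1 / y) ^ p + (1 - 1 / y) ^ p) / 2) := by ring
      _ ≤ y ^ p * (1 + (p - 1) * (1 / y) ^ 2) ^ (p / 2) := by gcongr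
      _ = (y ^ 2 * (1 + (p - 1) * (1 / y) ^ 2)) ^ (p / 2) := by
          rw [e3, Real.mul_rpow (by positivity) (by nlinarith [sq_nonneg (1 / y)])]
      _ ≤ _ := by
          apply Real.rpow_le_rpow
          · apply mul_nonneg (by positivity) (by nlinarith [sq_nonneg (1 / y)])
          · have : y ^ 2 * (1 + (p - 1) * (1 / y) ^ 2) = y ^ 2 + (p - 1) := by field_simp
            rw [this]; nlinarith [mul_nonneg (by linarith : (0:ℝ) ≤ p - 2) (by nlinarith : (0:ℝ) ≤ y ^ 2 - 1)]
          · linarith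

lemma bon (p a b : ℝ) (hp : 2 ≤ p) :
    (|a + b| ^ p + |a - b| ^ p) / 2 ≤ (a ^ 2 + (p - 1) * b ^ 2) ^ (p / 2) := by
  have key : ∀ a b : ℝ, 0 < a → 0 ≤ b → (|a + b| ^ p + |a - b| ^ p) / 2 ≤ (a ^ 2 + (p - 1) * b ^ 2) ^ (p / 2) := by
    intro a b ha hb
    have := bon3 p (b / a) hp (by positivity)
    have e1 : |a + b| = a * (1 + b / a) := by rw [abs_of_nonneg (by linarith)]; field_simp
    have e2 : |a - b| = a * |1 - b / a| := by
      rw [← abs_of_pos ha, ← abs_mul, abs_of_pos ha]; congr 1; field_simp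
    have e3 : a ^ p = (a ^ 2) ^ (p / 2) := by
      rw [← Real.rpow_natCast a 2, ← Real.rpow_mul ha.le]; congr 1; push_cast; ring
    have hap : 0 < a ^ p := Real.rpow_pos_of_pos ha _
    rw [e1, e2, Real.mul_rpow ha.le (by positivity), Real.mul_rpow ha.le (by positivity)]
    calc _ = a ^ p * (((1 + b / a) ^ p + |1 - b / a| ^ p) / 2) := by ring
      _ ≤ a ^ p * (1 + (p - 1) * (b / a) ^ 2) ^ (p / 2) := by gcongr
      _ = (a ^ 2 * (1 + (p - 1) * (b / a) ^ 2)) ^ (p / 2) := by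
          rw [e3, Real.mul_rpow (by positivity) (by nlinarith [sq_nonneg (b / a)])]
      _ = _ := by congr 1; field_simp
  have key2 : ∀ b : ℝ, 0 ≤ b → (|0 + b| ^ p + |0 - b| ^ p) / 2 ≤ (0 ^ 2 + (p - 1) * b ^ 2) ^ (p / 2) := by
    intro b hb
    have e3 : b ^ p = (b ^ 2) ^ (p / 2) := by
      rw [← Real.rpow_natCast b 2, ← Real.rpow_mul hb]; congr 1; push_cast; ring
    simp only [zero_add, zero_sub, abs_neg, abs_of_nonneg hb]
    rw [add_self_div_two, e3]
    apply Real.rpow_le_rpow (by positivity) (by nlinarith [sq_nonneg b]) (by linarith)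
  have key3 : ∀ a b : ℝ, 0 ≤ a → 0 ≤ b → (|a + b| ^ p + |a - b| ^ p) / 2 ≤ (a ^ 2 + (p - 1) * b ^ 2) ^ (p / 2) := by
    intro a b ha hb
    rcases ha.eq_or_lt with rfl | ha
    · exact key2 b hb
    · exact key a b ha hb
  have := key3 |a| |b| (abs_nonneg _) (abs_nonneg _)
  rw [sq_abs, sq_abs] at this
  refine le_trans (le_of_eq ?_) this
  rcases le_total 0 a with ha | ha <;> rcases le_total 0 b with hb | hb
  · rw [abs_of_nonneg ha, abs_of_nonneg hb]
  · rw [abs_of_nonneg ha, abs_of_nonpos hb]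
    have e1 : a + -b = a - b := by ring
    have e2 : a - -b = a + b := by ring
    rw [e1, e2]; ring
  · rw [abs_of_nonpos ha, abs_of_nonneg hb]
    have e1 : |-a + b| = |a - b| := by rw [← abs_neg]; congr 1; ring
    have e2 : |-a - b| = |a + b| := by rw [← abs_neg]; congr 1; ring
    rw [e1, e2]; ring
  · rw [abs_of_nonpos ha, abs_of_nonpos hb]
    have e1 : |-a + -b| = |a + b| := by rw [← abs_neg]; congr 1; ring
    have e2 : |-a - -b| = |a - b| := by rw [← abs_neg]; congr 1; ring
    rw [e1, e2]

/-- s6 -/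
lemma s6 (κ β : ℝ) (h0 : 0 ≤ κ) (h1 : κ ≤ 1) (hb : 1 ≤ β) :
    β ^ κ ≤ 1 + κ * ((1 + κ) / 2 * (β - 1) + (1 - κ) / 2 * (1 - β⁻¹)) := by
  have := nonneg_of_derivab 1 β (fun t => 1 + κ * ((1 + κ) / 2 * (t - 1) + (1 - κ) / 2 * (1 - t⁻¹)) - t ^ κ)
    (fun x => κ * ((1 + κ) / 2 * 1 + (1 - κ) / 2 * (-(-(x ^ 2)⁻¹))) - κ * x ^ (κ - 1))
    (fun x hx _ => by
      have hx0 : x ≠ 0 := by linarith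
      exact ((((((hasDerivAt_id x).sub_const 1).const_mul ((1 + κ) / 2)).add (((hasDerivAt_inv hx0).const_sub 1).const_mul ((1 - κ) / 2))).const_mul κ).const_add 1).sub (Real.hasDerivAt_rpow_const (Or.inl hx0)))
    (by norm_num)
    (fun x hx _ => by
      have hx0 : 0 < x := by linarith
      have := Real.geom_mean_le_arith_mean2_weighted (by linarith : 0 ≤ (1 + κ) / 2) (by linarith : 0 ≤ (1 - κ) / 2) zero_le_one (by positivity : 0 ≤ (x ^ 2)⁻¹) (by ring)
      have e : ((x ^ 2)⁻¹) ^ ((1 - κ) / 2) = x ^ (κ - 1) := by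
        rw [← Real.rpow_natCast x 2, ← Real.rpow_neg hx0.le, ← Real.rpow_mul hx0.le]; congr 1; push_cast; ring
      rw [e, Real.one_rpow, one_mul] at this
      have : 0 ≤ κ * ((1 + κ) / 2 * 1 + (1 - κ) / 2 * (x ^ 2)⁻¹ - x ^ (κ - 1)) := mul_nonneg h0 (by linarith)
      linarith) hb
  linarith

/-- s7, with s = σ^2 -/
lemma s7 (κ σ : ℝ) (h0 : 0 ≤ κ) (h1 : κ ≤ 1) (hs : 0 < σ) (hs1 : σ ≤ 1) :
    1 - κ * ((1 - κ) * (σ⁻¹ - σ) + κ * (1 - σ ^ 2)) ≤ (σ ^ 2) ^ κ := by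
  have hB : (1:ℝ) ≤ σ⁻¹ := (one_le_inv₀ hs).2 hs1
  have := nonneg_of_derivab 1 σ⁻¹ (fun t => κ * ((1 - κ) * (t - t⁻¹) + κ * (1 - (t ^ 2)⁻¹)) + t ^ (-2 * κ) - 1)
    (fun x => κ * ((1 - κ) * (1 - (-(x ^ 2)⁻¹)) + κ * (-(-(2 * x) / (x ^ 2) ^ 2))) + (-2 * κ) * x ^ (-2 * κ - 1))
    (fun x hx _ => by
      have hx0 : x ≠ 0 := by linarith
      have hsq : HasDerivAt (fun t : ℝ => t ^ 2) (2 * x) x := by simpa using hasDerivAt_pow 2 x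
      exact ((((((hasDerivAt_id x).sub (hasDerivAt_inv hx0)).const_mul (1 - κ)).add
        (((hsq.inv (by positivity)).const_sub 1).const_mul κ)).const_mul κ).add (Real.hasDerivAt_rpow_const (Or.inl hx0))).sub_const 1)
    (by norm_num)
    (fun x hx _ => by
      have hx0 : 0 < x := by linarith
      have := Real.geom_mean_le_arith_mean2_weighted (by linarith : 0 ≤ (1 - κ)) h0 (by positivity : 0 ≤ x⁻¹) (by positivity : 0 ≤ (x ^ 3)⁻¹) (by ring)
      have e : (x⁻¹) ^ (1 - κ) * ((x ^ 3)⁻¹) ^ κ = x ^ (-2 * κ - 1) := by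
        rw [← Real.rpow_natCast x 3, ← Real.rpow_neg hx0.le, ← Real.rpow_mul hx0.le, Real.inv_rpow hx0.le, ← Real.rpow_neg hx0.le, ← Real.rpow_add hx0]; congr 1; push_cast; ring
      rw [e] at this
      have h2 : 2 * x⁻¹ ≤ 1 + (x ^ 2)⁻¹ := by
        have := sq_nonneg (1 - x⁻¹)
        have e : (x ^ 2)⁻¹ = x⁻¹ ^ 2 := by rw [inv_pow]
        rw [e]; nlinarith
      have h3 : (-(-(2 * x) / (x ^ 2) ^ 2)) = 2 * (x ^ 3)⁻¹ := by field_simp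
      rw [h3]
      have : 0 ≤ κ * ((1 - κ) * (1 + (x ^ 2)⁻¹) + κ * (2 * (x ^ 3)⁻¹) - 2 * x ^ (-2 * κ - 1)) := by
        apply mul_nonneg h0
        nlinarith
      linarith) hB
  have e : σ⁻¹ ^ (-2 * κ) = (σ ^ 2) ^ κ := by
    rw [Real.inv_rpow hs.le, ← Real.rpow_neg hs.le, ← Real.rpow_natCast σ 2, ← Real.rpow_mul hs.le]
    congr 1; push_cast; ring
  rw [e, inv_inv, inv_pow, inv_inv] at this
  linarith


lemma sig1 (σ : ℝ) (h0 : 0 ≤ σ) : σ - σ ^ 3 ≤ 0.386 := by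
  nlinarith [mul_nonneg (by linarith : 0 ≤ σ + 1.154) (sq_nonneg (σ - 0.577))]

lemma sub_rpow_bound (κ s : ℝ) (h0 : 0 ≤ κ) (h1 : κ ≤ 1) (hs : 0 < s) (hs1 : s ≤ 1) :
    (2 + κ) * (s - s ^ (1 + κ)) ≤ κ := by
  set σ := Real.sqrt s with hσ
  have hσ0 : 0 < σ := Real.sqrt_pos.2 hs
  have hσ1 : σ ≤ 1 := Real.sqrt_le_iff.2 ⟨by norm_num, by simpa using hs1⟩
  have hsq : s = σ ^ 2 := (Real.sq_sqrt hs.le).symm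
  have h7 := s7 κ σ h0 h1 hσ0 hσ1
  rw [← hsq] at h7
  have e : s ^ (1 + κ) = s * s ^ κ := by rw [Real.rpow_add hs, Real.rpow_one]
  rw [e]
  have h8 : s * (1 - κ * ((1 - κ) * (σ⁻¹ - σ) + κ * (1 - s))) ≤ s * s ^ κ := by gcongr
  have h9 : s * (σ⁻¹ - σ) = σ - σ ^ 3 := by rw [hsq]; field_simp
  have h10 : s * (1 - s) ≤ 1 / 4 := by nlinarith [sq_nonneg (s - 1/2)]
  have h11 := sig1 σ hσ0.le
  have h12 : s - s * s ^ κ ≤ κ * ((1 - κ) * (s * (σ⁻¹ - σ)) + κ * (s * (1 - s))) := by linarith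
  rw [h9] at h12
  have h13 : (1 - κ) * (σ - σ ^ 3) + κ * (s * (1 - s)) ≤ (1 - κ) * 0.386 + κ * (1 / 4) := by
    gcongr
  have h14 : s - s * s ^ κ ≤ κ * ((1 - κ) * 0.386 + κ * (1 / 4)) := h12.trans (by gcongr)
  have h15 : (2 + κ) * ((1 - κ) * 0.386 + κ * (1 / 4)) ≤ 1 := by nlinarith
  nlinarith

lemma sup_small (p x : ℝ) (hp : 2 ≤ p) (h0 : 0 ≤ x) (h1 : x ≤ 1) :
    1 + p * x + x ^ p ≤ (1 + x) ^ p := by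
  have := nonneg_of_deriv01 (fun t => (1 + t) ^ p - t ^ p - p * t - 1)
    (fun x => p * (1 + x) ^ (p - 1) - p * x ^ (p - 1) - p * 1)
    (by
      have := cont_one_add p (by linarith)
      have : Continuous (fun t : ℝ => t ^ p) := continuous_id.rpow_const (fun _ => Or.inr (by linarith))
      fun_prop)
    (fun x hx0 hx1 => by
      exact (((hasDeriv_one_add p x (by linarith)).sub (Real.hasDerivAt_rpow_const (Or.inl hx0.ne'))).sub ((hasDerivAt_id x).const_mul p)).sub_const 1)
    (by norm_num; rw [Real.zero_rpow (by linarith)])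
    (fun x hx0 hx1 => by
      have := Real.add_rpow_le_rpow_add zero_le_one hx0.le (by linarith : 1 ≤ p - 1)
      rw [Real.one_rpow] at this
      nlinarith) x h0 h1
  linarith

lemma sub_small (p x : ℝ) (hp : 2 ≤ p) (h0 : 0 ≤ x) (h1 : x ≤ 1) :
    1 - p * x + x ^ p ≤ (1 - x) ^ p := by
  have := nonneg_of_deriv01 (fun t => (1 - t) ^ p - t ^ p + p * t - 1)
    (fun x => (-(p * (1 - x) ^ (p - 1))) - p * x ^ (p - 1) + p * 1)
    (by
      have := cont_one_sub p (by linarith)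
      have : Continuous (fun t : ℝ => t ^ p) := continuous_id.rpow_const (fun _ => Or.inr (by linarith))
      fun_prop)
    (fun x hx0 hx1 => by
      exact (((hasDeriv_one_sub p x (by linarith)).sub (Real.hasDerivAt_rpow_const (Or.inl hx0.ne'))).add ((hasDerivAt_id x).const_mul p)).sub_const 1)
    (by norm_num; rw [Real.zero_rpow (by linarith)])
    (fun x hx0 hx1 => by
      have := Real.add_rpow_le_rpow_add (by linarith : 0 ≤ 1 - x) hx0.le (by linarith : 1 ≤ p - 1)
      rw [sub_add_cancel, Real.one_rpow] at this
      nlinarith) x h0 h1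
  linarith

lemma s5 (κ ρ : ℝ) (h0 : 0 ≤ κ) (h1 : κ ≤ 1) :
    1 + (2 + κ) * ρ + (1 - κ) * |ρ| ^ (2 + κ) ≤ |1 + ρ| ^ (2 + κ) := by
  have inv : ∀ z : ℝ, 1 ≤ z → ∀ w : ℝ, z ^ (2 + κ) * (1 + w * (1 / z) + (1 / z) ^ (2 + κ))
      = z ^ (2 + κ) + w * z ^ (1 + κ) + 1 := by
    intro z hz w
    have hz0 : 0 < z := by linarith
    have e1 : z ^ (2 + κ) = z * z ^ (1 + κ) := by
      rw [show 2 + κ = 1 + (1 + κ) by ring, Real.rpow_add hz0, Real.rpow_one]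
    have e2 : z ^ (2 + κ) * (1 / z) ^ (2 + κ) = 1 := by
      rw [← Real.mul_rpow hz0.le (by positivity)]; field_simp; simp
    rw [mul_add, e2, e1]; field_simp
  rcases le_total 0 ρ with hr | hr
  · rw [abs_of_nonneg hr, abs_of_nonneg (by linarith)]
    have hrp : 0 ≤ ρ ^ (2 + κ) := Real.rpow_nonneg hr _
    rcases le_total ρ 1 with h | h
    · have := sup_small (2 + κ) ρ (by linarith) hr h
      nlinarith
    · have hz0 : 0 < ρ := by linarith
      have := sup_small (2 + κ) (1 / ρ) (by linarith) (by positivity) (by rw [div_le_one hz0]; exact h)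
      have h2 := mul_le_mul_of_nonneg_left this hrp
      rw [inv ρ h, ← Real.mul_rpow hz0.le (by positivity)] at h2
      have e : ρ * (1 + 1 / ρ) = 1 + ρ := by field_simp; ring
      rw [e] at h2
      have h3 : ρ ≤ ρ ^ (1 + κ) := by
        conv_lhs => rw [← Real.rpow_one ρ]
        exact Real.rpow_le_rpow_of_exponent_le h (by linarith)
      nlinarith
  · obtain ⟨z, rfl⟩ : ∃ z, ρ = -z := ⟨-ρ, by ring⟩
    have hz : 0 ≤ z := by linarith
    rw [abs_neg, abs_of_nonneg hz, ← sub_eq_add_neg]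
    have hrp : 0 ≤ z ^ (2 + κ) := Real.rpow_nonneg hz _
    rcases le_total z 1 with h | h
    · rw [abs_of_nonneg (by linarith)]
      have := sub_small (2 + κ) z (by linarith) hz h
      nlinarith
    · have hz0 : 0 < z := by linarith
      have hz1 : 1 / z ≤ 1 := by rw [div_le_one hz0]; exact h
      have := sub_small (2 + κ) (1 / z) (by linarith) (by positivity) hz1
      rw [sub_eq_add_neg 1, ← neg_mul] at this
      have h2 := mul_le_mul_of_nonneg_left this hrp
      rw [inv z h, ← Real.mul_rpow hz0.le (by linarith)] at h2
      have e : z * (1 - 1 / z) = |1 - z| := by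
        rw [abs_of_nonpos (by linarith)]; field_simp; ring
      rw [e] at h2
      have h3 := sub_rpow_bound κ (1 / z) h0 h1 (by positivity) hz1
      have h4 := mul_le_mul_of_nonneg_left h3 hrp
      have e2 : z ^ (2 + κ) * (1 / z) = z ^ (1 + κ) := by
        rw [show 2 + κ = 1 + (1 + κ) by ring, Real.rpow_add hz0, Real.rpow_one]; field_simp
      have e3 : z ^ (2 + κ) * (1 / z) ^ (1 + κ) = z := by
        rw [show 2 + κ = 1 + (1 + κ) by ring, Real.rpow_add hz0, Real.rpow_one, mul_assoc, ← Real.mul_rpow hz0.le (by positivity)]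
        field_simp; simp
      have e4 : z ^ (2 + κ) * ((2 + κ) * (1 / z - (1 / z) ^ (1 + κ))) = (2 + κ) * (z ^ (1 + κ) - z) := by
        linear_combination (2 + κ) * e2 - (2 + κ) * e3
      rw [e4] at h4
      nlinarith


lemma bb (a c b d : ℝ) (ha : 0 ≤ a) (hc : 0 ≤ c) (hb : 0 ≤ b) (hd : 0 ≤ d) :
    0 ≤ a^0*c^6*(b^0*d^5) ∧
    0 ≤ a^0*c^6*(b^1*d^4) ∧
    0 ≤ a^0*c^6*(b^2*d^3) ∧
    0 ≤ a^0*c^6*(b^3*d^2) ∧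
    0 ≤ a^0*c^6*(b^4*d^1) ∧
    0 ≤ a^0*c^6*(b^5*d^0) ∧
    0 ≤ a^1*c^5*(b^0*d^5) ∧
    0 ≤ a^1*c^5*(b^1*d^4) ∧
    0 ≤ a^1*c^5*(b^2*d^3) ∧
    0 ≤ a^1*c^5*(b^3*d^2) ∧
    0 ≤ a^1*c^5*(b^4*d^1) ∧
    0 ≤ a^1*c^5*(b^5*d^0) ∧
    0 ≤ a^2*c^4*(b^0*d^5) ∧
    0 ≤ a^2*c^4*(b^1*d^4) ∧
    0 ≤ a^2*c^4*(b^2*d^3) ∧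
    0 ≤ a^2*c^4*(b^3*d^2) ∧
    0 ≤ a^2*c^4*(b^4*d^1) ∧
    0 ≤ a^2*c^4*(b^5*d^0) ∧
    0 ≤ a^3*c^3*(b^0*d^5) ∧
    0 ≤ a^3*c^3*(b^1*d^4) ∧
    0 ≤ a^3*c^3*(b^2*d^3) ∧
    0 ≤ a^3*c^3*(b^3*d^2) ∧
    0 ≤ a^3*c^3*(b^4*d^1) ∧
    0 ≤ a^3*c^3*(b^5*d^0) ∧
    0 ≤ a^4*c^2*(b^0*d^5) ∧
    0 ≤ a^4*c^2*(b^1*d^4) ∧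
    0 ≤ a^4*c^2*(b^2*d^3) ∧
    0 ≤ a^4*c^2*(b^3*d^2) ∧
    0 ≤ a^4*c^2*(b^4*d^1) ∧
    0 ≤ a^4*c^2*(b^5*d^0) ∧
    0 ≤ a^5*c^1*(b^0*d^5) ∧
    0 ≤ a^5*c^1*(b^1*d^4) ∧
    0 ≤ a^5*c^1*(b^2*d^3) ∧
    0 ≤ a^5*c^1*(b^3*d^2) ∧
    0 ≤ a^5*c^1*(b^4*d^1) ∧
    0 ≤ a^5*c^1*(b^5*d^0) ∧
    0 ≤ a^6*c^0*(b^0*d^5) ∧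
    0 ≤ a^6*c^0*(b^1*d^4) ∧
    0 ≤ a^6*c^0*(b^2*d^3) ∧
    0 ≤ a^6*c^0*(b^3*d^2) ∧
    0 ≤ a^6*c^0*(b^4*d^1) ∧
    0 ≤ a^6*c^0*(b^5*d^0) := by
  refine ⟨?_, ?_, ?_, ?_, ?_, ?_, ?_, ?_, ?_, ?_, ?_, ?_, ?_, ?_, ?_, ?_, ?_, ?_, ?_, ?_, ?_, ?_, ?_, ?_, ?_, ?_, ?_, ?_, ?_, ?_, ?_, ?_, ?_, ?_, ?_, ?_, ?_, ?_, ?_, ?_, ?_, ?_⟩ <;> positivity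


noncomputable def B6 (c0 c1 c2 c3 c4 c5 c6 a c : ℝ) : ℝ :=
  c0 * c ^ 6 + c1 * a * c ^ 5 + c2 * a ^ 2 * c ^ 4 + c3 * a ^ 3 * c ^ 3 + c4 * a ^ 4 * c ^ 2 + c5 * a ^ 5 * c + c6 * a ^ 6

lemma B6_nonneg (c0 c1 c2 c3 c4 c5 c6 a c : ℝ) (ha : 0 ≤ a) (hc : 0 ≤ c) (h0 : 0 ≤ c0) (h1 : 0 ≤ c1) (h2 : 0 ≤ c2)
    (h3 : 0 ≤ c3) (h4 : 0 ≤ c4) (h5 : 0 ≤ c5) (h6 : 0 ≤ c6) : 0 ≤ B6 c0 c1 c2 c3 c4 c5 c6 a c := by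
  unfold B6; positivity

noncomputable def B5 (c0 c1 c2 c3 c4 c5 a c : ℝ) : ℝ :=
  c0 * c ^ 5 + c1 * a * c ^ 4 + c2 * a ^ 2 * c ^ 3 + c3 * a ^ 3 * c ^ 2 + c4 * a ^ 4 * c + c5 * a ^ 5

lemma B5_nonneg (c0 c1 c2 c3 c4 c5 a c : ℝ) (ha : 0 ≤ a) (hc : 0 ≤ c) (h0 : 0 ≤ c0) (h1 : 0 ≤ c1) (h2 : 0 ≤ c2)
    (h3 : 0 ≤ c3) (h4 : 0 ≤ c4) (h5 : 0 ≤ c5) : 0 ≤ B5 c0 c1 c2 c3 c4 c5 a c := by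
  unfold B5; positivity

noncomputable def Qpol (k X : ℝ) : ℝ :=
  ((((1.62*(1-k)+4/3*k)*(1-k^2/4)+X*(2+X)*(0.81*k-0.48*k^2+0.205*k^3))+(1+k)*X)*
    ((2+2*k*(X*(1-(1-k)*X/4))-((1.62*(1-k)+4/3*k)*(1-k^2/4)+X*(2+X)*(0.81*k-0.48*k^2+0.205*k^3)))*(2+X)
      -(1+k)^2*X^2/3) - 4*X*(1-(1-k)*X/4)^2*(1+k))

lemma qbox0 (k X : ℝ) (h0 : 0 ≤ k) (h1 : k ≤ 1/5) (hx0 : 0 ≤ X) (hx1 : X ≤ 31/50) :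
    0 ≤ Qpol k X := by
  obtain ⟨a, ha⟩ : ∃ a, a = k - 0 := ⟨_, rfl⟩
  obtain ⟨c, hc⟩ : ∃ c, c = 1/5 - k := ⟨_, rfl⟩
  obtain ⟨d, hd⟩ : ∃ d, d = 31/50 - X := ⟨_, rfl⟩
  have ha0 : 0 ≤ a := by linarith
  have hc0 : 0 ≤ c := by linarith
  have hd0 : 0 ≤ d := by linarith
  have e : Qpol k X = B5 (B6 (6011718750000/28629151) (110293750000000/85887453) (844300859375000/257662359) (1150274562500000/257662359) (882231712109375/257662359) (120357123125000/85887453) (6843234750000/28629151) a c) (B6 (22113632812500/28629151) (408734093750000/85887453) (350932117968750/28629151) (1450230425937500/85887453) (4504358331484375/343549812) (467053845362500/85887453) (26930470127500/28629151) a c) (B6 (31790937500000/28629151) (1775884413125000/257662359) (4629130514875000/257662359) (6477656561412500/257662359) (5124664721730625/257662359) (241137259739875/28629151) (42651222558075/28629151) a c) (B6 (66388115234375/85887453) (136822261246875/28629151) (3231682736643125/257662359) (4595178716209250/257662359) (14883293608202675/1030649436) (4322521879321735/687099624) (131489282706929/114516604) a c) (B6 (21845605468750/85887453) (127832796615625/85887453)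 (1302078971148025/343549812) (922532506675835/171774906) (126984300581755/28629151) (1721313743524651/858874530) (4388143598768077/11451660400) a c) (B6 (2524560546875/85887453) (32661420500000/257662359) (955966812694951/4122597744) (2608887795626177/10306494360) (1990773779747371/10306494360) (5563612940494543/57258302000) (25900955612149229/1145166040000) a c) X d := by
    rw [ha, hc, hd]; unfold Qpol B5 B6; ring
  rw [e]; apply B5_nonneg _ _ _ _ _ _ _ _ hx0 hd0 <;> apply B6_nonneg _ _ _ _ _ _ _ _ _ ha0 hc0 <;> positivity

lemma qbox1 (k X : ℝ) (h0 : 1/5 ≤ k) (h1 : k ≤ 3/10) (hx0 : 0 ≤ X) (hx1 : X ≤ 33/50) :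
    0 ≤ Qpol k X := by
  obtain ⟨a, ha⟩ : ∃ a, a = k - 1/5 := ⟨_, rfl⟩
  obtain ⟨c, hc⟩ : ∃ c, c = 3/10 - k := ⟨_, rfl⟩
  obtain ⟨d, hd⟩ : ∃ d, d = 33/50 - X := ⟨_, rfl⟩
  have ha0 : 0 ≤ a := by linarith
  have hc0 : 0 ≤ c := by linarith
  have hd0 : 0 ≤ d := by linarith
  have e : Qpol k X = B5 (B6 (13271728000000/1185921) (7973681708000000/117406179) (60491062283750000/352218537) (81585628992500000/352218537) (5626852549375000/32019867) (2782568315375000/39135393) (469071709234375/39135393) a c) (B6 (17105729120000/395307) (31056046798960000/117406179) (237356487316487500/352218537) (322554480751225000/352218537) (22417049921018750/32019867) (11171573504626250/39135393) (7591796099541875/156541572) a c) (B6 (79939490590400/1185921) (48939051866074400/117406179) (378489703085462000/352218537) (520594127230094000/352218537) (36625823431799500/32019867) (18479006380129550/39135393) (3178505439252325/39135393) a c) (B6 (496821085936/9801) (37395947461193516/117406179) (294058033430680430/352218537) (411404047314939410/352218537) (2677072668572630/2910897) (60470283635836973/156541572) (21166167494753879/313083144) a c) (B6 (17138572671388/1098075)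 (294982133916175036/2935154475) (476310945433675751/1761092685) (685028233113376442/1761092685) (201743592048347929/640397340) (532721042275061333/3913539300) (383549310819532793/15654157200) a c) (B6 (156183122215259/741200625) (146185238809068299/73378861875) (1303184029781118061/176109268500) (1223595371176036481/88054634250) (899524806379336919/64039734000) (2860037063223556313/391353930000) (2409466134201262123/1565415720000) a c) X d := by
    rw [ha, hc, hd]; unfold Qpol B5 B6; ring
  rw [e]; apply B5_nonneg _ _ _ _ _ _ _ _ hx0 hd0 <;> apply B6_nonneg _ _ _ _ _ _ _ _ _ ha0 hc0 <;> positivity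

lemma qbox2 (k X : ℝ) (h0 : 3/10 ≤ k) (h1 : k ≤ 2/5) (hx0 : 0 ≤ X) (hx1 : X ≤ 7/10) :
    0 ≤ Qpol k X := by
  obtain ⟨a, ha⟩ : ∃ a, a = k - 3/10 := ⟨_, rfl⟩
  obtain ⟨c, hc⟩ : ∃ c, c = 2/5 - k := ⟨_, rfl⟩
  obtain ⟨d, hd⟩ : ∃ d, d = 7/10 - X := ⟨_, rfl⟩
  have ha0 : 0 ≤ a := by linarith
  have hc0 : 0 ≤ c := by linarith
  have hd0 : 0 ≤ d := by linarith
  have e : Qpol k X = B5 (B6 (150102946955/16807) (910813502540/16807) (20724144846700/151263) (27941140196800/151263) (21187861196800/151263) (2855944529920/50421) (160373637120/16807) a c) (B6 (2394666619293/67228) (10986780969763/50421) (84011779140805/151263) (114198797529520/151263) (87309097414720/151263) (3955023655936/16807) (671719641088/16807) a c) (B6 (14902507127209/252105) (277051645445926/756315) (143075446685804/151263) (21890699832544/16807) (152576712860416/151263) (315018666242816/756315) (18061160677376/252105) a c) (B6 (489561614867923/10084200) (1544247266016737/5042100) (608846426767286/756315) (853285927810664/756315) (672390357228944/756315) (156903473014816/420175)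 (82325595704384/1260525) a c) (B6 (1667233373131859/100842000) (451747501911533/4201750) (1101052604511439/3781575) (1588737073059796/3781575) (1287786522338956/3781575) (926395880072192/6302625) (55437189438912/2100875) a c) (B6 (696238198873711/2016840000) (649802377805347/189078750) (945065927005231/75631500) (141909609691307/6302625) (411441891151931/18907875) (1025140982973976/94539375) (69169322341136/31513125) a c) X d := by
    rw [ha, hc, hd]; unfold Qpol B5 B6; ring
  rw [e]; apply B5_nonneg _ _ _ _ _ _ _ _ hx0 hd0 <;> apply B6_nonneg _ _ _ _ _ _ _ _ _ ha0 hc0 <;> positivity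

lemma qbox3 (k X : ℝ) (h0 : 2/5 ≤ k) (h1 : k ≤ 3/5) (hx0 : 0 ≤ X) (hx1 : X ≤ 39/50) :
    0 ≤ Qpol k X := by
  obtain ⟨a, ha⟩ : ∃ a, a = k - 2/5 := ⟨_, rfl⟩
  obtain ⟨c, hc⟩ : ∃ c, c = 3/5 - k := ⟨_, rfl⟩
  obtain ⟨d, hd⟩ : ∃ d, d = 39/50 - X := ⟨_, rfl⟩
  have ha0 : 0 ≤ a := by linarith
  have hc0 : 0 ≤ c := by linarith
  have hd0 : 0 ≤ d := by linarith
  have e : Qpol k X = B5 (B6 (2610248000000/30074733) (143959343000000/270672597) (1102070615000000/812017791) (1498732720625000/812017791) (1145401627109375/812017791) (155452956437500/270672597) (225130062500/2313441) a c) (B6 (10690845080000/30074733) (600167803780000/270672597) (4676126072462500/812017791) (6470522877456250/812017791) (20120199925178125/3248071164) (694149869226875/270672597) (340595073125/771147) a c) (B6 (19104863129600/30074733) (1102318853948600/270672597) (8822090634293000/812017791) (12530145486198500/812017791) (9989934636872375/812017791) (1412685558322225/270672597) (709686615025/771147) a c) (B6 (17290914666377/30074733) (1033263830991407/270672597) (8551661479215035/812017791)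 (12539163430663445/812017791) (20604678916063495/1624035582) (11989634722674311/2165380776) (4639358212993/4626882) a c) (B6 (159034149495461/751868325) (10098365928212626/6766814925) (70681170451094999/16240355820) (54495954945554389/8120177910) (93713473501653659/16240355820) (71013940740649949/27067259700) (152069634156289/308458800) a c) (B6 (120483016768793/75186832500) (34906775866867313/676681492500) (413946261065022187/1624035582000) (434423228277499757/812017791000) (921123779213422267/1624035582000) (101729700287056739/338340746250) (1961037795807457/30845880000) a c) X d := by
    rw [ha, hc, hd]; unfold Qpol B5 B6; ring
  rw [e]; apply B5_nonneg _ _ _ _ _ _ _ _ hx0 hd0 <;> apply B6_nonneg _ _ _ _ _ _ _ _ _ ha0 hc0 <;> positivity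

lemma qbox4 (k X : ℝ) (h0 : 3/5 ≤ k) (h1 : k ≤ 1) (hx0 : 0 ≤ X) (hx1 : X ≤ 47/50) :
    0 ≤ Qpol k X := by
  obtain ⟨a, ha⟩ : ∃ a, a = k - 3/5 := ⟨_, rfl⟩
  obtain ⟨c, hc⟩ : ∃ c, c = 1 - k := ⟨_, rfl⟩
  obtain ⟨d, hd⟩ : ∃ d, d = 47/50 - X := ⟨_, rfl⟩
  have ha0 : 0 ≤ a := by linarith
  have hc0 : 0 ≤ c := by linarith
  have hd0 : 0 ≤ d := by linarith
  have e : Qpol k X = B5 (B6 (2195018109375/3669520112) (10201124921875/2752140084) (157328555078125/16512840504) (107248244140625/8256420252) (326857021484375/33025681008) (915527343750/229345007) (152587890625/229345007) a c) (B6 (39018702810625/14678080448) (15683513315625/917380028) (3008500835546875/66051362016) (2122850071953125/33025681008) (6690036184765625/132102724032) (232430974609375/11008560336) (3338623046875/917380028) a c) (B6 (254647035986975/44034241344) (1291669022178625/33025681008) (14435488159238125/132102724032) (110990296990625/688035021) (17528731504484375/132102724032) (1905234087734375/33025681008) (456471670703125/44034241344) a c) (B6 (572979569414477/88068482688) (8160818217714485/176136965376)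 (71679494082484775/528410896128) (55197738139520875/264205448064) (23594229744951875/132102724032) (14171114650215625/176136965376) (2631742389953125/176136965376) a c) (B6 (51004090044316799/17613696537600) (39549926709204871/1761369653760) (149190576431223755/2113643584512) (60960864389645495/528410896128) (219142640118934475/2113643584512) (5721746501547625/117424643584) (2203670984308125/234849287168) a c) (B6 (41554389366641517/587123217920000) (824242860242284537/528410896128000) (312774932352241919/42272871690240) (53975402645356517/3522739307520) (136025485455510971/8454574338048) (35690165489516605/4227287169024) (1657392557853925/939397148672) a c) X d := by
    rw [ha, hc, hd]; unfold Qpol B5 B6; ring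
  rw [e]; apply B5_nonneg _ _ _ _ _ _ _ _ hx0 hd0 <;> apply B6_nonneg _ _ _ _ _ _ _ _ _ ha0 hc0 <;> positivity

lemma qpos (k X : ℝ) (h0 : 0 ≤ k) (h1 : k ≤ 1) (hx0 : 0 ≤ X) (hX : X * (2 + X) ≤ 4 / 3 * (1 + k)) :
    0 ≤ Qpol k X := by
  have top : ∀ κ : ℝ, 0 ≤ κ → κ ≤ 1 → k ≤ κ → X ≤ 0.54 + 0.4 * κ := by
    intro κ h2 h3 h4
    by_contra h
    push Not at h
    have h5 : (0.54 + 0.4 * κ) * (2 + (0.54 + 0.4 * κ)) ≤ X * (2 + X) := by gcongr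
    nlinarith [sq_nonneg (κ - 0.32)]
  rcases le_total k 0.2 with h | h
  · exact qbox0 k X (by linarith) (by linarith) hx0 (by linarith [top 0.2 (by norm_num) (by norm_num) h])
  rcases le_total k 0.3 with h' | h'
  · exact qbox1 k X (by linarith) (by linarith) hx0 (by linarith [top 0.3 (by norm_num) (by norm_num) h'])
  rcases le_total k 0.4 with h2 | h2
  · exact qbox2 k X (by linarith) (by linarith) hx0 (by linarith [top 0.4 (by norm_num) (by norm_num) h2])
  rcases le_total k 0.6 with h3 | h3
  · exact qbox3 k X (by linarith) (by linarith) hx0 (by linarith [top 0.6 (by norm_num) (by norm_num) h3])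
  · exact qbox4 k X (by linarith) (by linarith) hx0 (by linarith [top 1 (by norm_num) (by norm_num) h1])


noncomputable def c1p (k X : ℝ) : ℝ :=
  (1.62*(1-k)+4/3*k)*(1-k^2/4)+X*(2+X)*(0.81*k-0.48*k^2+0.205*k^3)
noncomputable def ellp (k X : ℝ) : ℝ := X*(1-(1-k)*X/4)

lemma topX (k X : ℝ) (h0 : 0 ≤ k) (h1 : k ≤ 1) (hx0 : 0 ≤ X) (hX : X * (2 + X) ≤ 4 / 3 * (1 + k)) :
    ∀ κ : ℝ, 0 ≤ κ → κ ≤ 1 → k ≤ κ → X ≤ 0.54 + 0.4 * κ := by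
  intro κ h2 h3 h4
  by_contra h
  push Not at h
  have h5 : (0.54 + 0.4 * κ) * (2 + (0.54 + 0.4 * κ)) ≤ X * (2 + X) := by gcongr
  nlinarith [sq_nonneg (κ - 0.32)]

set_option maxHeartbeats 4000000 in
lemma r1pos (k X : ℝ) (h0 : 0 ≤ k) (h1 : k ≤ 1) (hx0 : 0 ≤ X) (hx1 : X ≤ 0.94) :
    2 * ellp k X ≤ c1p k X := by
  obtain ⟨g0, g1, g2, g3, g4, g5, g6, g7, g8, g9, g10, g11, g12, g13, g14, g15, g16, g17, g18, g19, g20, g21, g22, g23, g24, g25, g26, g27, g28, g29, g30, g31, g32, g33, g34, g35, g36, g37, g38, g39, g40, g41⟩ := bb k (1-k) X (0.94-X) (by linarith) (by linarith) hx0 (by linarith)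
  clear h0 h1 hx0 hx1
  unfold ellp c1p
  linarith

set_option maxHeartbeats 4000000 in
lemma rbox0 (k X : ℝ) (h0 : (0/100) ≤ k) (h1 : k ≤ (30/100)) (hx0 : 0 ≤ X) (hx1 : X ≤ (66/100)) :
    0 ≤ (c1p k X-4*ellp k X)*(1+k)+(2+2*k*ellp k X-c1p k X)*(X*(2+X)) := by
  obtain ⟨g0, g1, g2, g3, g4, g5, g6, g7, g8, g9, g10, g11, g12, g13, g14, g15, g16, g17, g18, g19, g20, g21, g22, g23, g24, g25, g26, g27, g28, g29, g30, g31, g32, g33, g34, g35, g36, g37, g38, g39, g40, g41⟩ := bb (k-(0/100)) ((30/100)-k) X ((66/100)-X) (by linarith) (by linarith) hx0 (by linarith)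
  clear h0 h1 hx0 hx1
  unfold ellp c1p
  linarith

set_option maxHeartbeats 4000000 in
lemma rbox1 (k X : ℝ) (h0 : (30/100) ≤ k) (h1 : k ≤ (60/100)) (hx0 : 0 ≤ X) (hx1 : X ≤ (78/100)) :
    0 ≤ (c1p k X-4*ellp k X)*(1+k)+(2+2*k*ellp k X-c1p k X)*(X*(2+X)) := by
  obtain ⟨g0, g1, g2, g3, g4, g5, g6, g7, g8, g9, g10, g11, g12, g13, g14, g15, g16, g17, g18, g19, g20, g21, g22, g23, g24, g25, g26, g27, g28, g29, g30, g31, g32, g33, g34, g35, g36, g37, g38, g39, g40, g41⟩ := bb (k-(30/100)) ((60/100)-k) X ((78/100)-X) (by linarith) (by linarith) hx0 (by linarith)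
  clear h0 h1 hx0 hx1
  unfold ellp c1p
  linarith

set_option maxHeartbeats 4000000 in
lemma rbox2 (k X : ℝ) (h0 : (60/100) ≤ k) (h1 : k ≤ (100/100)) (hx0 : 0 ≤ X) (hx1 : X ≤ (94/100)) :
    0 ≤ (c1p k X-4*ellp k X)*(1+k)+(2+2*k*ellp k X-c1p k X)*(X*(2+X)) := by
  obtain ⟨g0, g1, g2, g3, g4, g5, g6, g7, g8, g9, g10, g11, g12, g13, g14, g15, g16, g17, g18, g19, g20, g21, g22, g23, g24, g25, g26, g27, g28, g29, g30, g31, g32, g33, g34, g35, g36, g37, g38, g39, g40, g41⟩ := bb (k-(60/100)) ((100/100)-k) X ((94/100)-X) (by linarith) (by linarith) hx0 (by linarith)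
  clear h0 h1 hx0 hx1
  unfold ellp c1p
  linarith

lemma r2pos (k X : ℝ) (h0 : 0 ≤ k) (h1 : k ≤ 1) (hx0 : 0 ≤ X) (hX : X * (2 + X) ≤ 4 / 3 * (1 + k)) :
    0 ≤ (c1p k X-4*ellp k X)*(1+k)+(2+2*k*ellp k X-c1p k X)*(X*(2+X)) := by
  have top := topX k X h0 h1 hx0 hX
  rcases le_total k 0.3 with h' | h'
  · exact rbox0 k X (by linarith) (by linarith) hx0 (by linarith [top 0.3 (by norm_num) (by norm_num) h'])
  rcases le_total k 0.6 with h3 | h3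
  · exact rbox1 k X (by linarith) (by linarith) hx0 (by linarith [top 0.6 (by norm_num) (by norm_num) h3])
  · exact rbox2 k X (by linarith) (by linarith) hx0 (by linarith [top 1 (by norm_num) (by norm_num) h1])

lemma c1pos (k X : ℝ) (h0 : 0 ≤ k) (h1 : k ≤ 1) (hx0 : 0 ≤ X) : 0 < c1p k X := by
  unfold c1p
  have e1 : 0 < 1.62*(1-k)+4/3*k := by linarith
  have e2 : 0 < 1 - k^2/4 := by nlinarith
  have e3 : 0 ≤ 0.81*k-0.48*k^2+0.205*k^3 := by
    have : 0 ≤ k * (0.81-0.48*k+0.205*k^2) := mul_nonneg h0 (by nlinarith)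
    linarith
  positivity

lemma c1le (k X : ℝ) (h0 : 0 ≤ k) (h1 : k ≤ 1) (hx0 : 0 ≤ X) (hX : X * (2 + X) ≤ 4 / 3 * (1 + k)) :
    c1p k X ≤ 2 + 2 * k * ellp k X := by
  have hq := qpos k X h0 h1 hx0 hX
  have hc := c1pos k X h0 h1 hx0
  have e : Qpol k X = (c1p k X + (1+k)*X) * ((2+2*k*ellp k X - c1p k X)*(2+X) - (1+k)^2*X^2/3)
    - 4*X*(1-(1-k)*X/4)^2*(1+k) := by unfold Qpol c1p ellp; ring
  rw [e] at hq
  by_contra h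
  push Not at h
  have e1 : (2+2*k*ellp k X - c1p k X)*(2+X) - (1+k)^2*X^2/3 < 0 := by
    have : (2+2*k*ellp k X - c1p k X)*(2+X) < 0 := mul_neg_of_neg_of_pos (by linarith) (by linarith)
    have : 0 ≤ (1+k)^2*X^2/3 := by positivity
    linarith
  have e2 : (c1p k X + (1+k)*X) * ((2+2*k*ellp k X - c1p k X)*(2+X) - (1+k)^2*X^2/3) < 0 :=
    mul_neg_of_pos_of_neg (by positivity) e1
  have e3 : 0 ≤ 4*X*(1-(1-k)*X/4)^2*(1+k) := by positivity
  linarith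

/-- lower bound for the constant -/
lemma c1ge (k X T2 : ℝ) (h0 : 0 ≤ k) (h1 : k ≤ 1) (hT : (1 + k) * T2 = X * (2 + X)) (hx0 : 0 ≤ X) :
    (1.62*(1-k)+4/3*k) * (1 + k/2) * (1 + k/2*(T2 - 1)) ≤ c1p k X := by
  have hb : (1.62*(1-k)+4/3*k) * (1+k/2)*k/2 ≤ (0.81*k-0.48*k^2+0.205*k^3)*(1+k) := by
    have : 0 ≤ k^2 * ((0.81-0.48*k+0.205*k^2)*(1+k) - (1.62*(1-k)+4/3*k) * (1+k/2)/2) := by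
      rcases h0.eq_or_lt with h | h
      · subst h; norm_num
      have : 0 ≤ k * ((0.81-0.48*k+0.205*k^2)*(1+k) - (1.62*(1-k)+4/3*k) * (1+k/2)/2) := by
        have : 0 ≤ k^2 * (0.0683333 - 0.20334*k + 0.205*k^2) := by
          apply mul_nonneg (by positivity)
          nlinarith [sq_nonneg (k - 0.496)]
        nlinarith
      have := mul_nonneg h.le this
      linarith
    rcases h0.eq_or_lt with h | h
    · subst h; norm_num
    have h2 : 0 ≤ ((0.81-0.48*k+0.205*k^2)*(1+k) - (1.62*(1-k)+4/3*k) * (1+k/2)/2) :=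
      nonneg_of_mul_nonneg_right this (by positivity)
    nlinarith
  have hT0 : 0 ≤ T2 := by
    have : 0 ≤ (1 + k) * T2 := by rw [hT]; positivity
    exact nonneg_of_mul_nonneg_right this (by linarith)
  unfold c1p
  rw [← hT]
  nlinarith [mul_le_mul_of_nonneg_right hb hT0]


/-- homogeneity for large argument -/
lemma big_diff (p x : ℝ) (hx : 1 ≤ x) :
    (x + 1) ^ p - (x - 1) ^ p = x ^ p * ((1 + 1 / x) ^ p - (1 - 1 / x) ^ p) := by
  have hx0 : 0 < x := by linarith
  have h1 : 1 / x ≤ 1 := by rw [div_le_one hx0]; exact hx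
  have h2 : 0 ≤ 1 / x := by positivity
  rw [mul_sub, ← Real.mul_rpow hx0.le (by linarith), ← Real.mul_rpow hx0.le (by linarith)]
  congr 2 <;> field_simp

/-- upper bound for odd part -/
lemma odd_upper (κ x : ℝ) (h0 : 0 ≤ κ) (h1 : κ ≤ 1) (hx : 0 ≤ x) :
    |1 + x| ^ (2 + κ) - |1 - x| ^ (2 + κ) ≤
      (2 + κ) / 2 * (4 * x + κ * (1.62*(1-κ)+4/3*κ) * x ^ (2 + κ)) := by
  rcases le_total x 1 with hx1 | hx1
  · rw [abs_of_nonneg (by linarith), abs_of_nonneg (by linarith)]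
    have h := s2 κ x h0 h1 hx hx1
    have h3 : x ^ 3 ≤ x ^ (2 + κ) := by
      rw [← Real.rpow_natCast]
      apply Real.rpow_le_rpow_of_exponent_ge' hx hx1 (by linarith)
      push_cast; linarith
    have h4 : 4 / 3 * x ^ 3 ≤ (1.62*(1-κ)+4/3*κ) * x ^ (2 + κ) := by
      apply mul_le_mul _ h3 (by positivity) (by linarith)
      linarith
    refine h.trans ?_
    apply mul_le_mul_of_nonneg_left _ (by linarith)
    nlinarith [mul_le_mul_of_nonneg_left h4 h0]
  · have hx0 : 0 < x := by linarith
    rw [abs_of_nonneg (by linarith), abs_of_nonpos (by linarith), neg_sub, add_comm 1 x,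
      big_diff _ _ hx1]
    set s := 1 / x with hs
    have hs0 : 0 < s := by positivity
    have hs1 : s ≤ 1 := by rw [hs, div_le_one hx0]; exact hx1
    have h := s2 κ s h0 h1 hs0.le hs1
    have hxp : 0 < x ^ (2 + κ) := Real.rpow_pos_of_pos hx0 _
    have e1 : x = x ^ (2 + κ) * s ^ (1 + κ) := by
      rw [hs, Real.div_rpow zero_le_one hx0.le, Real.one_rpow, show 2 + κ = 1 + (1 + κ) by ring,
        Real.rpow_add hx0, Real.rpow_one]
      have : x ^ (1 + κ) ≠ 0 := (Real.rpow_pos_of_pos hx0 _).ne'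
      field_simp
    have key : 4 * s + 4 / 3 * κ * s ^ 3 ≤ 4 * s ^ (1 + κ) + κ * (1.62*(1-κ)+4/3*κ) := by
      set σ := Real.sqrt s with hσ
      have hσ0 : 0 < σ := Real.sqrt_pos.2 hs0
      have hσ1 : σ ≤ 1 := Real.sqrt_le_iff.2 ⟨by norm_num, by simpa using hs1⟩
      have hsq : s = σ ^ 2 := (Real.sq_sqrt hs0.le).symm
      have h7 := s7 κ σ h0 h1 hσ0 hσ1
      rw [← hsq] at h7
      have e : s ^ (1 + κ) = s * s ^ κ := by rw [Real.rpow_add hs0, Real.rpow_one]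
      rw [e]
      have h8 : s * (1 - κ * ((1 - κ) * (σ⁻¹ - σ) + κ * (1 - s))) ≤ s * s ^ κ := by gcongr
      have h9 : s * (σ⁻¹ - σ) = σ - σ ^ 3 := by rw [hsq]; field_simp
      have h12 : s - s * s ^ κ ≤ κ * ((1 - κ) * (s * (σ⁻¹ - σ)) + κ * (s * (1 - s))) := by linarith
      rw [h9] at h12
      have q1 : 4 * (σ - σ ^ 3) + 4 / 3 * σ ^ 6 ≤ 1.62 := by
        nlinarith [mul_nonneg (by linarith : 0 ≤ σ + 1.154) (sq_nonneg (σ - 0.577)), sq_nonneg (σ^3 - 0.24), sq_nonneg (σ^2 - 0.38), sq_nonneg (σ - 0.62), sq_nonneg (σ^3-σ^2), mul_nonneg hσ0.le (sub_nonneg.2 hσ1), pow_pos hσ0 3, pow_pos hσ0 5, mul_nonneg (pow_pos hσ0 3).le (sub_nonneg.2 hσ1)]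
      have q2 : 4 * (s * (1 - s)) + 4 / 3 * s ^ 3 ≤ 4 / 3 := by
        nlinarith [mul_nonneg (sub_nonneg.2 hs1) (sq_nonneg (s-1/2)), mul_nonneg (sub_nonneg.2 hs1) (sq_nonneg (s-1))]
      have q3 : σ ^ 6 = s ^ 3 := by rw [hsq]; ring
      rw [q3] at q1
      have q4 : (1 - κ) * (4 * (σ - σ ^ 3) + 4 / 3 * s ^ 3) ≤ (1 - κ) * 1.62 :=
        mul_le_mul_of_nonneg_left q1 (by linarith)
      have q5 : κ * (4 * (s * (1 - s)) + 4 / 3 * s ^ 3) ≤ κ * (4 / 3) :=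
        mul_le_mul_of_nonneg_left q2 h0
      have q6 := mul_le_mul_of_nonneg_left (add_le_add q4 q5) h0
      linarith
    have h' : x ^ (2 + κ) * ((1 + s) ^ (2 + κ) - (1 - s) ^ (2 + κ)) ≤
        x ^ (2 + κ) * ((2 + κ) / 2 * (4 * s ^ (1 + κ) + κ * (1.62*(1-κ)+4/3*κ))) := by
      apply mul_le_mul_of_nonneg_left _ hxp.le
      refine h.trans ?_
      apply mul_le_mul_of_nonneg_left key (by linarith)
    refine h'.trans (le_of_eq ?_)
    have : 4 * x = 4 * (x ^ (2 + κ) * s ^ (1 + κ)) := by rw [← e1]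
    rw [this]; ring

lemma odd_lower_big (κ x : ℝ) (h0 : 0 ≤ κ) (h1 : κ ≤ 1) (hx1 : 1 ≤ x) :
    (2 + κ) / 2 * (4 * x) ≤ |1 + x| ^ (2 + κ) - |1 - x| ^ (2 + κ) := by
  have hx0 : 0 < x := by linarith
  rw [abs_of_nonneg (by linarith), abs_of_nonpos (by linarith), neg_sub, add_comm 1 x,
      big_diff _ _ hx1]
  set s := 1 / x with hs
  have hs0 : 0 < s := by positivity
  have hs1 : s ≤ 1 := by rw [hs, div_le_one hx0]; exact hx1
  have h := s3 κ s h0 h1 hs0.le hs1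
  have hxp : x ^ 2 ≤ x ^ (2 + κ) := by
    rw [← Real.rpow_natCast]
    apply Real.rpow_le_rpow_of_exponent_le hx1
    push_cast; linarith
  have h4 : (2 + κ) / 2 * (4 * s) ≤ (1 + s) ^ (2 + κ) - (1 - s) ^ (2 + κ) := by
    refine le_trans ?_ h
    apply mul_le_mul_of_nonneg_left _ (by linarith)
    have : 0 ≤ 2 / 3 * κ * (1 + κ) * s ^ 3 := by positivity
    linarith
  have h5 : x ^ 2 * ((2 + κ) / 2 * (4 * s)) ≤ x ^ (2 + κ) * ((1 + s) ^ (2 + κ) - (1 - s) ^ (2 + κ)) := by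
    apply mul_le_mul hxp h4 (by positivity) (by positivity)
  refine le_trans (le_of_eq ?_) h5
  rw [hs]; field_simp

lemma quad_nn (α ℓ γ y : ℝ) (hα0 : 0 < α) (hd : 4 * ℓ ^ 2 ≤ α * γ) : 0 ≤ α * y ^ 2 - 4 * ℓ * y + γ := by
  have : 0 ≤ α * (α * y ^ 2 - 4 * ℓ * y + γ) := by
    linarith [sq_nonneg (α * y - 2 * ℓ)]
  exact nonneg_of_mul_nonneg_right this hα0

lemma cub_nn (y X : ℝ) (hy : 0 ≤ y) (hX : 0 ≤ X) : 3 / 2 * X * y ^ 2 - X ^ 3 / 2 ≤ y ^ 3 := by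
  linarith [mul_nonneg (by linarith : 0 ≤ 2 * y + X) (sq_nonneg (y - X))]

lemma lin_nn (c l y : ℝ) (hc : 0 ≤ c) (hr : 2 * l ≤ c) (hy : 1 ≤ y) : c - 4 * l ≤ c * y ^ 2 - 4 * l * y := by
  nlinarith [mul_nonneg (sub_nonneg.2 hy) (sub_nonneg.2 hr), mul_nonneg (sub_nonneg.2 hy) (mul_nonneg hc (sub_nonneg.2 hy))]

set_option maxHeartbeats 1000000 in
/-- the scalar inequality -/
lemma scalar_delta (κ X T y : ℝ) (h0 : 0 ≤ κ) (h1 : κ ≤ 1) (hX0 : 0 ≤ X) (hT : 0 < T)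
    (hT2 : T ^ 2 ≤ 4 / 3) (hX : (1 + κ) * T ^ 2 = X * (2 + X)) :
    (2 + κ) / 2 * (4 * (1 + κ * ellp κ X) * y
      - κ * (c1p κ X / (1 + κ / 2) / T ^ κ) * |y| ^ (2 + κ)
      - κ * (2 * (1 + κ * ellp κ X) - c1p κ X / (1 + κ / 2)) * T ^ 2)
      ≤ |1 + y| ^ (2 + κ) - |1 - y| ^ (2 + κ) := by
  have hXX : X * (2 + X) ≤ 4 / 3 * (1 + κ) := by rw [← hX]; nlinarith
  have hc1 := c1pos κ X h0 h1 hX0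
  have hcl := c1le κ X h0 h1 hX0 hXX
  have hX1 : X ≤ 0.94 := by
    have := topX κ X h0 h1 hX0 hXX 1 (by norm_num) le_rfl h1
    linarith
  have hl0 : 0 ≤ ellp κ X := by
    unfold ellp; apply mul_nonneg hX0; nlinarith
  set ℓ := ellp κ X with hℓ
  set C := c1p κ X / (1 + κ / 2) with hC
  have hCC : C * (1 + κ / 2) = c1p κ X := by rw [hC]; field_simp
  have hC0 : 0 < C := by positivity
  have hCle : C ≤ c1p κ X := by rw [← hCC]; nlinarith
  have hTk : 0 < T ^ κ := Real.rpow_pos_of_pos hT _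
  have hTk2 : T ^ (2 + κ) = T ^ 2 * T ^ κ := by
    rw [Real.rpow_add hT]; norm_cast
  have hT20 : 0 < T ^ 2 := by positivity
  rcases le_total 0 y with hy | hy
  · -- Young
    have young : C * ((1 + κ / 2) * y ^ 2 - κ / 2 * T ^ 2) ≤ C / T ^ κ * |y| ^ (2 + κ) := by
      rw [abs_of_nonneg hy]
      have h2 := one_add_mul_self_le_rpow_one_add (s := y ^ 2 / T ^ 2 - 1) (by
        have : 0 ≤ y ^ 2 / T ^ 2 := by positivity
        linarith) (p := 1 + κ / 2) (by linarith)
      rw [show 1 + (y ^ 2 / T ^ 2 - 1) = (y / T) ^ 2 by rw [div_pow]; ring] at h2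
      have h3 : ((y / T) ^ 2) ^ (1 + κ / 2) = y ^ (2 + κ) / T ^ (2 + κ) := by
        rw [← Real.rpow_natCast, ← Real.rpow_mul (by positivity), ← Real.div_rpow hy hT.le]
        congr 1; push_cast; ring
      rw [h3, hTk2] at h2
      have h4 := mul_le_mul_of_nonneg_left h2 (mul_pos hC0 hT20).le
      have e1 : C * T ^ 2 * (1 + (1 + κ / 2) * (y ^ 2 / T ^ 2 - 1)) = C * ((1 + κ / 2) * y ^ 2 - κ / 2 * T ^ 2) := by
        field_simp; ring
      have e2 : C * T ^ 2 * (y ^ (2 + κ) / (T ^ 2 * T ^ κ)) = C / T ^ κ * y ^ (2 + κ) := by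
        field_simp
      rw [e1, e2] at h4
      exact h4
    have young2 : c1p κ X * y ^ 2 - c1p κ X * T ^ 2 ≤ C / T ^ κ * |y| ^ (2 + κ) - C * T ^ 2 := by
      rw [← hCC]; linarith
    rcases le_total y 1 with hy1 | hy1
    · have hq := qpos κ X h0 h1 hX0 hXX
      have e : Qpol κ X = (c1p κ X + (1+κ)*X) * ((2+2*κ*ellp κ X - c1p κ X)*(2+X) - (1+κ)^2*X^2/3)
        - 4*X*(1-(1-κ)*X/4)^2*(1+κ) := by unfold Qpol c1p ellp; ring
      rw [e, ← hℓ] at hq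
      have h3 := s3 κ y h0 h1 hy hy1
      have hl : ℓ = X*(1-(1-κ)*X/4) := rfl
      set α := c1p κ X + (1+κ)*X with hα
      have hα0 : 0 < α := by positivity
      set γ := (2 + 2*κ*ℓ - c1p κ X) * T^2 - (1+κ)*X^3/3 with hγ
      have hd : 4 * ℓ ^ 2 ≤ α * γ := by
        have h5 := mul_nonneg hX0 hq
        have h6 : (1 + κ) * γ = X * ((2+2*κ*ℓ - c1p κ X)*(2+X) - (1+κ)^2*X^2/3) := by
          rw [hγ]; linear_combination (2+2*κ*ℓ - c1p κ X) * hX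
        have h7 : X * (α * ((2+2*κ*ℓ - c1p κ X)*(2+X) - (1+κ)^2*X^2/3)
          - 4*X*(1-(1-κ)*X/4)^2*(1+κ)) = (1 + κ) * (α * γ - 4 * ℓ ^ 2) := by
          rw [hl] at h6 ⊢
          linear_combination (-α) * h6
        rw [h7] at h5
        have := nonneg_of_mul_nonneg_right h5 (by linarith)
        linarith
      have hquad : 0 ≤ α * y ^ 2 - 4 * ℓ * y + γ := by
        exact quad_nn α ℓ γ y hα0 hd
      have hcub : 3 / 2 * X * y ^ 2 - X ^ 3 / 2 ≤ y ^ 3 := by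
        exact cub_nn y X hy hX0
      rw [abs_of_nonneg (by linarith : 0 ≤ 1 + y), abs_of_nonneg (by linarith : 0 ≤ 1 - y)]
      refine le_trans ?_ h3
      apply mul_le_mul_of_nonneg_left _ (by linarith)
      have hcub2 := mul_le_mul_of_nonneg_left hcub (by linarith : 0 ≤ 2 / 3 * (1 + κ))
      have fin : 0 ≤ 2 / 3 * (1 + κ) * y ^ 3 - 4 * ℓ * y + C / T ^ κ * |y| ^ (2 + κ)
          + (2 * (1 + κ * ℓ) - C) * T ^ 2 := by
        rw [hγ, hα] at hquad
        linarith
      have := mul_nonneg h0 fin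
      linarith
    · have h3 := odd_lower_big κ y h0 h1 hy1
      refine le_trans ?_ h3
      apply mul_le_mul_of_nonneg_left _ (by linarith)
      have hr1 := r1pos κ X h0 h1 hX0 hX1
      have hr2 := r2pos κ X h0 h1 hX0 hXX
      rw [← hℓ] at hr1 hr2
      have hr3 : 0 ≤ c1p κ X - 4 * ℓ + (2 + 2*κ*ℓ - c1p κ X) * T^2 := by
        have : (c1p κ X-4*ℓ)*(1+κ)+(2+2*κ*ℓ-c1p κ X)*(X*(2+X)) =
          (1 + κ) * (c1p κ X - 4 * ℓ + (2 + 2*κ*ℓ - c1p κ X) * T^2) := by rw [← hX]; ring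
        rw [this] at hr2
        exact nonneg_of_mul_nonneg_right hr2 (by linarith)
      have hq : c1p κ X - 4 * ℓ ≤ c1p κ X * y ^ 2 - 4 * ℓ * y := by
        exact lin_nn (c1p κ X) ℓ y hc1.le hr1 hy1
      have fin : 0 ≤ - 4 * ℓ * y + C / T ^ κ * |y| ^ (2 + κ)
          + (2 * (1 + κ * ℓ) - C) * T ^ 2 := by
        linarith
      have := mul_nonneg h0 fin
      linarith
  · have h := odd_upper κ (-y) h0 h1 (by linarith)
    rw [show 1 + -y = 1 - y by ring, show 1 - -y = 1 + y by ring] at h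
    rw [abs_of_nonpos hy]
    have hcg := c1ge κ X (T ^ 2) h0 h1 hX hX0
    have hTle : T ^ κ ≤ 1 + κ / 2 * (T ^ 2 - 1) := by
      have h2 := rpow_one_add_le_one_add_mul_self (s := T ^ 2 - 1) (by linarith)
        (p := κ / 2) (by linarith) (by linarith)
      have h3 : (1 + (T ^ 2 - 1)) ^ (κ / 2) = T ^ κ := by
        rw [show 1 + (T ^ 2 - 1) = T ^ 2 by ring, ← Real.rpow_natCast, ← Real.rpow_mul hT.le]
        congr 1; push_cast; ring
      rw [h3] at h2
      exact h2
    have hc0 : 0 ≤ 1.62*(1-κ)+4/3*κ := by linarith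
    have hcc : 1.62*(1-κ)+4/3*κ ≤ C / T ^ κ := by
      rw [le_div_iff₀ hTk, hC, le_div_iff₀ (by linarith)]
      have := mul_le_mul_of_nonneg_left hTle (mul_nonneg hc0 (by linarith : 0 ≤ 1 + κ / 2))
      linarith
    have hyp : 0 ≤ (-y) ^ (2 + κ) := Real.rpow_nonneg (by linarith) _
    have g1 := mul_le_mul_of_nonneg_right hcc hyp
    have g2 := mul_le_mul_of_nonneg_left g1 h0
    have g3 : 0 ≤ κ * (2 * (1 + κ * ℓ) - C) * T ^ 2 := by
      have : 0 ≤ 2 * (1 + κ * ℓ) - C := by linarith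
      positivity
    have g4 : 0 ≤ κ * ℓ * (-y) := by
      have : 0 ≤ -y := by linarith
      positivity
    have g5 : 4 * (1 + κ * ℓ) * y - κ * (C / T ^ κ) * (-y) ^ (2 + κ)
      - κ * (2 * (1 + κ * ℓ) - C) * T ^ 2 ≤ -(4 * (-y) + κ * (1.62*(1-κ)+4/3*κ) * (-y) ^ (2 + κ)) := by
      linarith
    have := mul_le_mul_of_nonneg_left g5 (by linarith : 0 ≤ (2 + κ) / 2)
    linarith


section vec
variable {m : ℕ}

lemma pn_nonneg (p : ℝ) (x : Fin m → ℝ) : 0 ≤ pnorm p x := by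
  unfold pnorm
  apply Real.rpow_nonneg
  exact Finset.sum_nonneg (fun i _ => Real.rpow_nonneg (abs_nonneg _) _)

lemma S_nonneg (p : ℝ) (x : Fin m → ℝ) : 0 ≤ ∑ i, |x i| ^ p :=
  Finset.sum_nonneg (fun i _ => Real.rpow_nonneg (abs_nonneg _) _)

lemma pn_rpow (p : ℝ) (hp : 2 ≤ p) (x : Fin m → ℝ) : pnorm p x ^ p = ∑ i, |x i| ^ p := by
  unfold pnorm
  rw [← Real.rpow_mul (S_nonneg p x), one_div_mul_cancel (by linarith), Real.rpow_one]

lemma pn_sq (p : ℝ) (x : Fin m → ℝ) : pnorm p x ^ 2 = (∑ i, |x i| ^ p) ^ (2 / p) := by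
  unfold pnorm
  rw [← Real.rpow_natCast, ← Real.rpow_mul (S_nonneg p x)]
  congr 1; push_cast; ring

lemma pn_sq_rpow (p : ℝ) (hp : 2 ≤ p) (x : Fin m → ℝ) : (pnorm p x ^ 2) ^ (p / 2) = ∑ i, |x i| ^ p := by
  rw [pn_sq, ← Real.rpow_mul (S_nonneg p x), show 2 / p * (p / 2) = 1 by field_simp, Real.rpow_one]

lemma pn_eq_zero (p : ℝ) (hp : 2 ≤ p) (x : Fin m → ℝ) (h : pnorm p x = 0) : x = 0 := by
  have h1 := pn_rpow p hp x
  rw [h, Real.zero_rpow (by linarith)] at h1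
  have h2 := (Finset.sum_eq_zero_iff_of_nonneg (fun i _ => Real.rpow_nonneg (abs_nonneg (x i)) p)).1 h1.symm
  ext i
  have h3 := h2 i (Finset.mem_univ i)
  rw [Real.rpow_eq_zero (abs_nonneg _) (by linarith)] at h3
  simpa using h3

lemma pn_zero (p : ℝ) (hp : 2 ≤ p) : pnorm p (0 : Fin m → ℝ) = 0 := by
  unfold pnorm
  simp [Real.zero_rpow (by linarith : p ≠ 0)]
  rw [Real.zero_rpow]
  simp; linarith

lemma pn_smul (p : ℝ) (hp : 2 ≤ p) (c : ℝ) (x : Fin m → ℝ) : pnorm p (c • x) = |c| * pnorm p x := by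
  unfold pnorm
  have : ∑ i, |(c • x) i| ^ p = |c| ^ p * ∑ i, |x i| ^ p := by
    rw [Finset.mul_sum]
    apply Finset.sum_congr rfl
    intro i _
    rw [Pi.smul_apply, smul_eq_mul, abs_mul, Real.mul_rpow (abs_nonneg _) (abs_nonneg _)]
  rw [this, Real.mul_rpow (Real.rpow_nonneg (abs_nonneg _) _) (S_nonneg p x), ← Real.rpow_mul (abs_nonneg _),
    mul_one_div_cancel (by linarith), Real.rpow_one]

/-- pairing -/
noncomputable def jj (p : ℝ) (x y : Fin m → ℝ) : ℝ := ∑ i, Jmap p x i * y i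

lemma jj_smul (p c : ℝ) (x y : Fin m → ℝ) : jj p x (c • y) = c * jj p x y := by
  unfold jj
  rw [Finset.mul_sum]
  apply Finset.sum_congr rfl
  intro i _
  simp; ring

lemma jj_neg (p : ℝ) (x y : Fin m → ℝ) : jj p x (-y) = - jj p x y := by
  rw [← neg_one_smul ℝ y, jj_smul]; ring

lemma jj_add (p : ℝ) (x y z : Fin m → ℝ) : jj p x (y + z) = jj p x y + jj p x z := by
  unfold jj
  rw [← Finset.sum_add_distrib]
  apply Finset.sum_congr rfl
  intro i _
  simp; ring

lemma jj_zero (p : ℝ) (y : Fin m → ℝ) : jj p 0 y = 0 := by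
  unfold jj Jmap
  simp

lemma jj_self (p : ℝ) (hp : 2 ≤ p) (x : Fin m → ℝ) : jj p x x = pnorm p x ^ 2 := by
  rcases (pn_nonneg p x).eq_or_lt with h | h
  · have := pn_eq_zero p hp x h.symm
    rw [this, jj_zero, pn_zero p hp]; norm_num
  unfold jj Jmap
  have : ∀ i, pnorm p x ^ (2 - p) * |x i| ^ (p - 1) * Real.sign (x i) * x i = pnorm p x ^ (2 - p) * |x i| ^ p := by
    intro i
    have h1 : Real.sign (x i) * x i = |x i| := by
      rcases lt_trichotomy (x i) 0 with h | h | h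
      · rw [Real.sign_of_neg h, abs_of_neg h]; ring
      · rw [h]; simp
      · rw [Real.sign_of_pos h, abs_of_pos h]; ring
    rw [mul_assoc, h1, mul_assoc]
    congr 1
    rcases (abs_nonneg (x i)).eq_or_lt with h2 | h2
    · rw [← h2, Real.zero_rpow (by linarith : p ≠ 0)]; ring
    · rw [show p = (p - 1) + 1 by ring, Real.rpow_add h2, Real.rpow_one]; ring_nf
  rw [Finset.sum_congr rfl (fun i _ => this i), ← Finset.mul_sum, ← pn_rpow p hp, ← Real.rpow_add h]
  rw [show 2 - p + p = ((2:ℕ):ℝ) by push_cast; ring, Real.rpow_natCast]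

lemma jj_abs_le (p : ℝ) (hp : 2 ≤ p) (x y : Fin m → ℝ) : |jj p x y| ≤ pnorm p x * pnorm p y := by
  rcases (pn_nonneg p x).eq_or_lt with h | h
  · have := pn_eq_zero p hp x h.symm
    rw [← h, this, jj_zero]; simp
  have hc : (p / (p - 1)).HolderConjugate p := by
    rw [Real.holderConjugate_iff]
    constructor
    · rw [lt_div_iff₀ (by linarith)]; linarith
    · have : p - 1 ≠ 0 := by linarith
      field_simp; ring
  have h1 := Real.inner_le_Lp_mul_Lq Finset.univ (fun i => |x i| ^ (p - 1)) (fun i => |y i|) hc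
  have h2 : ∑ i, |(|x i| ^ (p - 1))| ^ (p / (p - 1)) = pnorm p x ^ p := by
    rw [pn_rpow p hp]
    apply Finset.sum_congr rfl
    intro i _
    rw [abs_of_nonneg (Real.rpow_nonneg (abs_nonneg _) _), ← Real.rpow_mul (abs_nonneg _)]
    congr 1
    have : p - 1 ≠ 0 := by linarith
    field_simp
  rw [h2, ← Real.rpow_mul h.le] at h1
  have h3 : p * (1 / (p / (p - 1))) = p - 1 := by
    have : p - 1 ≠ 0 := by linarith
    field_simp
  rw [h3] at h1
  have h4 : (∑ i, |(|y i|)| ^ p) ^ (1 / p) = pnorm p y := by unfold pnorm; simp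
  rw [h4] at h1
  calc |jj p x y| ≤ ∑ i, |Jmap p x i * y i| := Finset.abs_sum_le_sum_abs _ _
    _ ≤ ∑ i, pnorm p x ^ (2 - p) * (|x i| ^ (p - 1) * |y i|) := by
        apply Finset.sum_le_sum
        intro i _
        unfold Jmap
        rw [abs_mul, abs_mul, abs_mul, abs_of_nonneg (Real.rpow_nonneg h.le _),
          abs_of_nonneg (Real.rpow_nonneg (abs_nonneg _) _)]
        have h5 : |Real.sign (x i)| ≤ 1 := by
          rcases Real.sign_apply_eq (x i) with h | h | h <;> rw [h] <;> norm_num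
        have h6 : 0 ≤ pnorm p x ^ (2 - p) := Real.rpow_nonneg h.le _
        have h7 : 0 ≤ |x i| ^ (p - 1) := Real.rpow_nonneg (abs_nonneg _) _
        calc pnorm p x ^ (2 - p) * |x i| ^ (p - 1) * |Real.sign (x i)| * |y i|
            ≤ pnorm p x ^ (2 - p) * |x i| ^ (p - 1) * 1 * |y i| := by gcongr
          _ = _ := by ring
    _ = pnorm p x ^ (2 - p) * ∑ i, (|x i| ^ (p - 1) * |y i|) := by rw [Finset.mul_sum]
    _ ≤ pnorm p x ^ (2 - p) * (pnorm p x ^ (p - 1) * pnorm p y) := by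
        apply mul_le_mul_of_nonneg_left h1 (Real.rpow_nonneg h.le _)
    _ = pnorm p x * pnorm p y := by
        rw [← mul_assoc, ← Real.rpow_add h]
        congr 1
        rw [show 2 - p + (p - 1) = 1 by ring, Real.rpow_one]

lemma conv_le (p : ℝ) (hp : 2 ≤ p) (x y : Fin m → ℝ) :
    pnorm p x ^ 2 + 2 * jj p x y ≤ pnorm p (x + y) ^ 2 := by
  have h1 := jj_abs_le p hp x (x + y)
  rw [jj_add, jj_self p hp] at h1
  have h2 := (le_abs_self _).trans h1
  nlinarith [sq_nonneg (pnorm p x - pnorm p (x + y))]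

lemma Pineq (p : ℝ) (hp : 2 ≤ p) (x y : Fin m → ℝ) :
    ((∑ i, |(x + y) i| ^ p + ∑ i, |(x - y) i| ^ p) / 2) ^ (2 / p) ≤
      pnorm p x ^ 2 + (p - 1) * pnorm p y ^ 2 := by
  have h1 : (∑ i, |(x + y) i| ^ p + ∑ i, |(x - y) i| ^ p) / 2 ≤
      ∑ i, ((x i) ^ 2 + (p - 1) * (y i) ^ 2) ^ (p / 2) := by
    rw [← Finset.sum_add_distrib, Finset.sum_div]
    apply Finset.sum_le_sum
    intro i _
    exact bon p (x i) (y i) hp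
  have h0 : 0 ≤ (∑ i, |(x + y) i| ^ p + ∑ i, |(x - y) i| ^ p) / 2 := by
    have := S_nonneg p (x + y)
    have := S_nonneg p (x - y)
    linarith
  refine (Real.rpow_le_rpow h0 h1 (by positivity)).trans ?_
  have h2 := Real.Lp_add_le_of_nonneg (s := Finset.univ) (f := fun i => (x i) ^ 2) (g := fun i => (p - 1) * (y i) ^ 2)
    (p := p / 2) (by linarith) (fun i _ => by positivity)
    (fun i _ => mul_nonneg (by linarith) (by positivity))
  have h3 : ∀ z : ℝ, (z ^ 2) ^ (p / 2) = |z| ^ p := by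
    intro z
    rw [← sq_abs, ← Real.rpow_natCast, ← Real.rpow_mul (abs_nonneg z)]
    congr 1; push_cast; ring
  have h4 : ∑ i, ((x i) ^ 2) ^ (p / 2) = ∑ i, |x i| ^ p := Finset.sum_congr rfl (fun i _ => h3 _)
  have h5 : ∑ i, ((p - 1) * (y i) ^ 2) ^ (p / 2) = (p - 1) ^ (p / 2) * ∑ i, |y i| ^ p := by
    rw [Finset.mul_sum]
    apply Finset.sum_congr rfl
    intro i _
    rw [Real.mul_rpow (by linarith) (by positivity), h3]
  have h6 : 1 / (p / 2) = 2 / p := by field_simp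
  simp only [h6] at h2
  rw [h4, h5, Real.mul_rpow (Real.rpow_nonneg (by linarith) _) (S_nonneg p y), ← Real.rpow_mul (by linarith),
    show p / 2 * (2 / p) = 1 by field_simp, Real.rpow_one, ← pn_sq, ← pn_sq] at h2
  exact h2

lemma Pineq2 (p : ℝ) (hp : 2 ≤ p) (x y : Fin m → ℝ) :
    pnorm p (x + y) ^ 2 + pnorm p (x - y) ^ 2 ≤ 2 * pnorm p x ^ 2 + 2 * (p - 1) * pnorm p y ^ 2 := by
  have h := Pineq p hp x y
  have ha : pnorm p (x + y) ^ 2 ∈ Set.Ici (0:ℝ) := by simp; positivity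
  have hb : pnorm p (x - y) ^ 2 ∈ Set.Ici (0:ℝ) := by simp; positivity
  have h1 := (convexOn_rpow (by linarith : 1 ≤ p / 2)).2 ha hb (by norm_num : (0:ℝ) ≤ 1/2)
    (by norm_num : (0:ℝ) ≤ 1/2) (by norm_num)
  simp only [smul_eq_mul] at h1
  rw [pn_sq_rpow p hp, pn_sq_rpow p hp] at h1
  have h2 : (pnorm p (x + y) ^ 2 + pnorm p (x - y) ^ 2) / 2 ≤ ((∑ i, |(x + y) i| ^ p + ∑ i, |(x - y) i| ^ p) / 2) ^ (2 / p) := by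
    have h3 := Real.rpow_le_rpow (by positivity) h1 (by positivity : 0 ≤ 2 / p)
    rw [← Real.rpow_mul (by positivity), show p / 2 * (2 / p) = 1 by field_simp, Real.rpow_one] at h3
    convert h3 using 1
    · ring
    · congr 1; ring
  linarith

lemma Sineq (p : ℝ) (hp : 2 ≤ p) (x y : Fin m → ℝ) :
    pnorm p (x - y) ^ 2 ≤ pnorm p x ^ 2 - 2 * jj p x y + (p - 1) * pnorm p y ^ 2 := by
  set G : ℝ → ℝ := fun t => pnorm p (x + t • y) ^ 2 - (p - 1) * pnorm p y ^ 2 * t ^ 2 with hG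
  have mid : ∀ t h : ℝ, G (t + h) + G (t - h) ≤ 2 * G t := by
    intro t h
    have := Pineq2 p hp (x + t • y) (h • y)
    rw [pn_smul p hp, mul_pow, sq_abs] at this
    have e1 : x + t • y + h • y = x + (t + h) • y := by rw [add_smul, add_assoc]
    have e2 : x + t • y - h • y = x + (t - h) • y := by rw [sub_smul, add_sub_assoc]
    rw [e1, e2] at this
    simp only [hG]
    linarith
  have step : ∀ n : ℕ, G (-1) - G 0 ≤ 2 ^ n * (G (-(1 / 2 ^ n)) - G 0) := by
    intro n
    induction n with
    | zero => simp
    | succ k ih =>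
      have := mid (-(1 / 2 ^ (k+1))) (1 / 2 ^ (k+1))
      have e1 : -((1:ℝ) / 2 ^ (k+1)) + 1 / 2 ^ (k+1) = 0 := by ring
      have e2 : -((1:ℝ) / 2 ^ (k+1)) - 1 / 2 ^ (k+1) = -(1 / 2 ^ k) := by rw [pow_succ]; field_simp; ring
      rw [e1, e2] at this
      have h2 : (0:ℝ) < 2 ^ k := by positivity
      have h3 := mul_le_mul_of_nonneg_left this h2.le
      have h4 : (2:ℝ) ^ (k+1) * (G (-(1 / 2 ^ (k+1))) - G 0) = 2 ^ k * (2 * G (-(1 / 2 ^ (k+1)))) - 2 * (2 ^ k * G 0) := by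
        rw [pow_succ]; ring
      rw [h4]
      linarith
  have bd : ∀ n : ℕ, G (-1) - G 0 ≤ -2 * jj p x y + (p - 1) * pnorm p y ^ 2 * (1 / 2 ^ n) := by
    intro n
    have h1 := step n
    have h2 := mid 0 (1 / 2 ^ n)
    rw [zero_add, zero_sub] at h2
    have h3 := conv_le p hp x (((1:ℝ) / 2 ^ n) • y)
    rw [jj_smul] at h3
    have h4 : (0:ℝ) < 2 ^ n := by positivity
    have h5 : G 0 = pnorm p x ^ 2 := by simp [hG]
    have h6 : G (1 / 2 ^ n) = pnorm p (x + ((1:ℝ) / 2 ^ n) • y) ^ 2 - (p - 1) * pnorm p y ^ 2 * (1 / 2 ^ n) ^ 2 := rfl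
    have h7 : G (-(1 / 2 ^ n)) - G 0 ≤ -2 * (1 / 2 ^ n * jj p x y) + (p - 1) * pnorm p y ^ 2 * (1 / 2 ^ n) ^ 2 := by
      rw [h6] at h2; linarith
    have h8 := mul_le_mul_of_nonneg_left h7 h4.le
    refine h1.trans (h8.trans (le_of_eq ?_))
    field_simp
  have lim : Filter.Tendsto (fun n : ℕ => -2 * jj p x y + (p - 1) * pnorm p y ^ 2 * ((1:ℝ) / 2 ^ n)) Filter.atTop
      (nhds (-2 * jj p x y + (p - 1) * pnorm p y ^ 2 * 0)) := by
    apply Filter.Tendsto.const_add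
    apply Filter.Tendsto.const_mul
    have := tendsto_pow_atTop_nhds_zero_of_lt_one (r := (1:ℝ)/2) (by norm_num) (by norm_num)
    simpa [one_div, inv_pow] using this
  have h := ge_of_tendsto' lim bd
  have h5 : G 0 = pnorm p x ^ 2 := by simp [hG]
  have h6 : G (-1) = pnorm p (x - y) ^ 2 - (p - 1) * pnorm p y ^ 2 := by simp [hG, sub_eq_add_neg]
  rw [h5, h6] at h
  linarith

end vec


lemma coord1 (p x y : ℝ) (hx : x ≠ 0) : |x + y| ^ p = |x| ^ p * |1 + y / x| ^ p := by
  rw [← Real.mul_rpow (abs_nonneg _) (abs_nonneg _), ← abs_mul]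
  congr 2; field_simp

lemma coord2 (p x y : ℝ) (hx : x ≠ 0) : |x - y| ^ p = |x| ^ p * |1 - y / x| ^ p := by
  rw [← Real.mul_rpow (abs_nonneg _) (abs_nonneg _), ← abs_mul]
  congr 2; field_simp

lemma coord3 (p x y : ℝ) (hx : x ≠ 0) : |x| ^ (p - 1) * Real.sign x * y = |x| ^ p * (y / x) := by
  have h0 : 0 < |x| := abs_pos.2 hx
  rw [Real.rpow_sub_one h0.ne']
  rcases lt_or_gt_of_ne hx with h | h
  · rw [Real.sign_of_neg h, abs_of_neg h]; field_simp
  · rw [Real.sign_of_pos h, abs_of_pos h]; field_simp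

lemma coord4 (p x y : ℝ) (hx : x ≠ 0) : |y| ^ p = |x| ^ p * |y / x| ^ p := by
  rw [← Real.mul_rpow (abs_nonneg _) (abs_nonneg _), ← abs_mul]
  congr 2; field_simp

section vec
variable {m : ℕ}

lemma jj_sum (κ : ℝ) (x y : Fin m → ℝ) (hn : 0 < pnorm (2 + κ) x) :
    ∑ i, |x i| ^ (2 + κ - 1) * Real.sign (x i) * y i = pnorm (2 + κ) x ^ κ * jj (2 + κ) x y := by
  unfold jj Jmap
  rw [Finset.mul_sum]
  apply Finset.sum_congr rfl
  intro i _
  have : pnorm (2 + κ) x ^ κ * pnorm (2 + κ) x ^ (2 - (2 + κ)) = 1 := by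
    rw [← Real.rpow_add hn, show κ + (2 - (2 + κ)) = 0 by ring, Real.rpow_zero]
  linear_combination (-(|x i| ^ (2 + κ - 1) * Real.sign (x i) * y i)) * this

lemma L4vec (κ : ℝ) (h0 : 0 ≤ κ) (h1 : κ ≤ 1) (x y : Fin m → ℝ) (hn : 0 < pnorm (2 + κ) x) :
    pnorm (2 + κ) x ^ (2 + κ) + (2 + κ) * (pnorm (2 + κ) x ^ κ * jj (2 + κ) x y) +
      (1 - κ) * pnorm (2 + κ) y ^ (2 + κ) ≤ pnorm (2 + κ) (x + y) ^ (2 + κ) := by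
  rw [← jj_sum κ x y hn, pn_rpow _ (by linarith), pn_rpow _ (by linarith), pn_rpow _ (by linarith),
    Finset.mul_sum, Finset.mul_sum, ← Finset.sum_add_distrib, ← Finset.sum_add_distrib]
  apply Finset.sum_le_sum
  intro i _
  by_cases hx : x i = 0
  · rw [Pi.add_apply, hx]
    have : 0 ≤ |y i| ^ (2 + κ) := Real.rpow_nonneg (abs_nonneg _) _
    simp only [abs_zero, Real.sign_zero, mul_zero, zero_mul, zero_add, add_zero]
    rw [Real.zero_rpow (by linarith)]
    nlinarith
  · rw [Pi.add_apply, coord1 _ _ _ hx, coord3 _ _ _ hx, coord4 _ _ (y i) hx]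
    have h := s5 κ (y i / x i) h0 h1
    have := mul_le_mul_of_nonneg_left h (Real.rpow_nonneg (abs_nonneg (x i)) (2 + κ))
    refine le_trans (le_of_eq ?_) this
    ring

lemma odd_sum (κ X T : ℝ) (h0 : 0 ≤ κ) (h1 : κ ≤ 1) (hX0 : 0 ≤ X) (hT : 0 < T)
    (hT2 : T ^ 2 ≤ 4 / 3) (hX : (1 + κ) * T ^ 2 = X * (2 + X)) (x y : Fin m → ℝ)
    (hn : 0 < pnorm (2 + κ) x) (hy : pnorm (2 + κ) y = T * pnorm (2 + κ) x) :
    (2 + κ) / 2 * ((1 + κ * ellp κ X) * (pnorm (2 + κ) x ^ κ * (4 * jj (2 + κ) x y - 2 * κ * pnorm (2 + κ) y ^ 2)))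
      ≤ ∑ i, |(x + y) i| ^ (2 + κ) - ∑ i, |(x - y) i| ^ (2 + κ) := by
  set lam := 1 + κ * ellp κ X with hlam
  set C := c1p κ X / (1 + κ / 2) with hC
  have hC0 : 0 < C := by
    have := c1pos κ X h0 h1 hX0
    positivity
  have hTk : 0 < T ^ κ := Real.rpow_pos_of_pos hT _
  have key : ∀ i, (2 + κ) / 2 * (4 * lam * (|x i| ^ (2 + κ - 1) * Real.sign (x i) * y i)
      - κ * (C / T ^ κ) * |y i| ^ (2 + κ) - κ * (2 * lam - C) * T ^ 2 * |x i| ^ (2 + κ)) ≤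
      |(x + y) i| ^ (2 + κ) - |(x - y) i| ^ (2 + κ) := by
    intro i
    by_cases hx : x i = 0
    · rw [Pi.add_apply, Pi.sub_apply, hx]
      have : 0 ≤ |y i| ^ (2 + κ) := Real.rpow_nonneg (abs_nonneg _) _
      simp only [abs_zero, Real.sign_zero, mul_zero, zero_mul, zero_add, zero_sub, abs_neg, sub_self]
      rw [Real.zero_rpow (by linarith)]
      have : 0 ≤ (2 + κ) / 2 * (κ * (C / T ^ κ) * |y i| ^ (2 + κ)) := by positivity
      linarith
    · rw [Pi.add_apply, Pi.sub_apply, coord1 _ _ _ hx, coord2 _ _ _ hx, coord3 _ _ _ hx, coord4 _ _ (y i) hx]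
      have h := scalar_delta κ X T (y i / x i) h0 h1 hX0 hT hT2 hX
      have := mul_le_mul_of_nonneg_left h (Real.rpow_nonneg (abs_nonneg (x i)) (2 + κ))
      refine le_trans (le_of_eq ?_) (this.trans (le_of_eq ?_))
      · ring
      · ring
  have hs := Finset.sum_le_sum (s := Finset.univ) (fun i _ => key i)
  rw [← Finset.mul_sum, Finset.sum_sub_distrib, Finset.sum_sub_distrib, Finset.sum_sub_distrib, ← Finset.mul_sum,
    ← Finset.mul_sum, ← Finset.mul_sum, jj_sum κ x y hn, ← pn_rpow (2 + κ) (by linarith) x,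
    ← pn_rpow (2 + κ) (by linarith) y] at hs
  refine le_trans (le_of_eq ?_) hs
  rw [hy, Real.mul_rpow hT.le hn.le, show (2 + κ) = κ + (2:ℕ) by push_cast; ring, Real.rpow_add_natCast hT.ne']
  rw [show κ + ((2:ℕ):ℝ) = 2 + κ by push_cast; ring] 
  have e : pnorm (2 + κ) x ^ (2 + κ) = pnorm (2 + κ) x ^ κ * pnorm (2 + κ) x ^ 2 := by
    rw [← Real.rpow_add_natCast hn.ne']; congr 1; push_cast; ring
  rw [e]
  field_simp
  ring

lemma diff_lower (p : ℝ) (hp : 2 ≤ p) (A B M : ℝ) (hB : 0 ≤ B) (hAB : B < A) (hM : 0 < M)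
    (hle : ((A + B) / 2) ^ (2 / p) ≤ M ^ 2) :
    2 / p * (M ^ (2 - p) * (A - B)) ≤ A ^ (2 / p) - B ^ (2 / p) := by
  have hp0 : 0 < p := by linarith
  set Sb := (A + B) / 2 with hS
  have hS0 : 0 < Sb := by rw [hS]; linarith
  set h := (A - B) / (2 * Sb) with hh
  have hh0 : 0 ≤ h := by rw [hh]; apply div_nonneg <;> linarith
  have hh1 : h ≤ 1 := by rw [hh, div_le_one (by linarith), hS]; linarith
  have eA : A = Sb * (1 + h) := by rw [hh]; field_simp; rw [hS]; ring
  have eB : B = Sb * (1 - h) := by rw [hh]; field_simp; rw [hS]; ring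
  have h4 := s4 (2 / p) h (by positivity) (by rw [div_le_one hp0]; exact hp) hh0 hh1
  have eA' : A ^ (2 / p) = Sb ^ (2 / p) * (1 + h) ^ (2 / p) := by
    rw [← Real.mul_rpow hS0.le (by linarith), ← eA]
  have eB' : B ^ (2 / p) = Sb ^ (2 / p) * (1 - h) ^ (2 / p) := by
    rw [← Real.mul_rpow hS0.le (by linarith), ← eB]
  rw [eA', eB', ← mul_sub]
  have hSe : 0 < Sb ^ (2 / p) := Real.rpow_pos_of_pos hS0 _
  refine le_trans ?_ (mul_le_mul_of_nonneg_left h4 hSe.le)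
  have hAB' : A - B = 2 * h * Sb := by rw [hh]; field_simp
  rw [hAB']
  have hSM : Sb ≤ M ^ p := by
    have := Real.rpow_le_rpow hSe.le hle (by positivity : 0 ≤ p / 2)
    rw [← Real.rpow_mul hS0.le, show 2 / p * (p / 2) = 1 by field_simp, Real.rpow_one, ← Real.rpow_natCast,
      ← Real.rpow_mul hM.le] at this
    convert this using 2; push_cast; ring
  have key : M ^ (2 - p) ≤ Sb ^ (2 / p - 1) := by
    have e1 : M ^ (2 - p) = (M ^ p) ^ (2 / p - 1) := by
      rw [← Real.rpow_mul hM.le]; congr 1; field_simp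
    rw [e1]
    apply Real.rpow_le_rpow_of_nonpos hS0 hSM
    have : 2 / p ≤ 1 := by rw [div_le_one hp0]; exact hp
    linarith
  have e3 : Sb ^ (2 / p) = Sb ^ (2 / p - 1) * Sb := by
    rw [Real.rpow_sub_one hS0.ne']; field_simp
  rw [e3]
  have := mul_le_mul_of_nonneg_right key (by positivity : 0 ≤ 2 / p * (2 * h * Sb))
  linarith

lemma Delta (κ : ℝ) (h0 : 0 ≤ κ) (x y : Fin m → ℝ) (hn : 0 < pnorm (2 + κ) x)
    (hT : pnorm (2 + κ) y ^ 2 ≤ 4 / 3 * pnorm (2 + κ) x ^ 2) :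
    4 * jj (2 + κ) x y ≤ max (pnorm (2 + κ) (x + y) ^ 2 - pnorm (2 + κ) (x - y) ^ 2) 0
      + 2 * κ * pnorm (2 + κ) y ^ 2 := by
  have hp : 2 ≤ 2 + κ := by linarith
  rcases le_total 1 κ with h1 | h1
  · have hS := Sineq (2 + κ) hp x y
    have hC := conv_le (2 + κ) hp x y
    have := le_max_left (pnorm (2 + κ) (x + y) ^ 2 - pnorm (2 + κ) (x - y) ^ 2) 0
    nlinarith [sq_nonneg (pnorm (2 + κ) y)]
  by_cases hj : 4 * jj (2 + κ) x y ≤ 2 * κ * pnorm (2 + κ) y ^ 2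
  · have := le_max_right (pnorm (2 + κ) (x + y) ^ 2 - pnorm (2 + κ) (x - y) ^ 2) 0
    linarith
  push Not at hj
  have hy0 : 0 < pnorm (2 + κ) y := by
    rcases (pn_nonneg (2 + κ) y).eq_or_lt with h | h
    · exfalso
      have h2 := (le_abs_self _).trans (jj_abs_le (2 + κ) hp x y)
      rw [← h] at h2 hj
      norm_num at hj h2
      linarith
    · exact h
  set n := pnorm (2 + κ) x with hnn
  set T := pnorm (2 + κ) y / n with hTd
  have hT0 : 0 < T := by positivity
  have hTn : pnorm (2 + κ) y = T * n := by rw [hTd]; field_simp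
  have hT2 : T ^ 2 ≤ 4 / 3 := by
    rw [hTd, div_pow, div_le_iff₀ (by positivity)]; exact hT
  set β := Real.sqrt (1 + (1 + κ) * T ^ 2) with hβ
  have hβ2 : β ^ 2 = 1 + (1 + κ) * T ^ 2 := Real.sq_sqrt (by positivity)
  have hβ1 : 1 ≤ β := by
    rw [hβ, Real.one_le_sqrt]
    have : 0 ≤ (1 + κ) * T ^ 2 := by positivity
    linarith
  set X := β - 1 with hXd
  have hX0 : 0 ≤ X := by rw [hXd]; linarith
  have hX : (1 + κ) * T ^ 2 = X * (2 + X) := by rw [hXd]; linear_combination hβ2 * (-1)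
  have hX1 : X ≤ 1 := by
    by_contra h
    push Not at h
    nlinarith
  have hos := odd_sum κ X T h0 h1 hX0 hT0 hT2 hX x y hn hTn
  rw [← hnn] at hos
  set lam := 1 + κ * ellp κ X with hlam
  have hlamb : β ^ κ ≤ lam := by
    have h6 := s6 κ β h0 h1 hβ1
    refine h6.trans ?_
    rw [hlam]
    have : (1 + κ) / 2 * (β - 1) + (1 - κ) / 2 * (1 - β⁻¹) ≤ ellp κ X := by
      unfold ellp
      have e1 : β⁻¹ = 1 / (1 + X) := by rw [hXd]; simp
      have e2 : 1 - β⁻¹ ≤ X * (1 - X / 2) := by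
        rw [e1, sub_le_iff_le_add, ← sub_le_iff_le_add', le_div_iff₀ (by linarith)]
        nlinarith [mul_nonneg hX0 (mul_nonneg hX0 (sub_nonneg.2 hX1))]
      rw [← hXd]
      have := mul_le_mul_of_nonneg_left e2 (by linarith : 0 ≤ (1 - κ) / 2)
      linarith
    have := mul_le_mul_of_nonneg_left this h0
    linarith
  have hβk : 0 < β ^ κ := Real.rpow_pos_of_pos (by linarith) _
  have hlam0 : 0 < lam := by linarith
  have hnk : 0 < n ^ κ := Real.rpow_pos_of_pos hn _
  have hpos : 0 < 4 * jj (2 + κ) x y - 2 * κ * pnorm (2 + κ) y ^ 2 := by linarith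
  set Sp := ∑ i, |(x + y) i| ^ (2 + κ) with hSp
  set Sm := ∑ i, |(x - y) i| ^ (2 + κ) with hSm
  have hlt : Sm < Sp := by
    have : 0 < (2 + κ) / 2 * (lam * (n ^ κ * (4 * jj (2 + κ) x y - 2 * κ * pnorm (2 + κ) y ^ 2))) := by positivity
    linarith
  have hP := Pineq (2 + κ) hp x y
  have hM : ((Sp + Sm) / 2) ^ (2 / (2 + κ)) ≤ (β * n) ^ 2 := by
    refine hP.trans (le_of_eq ?_)
    rw [hTn, mul_pow β, hβ2]; ring
  have hβn : 0 < β * n := by positivity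
  have hdl := diff_lower (2 + κ) hp Sp Sm (β * n) (S_nonneg _ _) hlt hβn hM
  rw [← pn_sq, ← pn_sq] at hdl
  have hfin : 4 * jj (2 + κ) x y - 2 * κ * pnorm (2 + κ) y ^ 2 ≤
      2 / (2 + κ) * ((β * n) ^ (2 - (2 + κ)) * (Sp - Sm)) := by
    have hpw : (β * n) ^ (2 - (2 + κ)) = 1 / (β ^ κ * n ^ κ) := by
      rw [← Real.mul_rpow (by linarith) hn.le, show 2 - (2 + κ) = -κ by ring, Real.rpow_neg hβn.le, one_div]
    rw [hpw]
    have h9 : 2 / (2 + κ) * (1 / (β ^ κ * n ^ κ) * ((2 + κ) / 2 * (lam * (n ^ κ * (4 * jj (2 + κ) x y - 2 * κ * pnorm (2 + κ) y ^ 2))))) ≤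
      2 / (2 + κ) * (1 / (β ^ κ * n ^ κ) * (Sp - Sm)) := by gcongr
    refine le_trans ?_ h9
    have e : 2 / (2 + κ) * (1 / (β ^ κ * n ^ κ) * ((2 + κ) / 2 * (lam * (n ^ κ * (4 * jj (2 + κ) x y - 2 * κ * pnorm (2 + κ) y ^ 2))))) = lam / β ^ κ * (4 * jj (2 + κ) x y - 2 * κ * pnorm (2 + κ) y ^ 2) := by
      field_simp
    rw [e]
    have : 1 ≤ lam / β ^ κ := by rw [le_div_iff₀ hβk]; linarith
    nlinarith
  have := le_max_left (pnorm (2 + κ) (x + y) ^ 2 - pnorm (2 + κ) (x - y) ^ 2) 0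
  linarith

end vec


lemma disc_le (c d j : ℝ) (h : ∀ t : ℝ, 0 ≤ c - 2 * t * j + d * t ^ 2) : j ^ 2 ≤ c * d := by
  have := discrim_le_zero (a := d) (b := -(2 * j)) (c := c) (fun t => by
    have := h t
    linarith)
  unfold discrim at this
  linarith

section vec
variable {m : ℕ}

lemma S0 (κ : ℝ) (h0 : 0 ≤ κ) (x y : Fin m → ℝ) (D : ℝ)
    (hD : ∀ t : ℝ, D ≤ pnorm (2 + κ) (x + t • y) ^ 2) :
    jj (2 + κ) x y ^ 2 ≤ (pnorm (2 + κ) x ^ 2 - D) * ((1 + κ) * pnorm (2 + κ) y ^ 2) := by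
  apply disc_le
  intro t
  have h := Sineq (2 + κ) (by linarith) x (t • y)
  rw [jj_smul, pn_smul _ (by linarith), mul_pow, sq_abs] at h
  have h2 := hD (-t)
  rw [neg_smul, ← sub_eq_add_neg] at h2
  linarith

lemma case1 (κ : ℝ) (h0 : 0 ≤ κ) (x y : Fin m → ℝ) (D U A b' : ℝ) (g : ℝ → ℝ)
    (hD0 : 0 ≤ D) (hD1 : D < 1) (hU : U ≤ 2 - D) (hU0 : 0 ≤ U) (hA : 1 ≤ A) (hb' : 1 ≤ b')
    (hb : pnorm (2 + κ) y ^ 2 ≤ b')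
    (hg1 : ∀ t, 1 ≤ g t) (hg2 : ∀ t, g t ≤ 1 + t ^ 2) (hge : ∀ t, g (-t) = g t)
    (hlo : ∀ t : ℝ, D * g t ≤ pnorm (2 + κ) (x + t • y) ^ 2)
    (hup : ∀ t : ℝ, pnorm (2 + κ) (x + t • y) ^ 2 ≤ U * g t)
    (hj : 0 ≤ jj (2 + κ) x y) :
    jj (2 + κ) x y ^ 2 ≤ (A - D) * ((1 + κ) * b' - D) := by
  have hlo1 : ∀ t : ℝ, D ≤ pnorm (2 + κ) (x + t • y) ^ 2 := fun t => by
    have := hlo t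
    have := hg1 t
    nlinarith
  have hs := S0 κ h0 x y D hlo1
  set a := pnorm (2 + κ) x ^ 2 with ha
  set b := pnorm (2 + κ) y ^ 2 with hbb
  set j := jj (2 + κ) x y with hjj
  have haD : D ≤ a := by simpa using hlo1 0
  set Y := (1 + κ) * b' with hY
  have hYb : b' ≤ Y := by rw [hY]; nlinarith
  have hs2 : j ^ 2 ≤ (a - D) * Y := by
    refine hs.trans ?_
    have : 0 ≤ a - D := by linarith
    rw [hY]
    gcongr
  by_cases hcase : (a - D) * Y ≤ (A - D) * (Y - D)
  · exact hs2.trans hcase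
  push Not at hcase
  set ε := 1 - D with hε
  have hε0 : 0 < ε := by rw [hε]; linarith
  have hε1 : ε ≤ 1 := by rw [hε]; linarith
  have hm : 0 < Y - D := by linarith
  set t := Real.sqrt (ε / (Y - D)) with ht
  have ht2 : t ^ 2 = ε / (Y - D) := Real.sq_sqrt (by positivity)
  have ht0 : 0 < t := Real.sqrt_pos.2 (by positivity)
  have htm : t ^ 2 * (Y - D) = ε := by rw [ht2]; field_simp
  have hAe : ε * (Y - D) ≤ (A - D) * (Y - D) := by
    apply mul_le_mul_of_nonneg_right _ hm.le; linarith
  have haY : D * Y + ε * (Y - D) < a * Y := by linarith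
  have hY0 : 0 < Y := by linarith
  have hT : t ^ 2 * b ≤ 4 / 3 * a := by
    have key : ε * Y ^ 2 ≤ 4 / 3 * ((D * Y + ε * (Y - D)) * (Y - D)) := by
      have hx : 0 ≤ Y - 1 := by linarith
      have e : D = 1 - ε := by rw [hε]; ring
      rw [e]
      set z := Y - 1 with hz
      have e2 : Y = 1 + z := by rw [hz]; ring
      rw [e2]
      have k1 : 0 ≤ ε * (2 * ε - 1) ^ 2 := by positivity
      have k2 : 0 ≤ z * (4 / 3 * ε ^ 2 - 2 * ε + 4 / 3) := by
        apply mul_nonneg hx; nlinarith [sq_nonneg (ε - 3/4)]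
      have k3 : 0 ≤ z ^ 2 * (4 / 3 - ε) := by
        apply mul_nonneg (sq_nonneg z); linarith
      linarith
    have k1 : (D * Y + ε * (Y - D)) * (Y - D) ≤ a * Y * (Y - D) := by
      apply mul_le_mul_of_nonneg_right haY.le hm.le
    have k2 : ε * Y ≤ 4 / 3 * a * (Y - D) := by
      have : Y * (ε * Y) ≤ Y * (4 / 3 * a * (Y - D)) := by linarith
      exact le_of_mul_le_mul_left this hY0
    rw [ht2, div_mul_eq_mul_div, div_le_iff₀ hm]
    refine le_trans ?_ k2
    apply mul_le_mul_of_nonneg_left _ hε0.le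
    linarith
  have ha0 : 0 < a := by
    have : 0 < a * Y := by
      have : 0 ≤ D * Y := by positivity
      have : 0 < ε * (Y - D) := by positivity
      linarith
    exact (pos_iff_pos_of_mul_pos this).2 hY0
  have hn : 0 < pnorm (2 + κ) x := by
    rcases (pn_nonneg (2 + κ) x).eq_or_lt with h | h
    · rw [ha, ← h] at ha0; norm_num at ha0
    · exact h
  have hdel := Delta κ h0 x (t • y) hn (by
    rw [pn_smul _ (by linarith), mul_pow, sq_abs]; exact hT)
  rw [pn_smul _ (by linarith), mul_pow, sq_abs, jj_smul, ← hbb, ← hjj] at hdel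
  have hmax : max (pnorm (2 + κ) (x + t • y) ^ 2 - pnorm (2 + κ) (x - t • y) ^ 2) 0 ≤ 2 * ε * (1 + t ^ 2) := by
    apply max_le _ (by positivity)
    have h1 := hup t
    have h2 := hlo (-t)
    rw [neg_smul, ← sub_eq_add_neg, hge] at h2
    have h3 : (U - D) * g t ≤ 2 * ε * g t := by
      apply mul_le_mul_of_nonneg_right
      · rw [hε]; linarith
      · linarith [hg1 t]
    have h4 : 2 * ε * g t ≤ 2 * ε * (1 + t ^ 2) := mul_le_mul_of_nonneg_left (hg2 t) (by linarith)
    linarith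
  have h5 : t ^ 2 * (ε + κ * b) ≤ ε := by
    rw [← htm]
    apply mul_le_mul_of_nonneg_left _ (sq_nonneg t)
    rw [htm]
    have : κ * b ≤ κ * b' := mul_le_mul_of_nonneg_left hb h0
    rw [hε, hY]; linarith
  have h6 : t * j ≤ ε := by linarith
  have h7 : (t * j) ^ 2 ≤ ε ^ 2 := by
    apply pow_le_pow_left₀ (by positivity) h6
  have h8 : t ^ 2 * j ^ 2 ≤ t ^ 2 * (ε * (Y - D)) := by
    have : t ^ 2 * (ε * (Y - D)) = ε ^ 2 := by linear_combination ε * htm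
    rw [this]; linarith
  have h9 := le_of_mul_le_mul_left h8 (by positivity)
  linarith

end vec


noncomputable def Vb (r : ℝ) : ℝ := 1 + 181/100 * r + 307/100 * r ^ 2 + 179/50 * r ^ 3 + 69/10 * r ^ 4
noncomputable def Qb (r : ℝ) : ℝ := 157/100 * r * (1 + 81/100 * r ^ 2 + 4/5 * r ^ 4)
noncomputable def cb (r : ℝ) : ℝ := 1/3 + 2/3 * Qb r ^ 2
noncomputable def Lb (r : ℝ) : ℝ := (1 + 2 * r) / 3 + 2/3 * Vb r
noncomputable def xb (r : ℝ) : ℝ := 181/100 * r + 57/40 * r ^ 2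

noncomputable def Bn8 (c0 c1 c2 c3 c4 c5 c6 c7 c8 a c : ℝ) : ℝ :=
  c0 * a ^ 0 * c ^ 8 + c1 * a ^ 1 * c ^ 7 + c2 * a ^ 2 * c ^ 6 + c3 * a ^ 3 * c ^ 5 + c4 * a ^ 4 * c ^ 4 + c5 * a ^ 5 * c ^ 3 + c6 * a ^ 6 * c ^ 2 + c7 * a ^ 7 * c ^ 1 + c8 * a ^ 8 * c ^ 0

lemma Bn8_nonneg (c0 c1 c2 c3 c4 c5 c6 c7 c8 a c : ℝ) (ha : 0 ≤ a) (hc : 0 ≤ c) (h0 : 0 ≤ c0) (h1 : 0 ≤ c1) (h2 : 0 ≤ c2) (h3 : 0 ≤ c3) (h4 : 0 ≤ c4) (h5 : 0 ≤ c5) (h6 : 0 ≤ c6) (h7 : 0 ≤ c7) (h8 : 0 ≤ c8) :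
    0 ≤ Bn8 c0 c1 c2 c3 c4 c5 c6 c7 c8 a c := by
  unfold Bn8; positivity

noncomputable def Bn10 (c0 c1 c2 c3 c4 c5 c6 c7 c8 c9 c10 a c : ℝ) : ℝ :=
  c0 * a ^ 0 * c ^ 10 + c1 * a ^ 1 * c ^ 9 + c2 * a ^ 2 * c ^ 8 + c3 * a ^ 3 * c ^ 7 + c4 * a ^ 4 * c ^ 6 + c5 * a ^ 5 * c ^ 5 + c6 * a ^ 6 * c ^ 4 + c7 * a ^ 7 * c ^ 3 + c8 * a ^ 8 * c ^ 2 + c9 * a ^ 9 * c ^ 1 + c10 * a ^ 10 * c ^ 0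

lemma Bn10_nonneg (c0 c1 c2 c3 c4 c5 c6 c7 c8 c9 c10 a c : ℝ) (ha : 0 ≤ a) (hc : 0 ≤ c) (h0 : 0 ≤ c0) (h1 : 0 ≤ c1) (h2 : 0 ≤ c2) (h3 : 0 ≤ c3) (h4 : 0 ≤ c4) (h5 : 0 ≤ c5) (h6 : 0 ≤ c6) (h7 : 0 ≤ c7) (h8 : 0 ≤ c8) (h9 : 0 ≤ c9) (h10 : 0 ≤ c10) :
    0 ≤ Bn10 c0 c1 c2 c3 c4 c5 c6 c7 c8 c9 c10 a c := by
  unfold Bn10; positivity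

noncomputable def Bn20 (c0 c1 c2 c3 c4 c5 c6 c7 c8 c9 c10 c11 c12 c13 c14 c15 c16 c17 c18 c19 c20 a c : ℝ) : ℝ :=
  c0 * a ^ 0 * c ^ 20 + c1 * a ^ 1 * c ^ 19 + c2 * a ^ 2 * c ^ 18 + c3 * a ^ 3 * c ^ 17 + c4 * a ^ 4 * c ^ 16 + c5 * a ^ 5 * c ^ 15 + c6 * a ^ 6 * c ^ 14 + c7 * a ^ 7 * c ^ 13 + c8 * a ^ 8 * c ^ 12 + c9 * a ^ 9 * c ^ 11 + c10 * a ^ 10 * c ^ 10 + c11 * a ^ 11 * c ^ 9 + c12 * a ^ 12 * c ^ 8 + c13 * a ^ 13 * c ^ 7 + c14 * a ^ 14 * c ^ 6 + c15 * a ^ 15 * c ^ 5 + c16 * a ^ 16 * c ^ 4 + c17 * a ^ 17 * c ^ 3 + c18 * a ^ 18 * c ^ 2 + c19 * a ^ 19 * c ^ 1 + c20 * a ^ 20 * c ^ 0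

lemma Bn20_nonneg (c0 c1 c2 c3 c4 c5 c6 c7 c8 c9 c10 c11 c12 c13 c14 c15 c16 c17 c18 c19 c20 a c : ℝ) (ha : 0 ≤ a) (hc : 0 ≤ c) (h0 : 0 ≤ c0) (h1 : 0 ≤ c1) (h2 : 0 ≤ c2) (h3 : 0 ≤ c3) (h4 : 0 ≤ c4) (h5 : 0 ≤ c5) (h6 : 0 ≤ c6) (h7 : 0 ≤ c7) (h8 : 0 ≤ c8) (h9 : 0 ≤ c9) (h10 : 0 ≤ c10) (h11 : 0 ≤ c11) (h12 : 0 ≤ c12) (h13 : 0 ≤ c13) (h14 : 0 ≤ c14) (h15 : 0 ≤ c15) (h16 : 0 ≤ c16) (h17 : 0 ≤ c17) (h18 : 0 ≤ c18) (h19 : 0 ≤ c19) (h20 : 0 ≤ c20) :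
    0 ≤ Bn20 c0 c1 c2 c3 c4 c5 c6 c7 c8 c9 c10 c11 c12 c13 c14 c15 c16 c17 c18 c19 c20 a c := by
  unfold Bn20; positivity

lemma poly_b0 (r : ℝ) (h0 : 0 ≤ r) (h1 : r ≤ 1/2) :
    Vb r ≤ 2 + 2 * Qb r ^ 2 := by
  obtain ⟨w, hw⟩ : ∃ w, w = 1/2 - r := ⟨_, rfl⟩
  have hw0 : 0 ≤ w := by linarith
  have e : (2 + 2 * Qb r ^ 2) - (Vb r) = Bn10 (1024) (232832/25) (23884768/625) (58042944/625) (2302943876/15625) (2480272856/15625) (364947734089/3125000) (45126142089/781250) (29003423647/1562500) (2875600269/781250) (1222923649/3125000) r w := by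
    rw [hw]; unfold Vb Qb Bn10; ring
  rw [← sub_nonneg, e]
  apply Bn10_nonneg _ _ _ _ _ _ _ _ _ _ _ _ _ h0 hw0 <;> positivity

lemma poly_a1 (r : ℝ) (h0 : 0 ≤ r) (h1 : r ≤ 1/2) :
    Vb r - 1 ≤ Qb r ^ 2 * (3/5 + Qb r ^ 2) * (5/8) + 2 * Qb r * (79/125 * Qb r + 3/5) := by
  obtain ⟨w, hw⟩ : ∃ w, w = 1/2 - r := ⟨_, rfl⟩
  have hw0 : 0 ≤ w := by linarith
  have e : (Qb r ^ 2 * (3/5 + Qb r ^ 2) * (5/8) + 2 * Qb r * (79/125 * Qb r + 3/5)) - (Vb r - 1) = Bn20 (0) (4849664/125) (77454768128/78125) (854845435904/78125) (140912353137696/1953125) (634589122740736/1953125) (52456145377983168/48828125) (133151368643316352/48828125) (213844029520072183/39062500) (433329105865547641/48828125) (460528804321984782641/39062500000) (50632709772825160721/3906250000) (741025248935595406051921/62500000000000) (70498816774388886963921/7812500000000) (88747908955750874276267/15625000000000) (22780107015142596764307/7812500000000) (7449377293333792920607/6250000000000) (2915884241690407004847/7812500000000) (1312881320635494177347/15625000000000)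 (94500097118405581581/7812500000000) (52239648412236115201/62500000000000) r w := by
    rw [hw]; unfold Vb Qb Bn20; ring
  rw [← sub_nonneg, e]
  apply Bn20_nonneg _ _ _ _ _ _ _ _ _ _ _ _ _ _ _ _ _ _ _ _ _ _ _ h0 hw0 <;> positivity

lemma poly_a0 (r : ℝ) (h0 : 0 ≤ r) (h1 : r ≤ 1/2) :
    (1 + 2 * r) / 3 + 2 / 3 * (Vb r - 1) ≤ (1/3 + 2/3 * Qb r ^ 2) ^ 2 + 2 * (1/3 + 2/3 * Qb r ^ 2) := by
  obtain ⟨w, hw⟩ : ∃ w, w = 1/2 - r := ⟨_, rfl⟩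
  have hw0 : 0 ≤ w := by linarith
  have e : ((1/3 + 2/3 * Qb r ^ 2) ^ 2 + 2 * (1/3 + 2/3 * Qb r ^ 2)) - ((1 + 2 * r) / 3 + 2 / 3 * (Vb r - 1)) = Bn20 (4194304/9) (1876164608/225) (396548243456/5625) (701315547136/1875) (4903961956762624/3515625) (13644065479081984/3515625) (733417524441646336/87890625) (1245827081981576704/87890625) (42394328440164064664/2197265625) (5188708158069086752/244140625) (1050186912133982152241/54931640625) (52138183954391795894/3662109375) (263976995718710018977307/29296875000000) (55668523568756692403921/10986328125000) (58343659303949599396267/21972656250000) (14314605324520104604307/10986328125000) (549924894056801979623/976562500000) (2141220446055406684847/10986328125000) (1070607757921891617347/21972656250000) (84417296407142861581/10986328125000) (50154469652955475201/87890625000000) r w := by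
    rw [hw]; unfold Vb Qb Bn20; ring
  rw [← sub_nonneg, e]
  apply Bn20_nonneg _ _ _ _ _ _ _ _ _ _ _ _ _ _ _ _ _ _ _ _ _ _ _ h0 hw0 <;> positivity

lemma poly_b1 (r : ℝ) (h0 : 0 ≤ r) (h1 : r ≤ 1/2) :
    Vb r + 3/5 * (Vb r ^ 2 / 4 - Vb r / 12) - 7/5 ≤ Qb r ^ 2 * (3/5 + Qb r ^ 2) * (5/8) + 2 * Qb r * (79/125 * Qb r + 3/5) + 3/5 * Qb r ^ 2 := by
  obtain ⟨w, hw⟩ : ∃ w, w = 1/2 - r := ⟨_, rfl⟩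
  have hw0 : 0 ≤ w := by linarith
  have e : (Qb r ^ 2 * (3/5 + Qb r ^ 2) * (5/8) + 2 * Qb r * (79/125 * Qb r + 3/5) + 3/5 * Qb r ^ 2) - (Vb r + 3/5 * (Vb r ^ 2 / 4 - Vb r / 12) - 7/5) = Bn20 (1572864/5) (761626624/125) (4399247280128/78125) (25756978069504/78125) (2674426614616096/1953125) (8361035748635136/1953125) (509374331154410368/48828125) (988610770278097152/48828125) (1238522342230570743/39062500) (1969730567208504441/48828125) (1632150729698428942641/39062500000) (137276963428394312721/3906250000) (1489325721808352654051921/62500000000000) (100482380435215510963921/7812500000000) (84665093298443226276267/15625000000000) (13526676824216260764307/7812500000000) (2521124893997754520607/6250000000000) (512740918244135004847/7812500000000) (117881774665318177347/15625000000000) (5939573009093581581/7812500000000) (4128367151692115201/62500000000000) r w := by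
    rw [hw]; unfold Vb Qb Bn20; ring
  rw [← sub_nonneg, e]
  apply Bn20_nonneg _ _ _ _ _ _ _ _ _ _ _ _ _ _ _ _ _ _ _ _ _ _ _ h0 hw0 <;> positivity

lemma poly_b2 (r : ℝ) (h0 : 0 ≤ r) (h1 : r ≤ 1/2) :
    Lb r + 3/5 * (3 * Lb r ^ 2 / 8 - Lb r / 12) - 14/15 ≤ (3/5 * cb r + 2 * Qb r ^ 2 * cb r - Qb r ^ 4) * (5/8) + 2 * (5577/10000 + 5303/5000 * (cb r - 1/3)) + 3/5 * cb r := by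
  obtain ⟨w, hw⟩ : ∃ w, w = 1/2 - r := ⟨_, rfl⟩
  have hw0 : 0 ≤ w := by linarith
  have e : ((3/5 * cb r + 2 * Qb r ^ 2 * cb r - Qb r ^ 4) * (5/8) + 2 * (5577/10000 + 5303/5000 * (cb r - 1/3)) + 3/5 * cb r) - (Lb r + 3/5 * (3 * Lb r ^ 2 / 8 - Lb r / 12) - 14/15) = Bn20 (2356805632/1875) (1782317056/75) (250010413236224/1171875) (1416504826028032/1171875) (47315145427173856/9765625) (427613915896805888/29296875) (25095639957480255944/732421875) (15655321700597333072/244140625) (94781048970027327957/976562500) (29248912550201771327/244140625) (14184516044119891512881/117187500000) (1172231983913285375249/11718750000) (12616191348614130961123921/187500000000000) (285009676385628658833307/7812500000000) (735503410056236413604267/46875000000000) (122432079045753352860307/23437500000000) (24298982361372533503007/18750000000000) (5279757297192008796847/23437500000000) (1151919143964468513347/46875000000000) (10326907189025604527/7812500000000) (837925102469233067/62500000000000) r w := by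
    rw [hw]; unfold Lb cb Vb Qb Bn20; ring
  rw [← sub_nonneg, e]
  apply Bn20_nonneg _ _ _ _ _ _ _ _ _ _ _ _ _ _ _ _ _ _ _ _ _ _ _ h0 hw0 <;> positivity

lemma poly_P (r : ℝ) (h0 : 0 ≤ r) (h1 : r ≤ 1/2) :
    1 + xb r + xb r ^ 2 / 2 + xb r ^ 3 / 6 + 609/10000 * xb r ^ 4 ≤ Vb r := by
  obtain ⟨w, hw⟩ : ∃ w, w = 1/2 - r := ⟨_, rfl⟩
  have hw0 : 0 ≤ w := by linarith
  have e : (Vb r) - (1 + xb r + xb r ^ 2 / 2 + xb r ^ 3 / 6 + 609/10000 * xb r ^ 4) = Bn8 (0) (0) (278/625) (575159/187500) (10315305487933/187500000000) (31333472024237/187500000000) (275394736530679/1500000000000) (212090405488177/3000000000000) (75302222481053/48000000000000) r w := by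
    rw [hw]; unfold xb Vb Bn8; ring
  rw [← sub_nonneg, e]
  apply Bn8_nonneg _ _ _ _ _ _ _ _ _ _ _ h0 hw0 <;> positivity



lemma four_rpow (r : ℝ) (h0 : 0 ≤ r) (h1 : r ≤ 1/2) : (4:ℝ) ^ r ≤ 1 + 2 * r := by
  have : (4:ℝ) ^ r = (1 + 1) ^ (2 * r) := by
    rw [Real.rpow_mul (by norm_num)]; norm_num
  rw [this]
  have := rpow_one_add_le_one_add_mul_self (s := 1) (by norm_num) (p := 2 * r) (by linarith) (by linarith)
  linarith

lemma exp_ub (x : ℝ) (h0 : 0 ≤ x) (h1 : x ≤ 631/500) :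
    Real.exp x ≤ 1 + x + x ^ 2 / 2 + x ^ 3 / 6 + 609/10000 * x ^ 4 := by
  have := nonneg_of_derivab 0 x
    (fun x => (1 + x + x ^ 2 / 2 + x ^ 3 / 6 + 609/10000 * x ^ 4) * Real.exp (-x) - 1)
    (fun x => (x ^ 3 * (4 * (609/10000) - 1/6 - 609/10000 * x)) * Real.exp (-x))
    (by
      intro t ht1 ht2
      have h1 : HasDerivAt (fun x : ℝ => 1 + x + x ^ 2 / 2 + x ^ 3 / 6 + 609/10000 * x ^ 4)
        (0 + 1 + (2 * t) / 2 + (3 * t ^ 2) / 6 + 609/10000 * (4 * t ^ 3)) t := by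
        have a2 := hasDerivAt_pow 2 t
        have a3 := hasDerivAt_pow 3 t
        have a4 := hasDerivAt_pow 4 t
        have := (((((hasDerivAt_const t (1:ℝ)).add (hasDerivAt_id t)).add (a2.div_const 2)).add (a3.div_const 6)).add (a4.const_mul (609/10000)))
        exact this.congr_deriv (by norm_num)
      have h2 : HasDerivAt (fun x : ℝ => Real.exp (-x)) (Real.exp (-t) * (-1)) t :=
        (Real.hasDerivAt_exp (-t)).comp t (hasDerivAt_neg t)
      exact ((h1.mul h2).sub_const 1).congr_deriv (by ring))
    (by simp)
    (by
      intro t ht1 ht2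
      have : 0 ≤ t := by linarith
      have : 0 ≤ 4 * (609/10000) - 1/6 - 609/10000 * t := by linarith
      positivity) h0
  have he := Real.exp_pos x
  have e1 : Real.exp x * Real.exp (-x) = 1 := by rw [← Real.exp_add]; simp
  set P := 1 + x + x ^ 2 / 2 + x ^ 3 / 6 + 609/10000 * x ^ 4
  have : 0 ≤ Real.exp x * (P * Real.exp (-x) - 1) := by positivity
  nlinarith

lemma cube_le_exp (x : ℝ) (h0 : 0 ≤ x) : 1 + x + x ^ 2 / 2 + x ^ 3 / 6 ≤ Real.exp x := by
  have := Real.sum_le_exp_of_nonneg h0 4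
  simp [Finset.sum_range_succ, Nat.factorial] at this
  linarith

lemma sin_ge (x : ℝ) (h0 : 0 ≤ x) (h1 : x ≤ 1) : x * Real.cos x ≤ Real.sin x := by
  have := nonneg_of_derivab 0 x (fun x => Real.sin x - x * Real.cos x) (fun x => x * Real.sin x)
    (by
      intro t ht1 ht2
      exact ((Real.hasDerivAt_sin t).sub ((hasDerivAt_id t).mul (Real.hasDerivAt_cos t))).congr_deriv (by simp))
    (by simp)
    (by
      intro t ht1 ht2
      have h1' := ht1
      have h2 := ht2
      exact mul_nonneg (by linarith) (Real.sin_nonneg_of_nonneg_of_le_pi (by linarith) (by linarith [Real.pi_gt_three]))) h0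
  linarith

lemma sin_ge2 (x : ℝ) (h0 : 0 ≤ x) (h1 : x ≤ 1) : x * Real.cos x ≤ Real.sin x * (1 - x ^ 2 / 3) := by
  have := nonneg_of_derivab 0 x (fun x => Real.sin x * (1 - x ^ 2 / 3) - x * Real.cos x)
    (fun x => x / 3 * (Real.sin x - x * Real.cos x))
    (by
      intro t ht1 ht2
      exact (((Real.hasDerivAt_sin t).mul (((hasDerivAt_pow 2 t).div_const 3).const_sub 1)).sub ((hasDerivAt_id t).mul (Real.hasDerivAt_cos t))).congr_deriv (by simp; ring))
    (by simp)
    (by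
      intro t ht1 ht2
      have h1' := ht1
      have h2 := ht2
      have := sin_ge t (by linarith) (by linarith)
      exact mul_nonneg (by linarith) (by linarith)) h0
  linarith

lemma Qb_le (r : ℝ) (h0 : 0 < r) (h1 : r ≤ 1/2) :
    Qb r * Real.cos (Real.pi * r / 2) ≤ Real.sin (Real.pi * r / 2) := by
  set θ := Real.pi * r / 2 with hθ
  have p1 := Real.pi_gt_d6
  have p2 := Real.pi_lt_d6
  have hθ0 : 157/100 * r ≤ θ := by rw [hθ]; nlinarith
  have hθp : 0 < θ := by positivity
  have hθ1 : θ ≤ 1 := by rw [hθ]; nlinarith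
  have hs := sin_ge2 θ hθp.le hθ1
  have hX : 8224/10000 * r ^ 2 ≤ θ ^ 2 / 3 := by
    have : 8224/10000 * 12 ≤ Real.pi ^ 2 := by nlinarith
    rw [hθ]; nlinarith [sq_nonneg r]
  have hpos : 0 < 1 - θ ^ 2 / 3 := by nlinarith
  have hc : 0 ≤ Real.cos θ := Real.cos_nonneg_of_neg_pi_div_two_le_of_le (by linarith) (by linarith)
  have hQ : Qb r * (1 - θ ^ 2 / 3) ≤ θ := by
    unfold Qb
    have h3 : (1 + 81/100 * r ^ 2 + 4/5 * r ^ 4) * (1 - θ ^ 2 / 3) ≤ 1 := by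
      have : (1 + 81/100 * r ^ 2 + 4/5 * r ^ 4) * (1 - θ ^ 2 / 3) ≤ (1 + 81/100 * r ^ 2 + 4/5 * r ^ 4) * (1 - 8224/10000 * r ^ 2) := by gcongr
      have h4 : 0 ≤ r ^ 2 * (124/10000 - 133856/1000000 * r ^ 2 + 65792/100000 * (r ^ 2) ^ 2) := by
        apply mul_nonneg (by positivity)
        nlinarith [sq_nonneg (r ^ 2 - 1/10)]
      nlinarith
    nlinarith
  have : Qb r * Real.cos θ * (1 - θ ^ 2 / 3) ≤ Real.sin θ * (1 - θ ^ 2 / 3) := by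
    nlinarith
  exact le_of_mul_le_mul_right this hpos

lemma V1_le (r T : ℝ) (h0 : 0 < r) (h1 : r ≤ 1/2) (hT : 0 ≤ T)
    (hTc : T * Real.cos (Real.pi * r / 2) ^ 2 = 1) :
    (4 + 2 * T ^ (1 / r)) ^ r ≤ Vb r := by
  set θ := Real.pi * r / 2 with hθ
  have p1 := Real.pi_gt_d6
  have p2 := Real.pi_lt_d6
  have hθp : 0 < θ := by positivity
  have hθ1 : θ ≤ 1 := by rw [hθ]; nlinarith
  have hX : θ ^ 2 ≤ 24675/10000 * r ^ 2 := by
    have : Real.pi ^ 2 ≤ 24675/10000 * 4 := by nlinarith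
    rw [hθ]; nlinarith [sq_nonneg r]
  have hc1 : 1 - θ ^ 2 / 2 + θ ^ 4 / 32 ≤ Real.cos θ := by
    have := Real.one_sub_sq_div_two_le_cos (x := θ / 2)
    have h2 : Real.cos θ = 2 * Real.cos (θ / 2) ^ 2 - 1 := by rw [← Real.cos_two_mul]; congr 1; ring
    have : 0 ≤ 1 - (θ / 2) ^ 2 / 2 := by nlinarith
    rw [h2]; nlinarith
  have hr2 : r ^ 2 ≤ 1/4 := by nlinarith
  have hc2 : 1 - 24675/20000 * r ^ 2 + (24675/10000 * r ^ 2) ^ 2 / 32 ≤ Real.cos θ := by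
    nlinarith [mul_nonneg (sub_nonneg.2 hX) (show 0 ≤ 16 - θ ^ 2 - 24675/10000 * r ^ 2 by nlinarith)]
  set y := 1425/1000 * r ^ 2 with hy
  have hy0 : 0 ≤ y := by positivity
  have hey := cube_le_exp y hy0
  have h1c : 1 ≤ Real.exp y * Real.cos θ := by
    have a : 0 ≤ 1 - 24675/20000 * r ^ 2 + (24675/10000 * r ^ 2) ^ 2 / 32 := by nlinarith
    have : (1 + y + y ^ 2 / 2 + y ^ 3 / 6) * (1 - 24675/20000 * r ^ 2 + (24675/10000 * r ^ 2) ^ 2 / 32) ≤ Real.exp y * Real.cos θ := by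
      gcongr
    refine le_trans ?_ this
    obtain ⟨X, hXX⟩ : ∃ X, X = r ^ 2 := ⟨_, rfl⟩
    rw [hy, ← hXX]
    rw [← hXX] at hr2
    have hX0 : 0 ≤ X := by rw [hXX]; positivity
    obtain ⟨w, hw⟩ : ∃ w, w = 1/4 - X := ⟨_, rfl⟩
    have hw0 : 0 ≤ w := by linarith
    have : 0 ≤ X * w ^ 4 := by positivity
    have : 0 ≤ X ^ 2 * w ^ 3 := by positivity
    have : 0 ≤ X ^ 3 * w ^ 2 := by positivity
    have : 0 ≤ X ^ 4 * w := by positivity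
    have : 0 ≤ X ^ 5 := by positivity
    subst hw
    linarith
  have hc0 : 0 < Real.cos θ := by
    by_contra h
    nlinarith [Real.exp_pos y]
  have hTe : T ≤ Real.exp (2 * y) := by
    have e2 : Real.exp (2 * y) = Real.exp y ^ 2 := by rw [← Real.exp_nat_mul]; norm_num
    have : 1 ≤ Real.exp y ^ 2 * Real.cos θ ^ 2 := by rw [← mul_pow]; exact one_le_pow₀ h1c
    rw [e2]
    rw [← hTc] at this
    exact le_of_mul_le_mul_right this (by positivity)
  set z := Real.exp (1425/1000 * r) with hz
  have hTz : T ^ (1 / r) ≤ z ^ 2 := by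
    have : z ^ 2 = Real.exp (2 * y) ^ (1 / r) := by
      rw [hz, ← Real.exp_nat_mul, ← Real.exp_mul, hy]; congr 1; field_simp
      norm_num
    rw [this]; gcongr
  have hz1 : 1 ≤ z := by rw [hz]; exact Real.one_le_exp (by positivity)
  have hz2 : z ≤ 205/100 := by
    have := exp_ub (1425/2000) (by norm_num) (by norm_num)
    have : z ≤ Real.exp (1425/2000) := by rw [hz]; apply Real.exp_le_exp.2; linarith
    norm_num at *
    linarith
  have h61 : (61:ℝ)/10 ≤ Real.exp (181/100) := by
    have e : Real.exp (181/100) = Real.exp (181/1000) ^ 10 := by rw [← Real.exp_nat_mul]; norm_num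
    have := cube_le_exp (181/1000) (by norm_num)
    rw [e]
    refine le_trans ?_ (pow_le_pow_left₀ (by norm_num) this 10)
    norm_num
  have h4 : 4 + 2 * T ^ (1 / r) ≤ Real.exp (181/100 + 1425/1000 * r) := by
    rw [Real.exp_add, ← hz]
    nlinarith
  have h5 : (4 + 2 * T ^ (1 / r)) ^ r ≤ Real.exp (xb r) := by
    have : Real.exp (xb r) = Real.exp (181/100 + 1425/1000 * r) ^ r := by
      rw [← Real.exp_mul]; congr 1; unfold xb; ring
    rw [this]; gcongr
  have hx0 : 0 ≤ xb r := by unfold xb; positivity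
  have hx1 : xb r ≤ 631/500 := by unfold xb; nlinarith
  exact h5.trans ((exp_ub _ hx0 hx1).trans (poly_P r h0.le h1))


lemma my_le_of_sq {a b : ℝ} (h : a ^ 2 ≤ b ^ 2) (hb : 0 ≤ b) : a ≤ b :=
  (le_abs_self a).trans (abs_le_of_sq_le_sq h hb)

lemma cs_lin (p1 q1 p2 q2 K S l0 l1 : ℝ) (hp1 : 0 ≤ p1) (hq1 : 0 ≤ q1) (hp2 : 0 ≤ p2) (hq2 : 0 ≤ q2)
    (hl0 : 0 ≤ l0) (hl1 : 0 ≤ l1)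
    (hK : K ^ 2 ≤ p1 * q1) (hS : S ^ 2 ≤ p2 * q2) :
    (l0 * K + l1 * S) ^ 2 ≤ (l0 * p1 + l1 * p2) * (l0 * q1 + l1 * q2) := by
  have h1 : 2 * (K * S) ≤ p1 * q2 + p2 * q1 := by
    apply my_le_of_sq
    · have : K ^ 2 * S ^ 2 ≤ (p1 * q1) * (p2 * q2) := by gcongr
      nlinarith [sq_nonneg (p1 * q2 - p2 * q1)]
    · positivity
  have h2 : 0 ≤ l0 * l1 * (p1 * q2 + p2 * q1 - 2 * (K * S)) := by
    apply mul_nonneg (mul_nonneg hl0 hl1); linarith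
  have h3 : 0 ≤ l0 ^ 2 * (p1 * q1 - K ^ 2) := mul_nonneg (sq_nonneg _) (by linarith)
  have h4 : 0 ≤ l1 ^ 2 * (p2 * q2 - S ^ 2) := mul_nonneg (sq_nonneg _) (by linarith)
  linarith

lemma rpow_half_le (R κ : ℝ) (hR : 0 < R) (h0 : 0 ≤ κ) (h1 : κ ≤ 3/5) :
    R ^ (κ / 2) ≤ 1 + κ * (R / 4 - 1 / 12) := by
  set z := R ^ ((1:ℝ) / 3) with hz
  have hz0 : 0 < z := by positivity
  have hz3 : z ^ 3 = R := by
    rw [hz, ← Real.rpow_natCast, ← Real.rpow_mul hR.le]; norm_num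
  have e : R ^ (κ / 2) = (1 + (z - 1)) ^ (3 * κ / 2) := by
    rw [show 1 + (z - 1) = z by ring, hz, ← Real.rpow_mul hR.le]; congr 1; ring
  have hb := rpow_one_add_le_one_add_mul_self (s := z - 1) (by linarith) (p := 3 * κ / 2) (by linarith) (by linarith)
  have hzz : z ≤ 17/18 + R / 6 := by
    rw [← hz3]
    nlinarith [mul_nonneg (sq_nonneg (z - 14143/10000)) (show 0 ≤ z + 2 * (14143/10000) by linarith)]
  rw [e]
  nlinarith

set_option maxHeartbeats 1000000 in
lemma scal0 (r κ d v α ι e t Q : ℝ) (hr0 : 0 ≤ r) (hr1 : r ≤ 1/2) (hκ : 0 ≤ κ) (hd0 : 0 < d) (hd1 : d ≤ 1)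
    (hQ : Q = Qb r) (ht : t = Q ^ 2) (he : e = 1 - d + d * t) 
    (hv0 : 0 < v) (hv : v ≤ (1 - d) * (1 + 2 * r) + d * Vb r)
    (hα : e * (κ + e) ≤ (α - d) * (1 + κ)) (hι0 : 0 ≤ ι) (hι : e * (κ + e) < ι ^ 2)
    (h3 : α + 2 * ι ≤ v)
    (h4 : κ ≤ 3/5 → (2 + κ) * ι + α + (1 - κ) * d ≤ v * (v / d) ^ (κ / 2)) : False := by
  have hQ0 : 0 ≤ Q := by rw [hQ]; unfold Qb; positivity
  have hQ1 : Q ≤ 1 := by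
    rw [hQ]; unfold Qb
    have : r ^ 2 ≤ (1/2) ^ 2 := by gcongr
    have : r ^ 4 ≤ (1/2) ^ 4 := by gcongr
    have : 157/100 * r * (1 + 81/100 * r ^ 2 + 4/5 * r ^ 4) ≤ 157/100 * (1/2) * (1 + 81/100 * (1/2)^2 + 4/5 * (1/2)^4) := by gcongr
    norm_num at this ⊢
    linarith
  have ht0 : 0 ≤ t := by rw [ht]; positivity
  have ht1 : t ≤ 1 := by rw [ht]; nlinarith
  have he0 : 0 ≤ e := by rw [he]; nlinarith
  have he1 : e ≤ 1 := by rw [he]; nlinarith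
  have het : t ≤ e := by rw [he]; nlinarith
  have hb0 := poly_b0 r hr0 hr1
  have ha1 := poly_a1 r hr0 hr1
  have ha0 := poly_a0 r hr0 hr1
  have hb1 := poly_b1 r hr0 hr1
  have hb2 := poly_b2 r hr0 hr1
  have hL : Lb r = (1 + 2 * r) / 3 + 2/3 * Vb r := rfl
  have hcb : cb r = 1/3 + 2/3 * t := by rw [ht, hQ]; rfl
  rw [← hQ] at hb0 ha1 ha0 hb1 hb2
  rw [show Q ^ 4 = t ^ 2 by rw [ht]; ring] at hb2
  rw [← ht] at hb0 ha1 ha0 hb1 hb2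
  rw [← hcb] at ha0
  obtain ⟨S, hS⟩ : ∃ S, S = Q * (79/125 * Q + 3/5) := ⟨_, rfl⟩
  have hS0 : 0 ≤ S := by rw [hS]; positivity
  have hS2 : S ^ 2 ≤ t * (t + 3/5) := by
    have : (79/125 * Q + 3/5) ^ 2 ≤ Q ^ 2 + 3/5 := by nlinarith [sq_nonneg (Q - 6314/10000)]
    calc S ^ 2 = Q ^ 2 * (79/125 * Q + 3/5) ^ 2 := by rw [hS]; ring
      _ ≤ Q ^ 2 * (Q ^ 2 + 3/5) := by gcongr
      _ = _ := by rw [ht]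
  rw [show 2 * Q * (79/125 * Q + 3/5) = 2 * S by rw [hS]; ring] at ha1 hb1
  clear hS
  generalize Vb r = V at *
  generalize Lb r = L at *
  generalize cb r = c at *
  have hιe : e ≤ ι := by
    apply my_le_of_sq _ hι0
    have := mul_nonneg he0 hκ
    linarith
  rcases le_total (3/5) κ with hk | hk
  · -- large κ
    have ha : 5/8 * (e * (3/5 + e)) ≤ α - d := by
      have h1 : e * (κ + e) * 8 / 5 ≥ e * (3/5 + e) * (1 + κ) := by
        linarith [mul_nonneg he0 (mul_nonneg (sub_nonneg.2 hk) (sub_nonneg.2 he1))]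
      have : 5/8 * (e * (3/5 + e)) * (1 + κ) ≤ (α - d) * (1 + κ) := by linarith
      exact le_of_mul_le_mul_right this (by linarith)
    have hl : ((1 - d) * (126/100) + d * S) < ι := by
      apply lt_of_pow_lt_pow_left₀ 2 hι0
      have := cs_lin 1 (8/5) t (t + 3/5) (126/100) S (1 - d) d (by norm_num) (by norm_num) ht0 (by linarith) (by linarith) hd0.le (by norm_num) hS2
      have e1 : ((1 - d) * 1 + d * t) * ((1 - d) * (8/5) + d * (t + 3/5)) = e * (3/5 + e) := by rw [he]; ring
      rw [e1] at this
      have hke : e * (3/5 + e) ≤ e * (κ + e) := by gcongr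
      linarith
    have he2 : 2 * t * e - t ^ 2 ≤ e ^ 2 := by linarith [sq_nonneg (e - t)]
    have hd0' : 0 ≤ (1 - d) * ((5/8) * (3/5 + 2 * t - t ^ 2) + 2 * (126/100) - (1 + 2 * r)) := by
      apply mul_nonneg (by linarith); have := mul_nonneg ht0 (sub_nonneg.2 ht1); linarith
    have hd1' : 0 ≤ d * (t * (3/5 + t) * (5/8) + 2 * S - (V - 1)) := by
      apply mul_nonneg hd0.le; linarith
    have e2 : (5/8) * (3/5 * e + 2 * t * e - t ^ 2) + 2 * ((1 - d) * (126/100) + d * S) + d - ((1 - d) * (1 + 2 * r) + d * V)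
      = (1 - d) * ((5/8) * (3/5 + 2 * t - t ^ 2) + 2 * (126/100) - (1 + 2 * r)) + d * (t * (3/5 + t) * (5/8) + 2 * S - (V - 1)) := by
      rw [he]; ring
    linarith
  rcases le_total d (2/3) with hd | hd
  · have ha : e ^ 2 ≤ α - d := by
      have : e ^ 2 * (1 + κ) ≤ (α - d) * (1 + κ) := by
        linarith [mul_nonneg (mul_nonneg he0 hκ) (sub_nonneg.2 he1)]
      exact le_of_mul_le_mul_right this (by linarith)
    have hιe' : e < ι := by
      apply lt_of_pow_lt_pow_left₀ 2 hι0
      have := mul_nonneg he0 hκ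
      linarith
    have hc0 : 0 ≤ c := by linarith
    have hc1 : c ≤ 1 := by linarith
    have he2 : 2 * c * e - c ^ 2 ≤ e ^ 2 := by linarith [sq_nonneg (e - c)]
    have hd0' : 0 ≤ (1 - 3 * d / 2) * ((2 * c - c ^ 2) + 2 - (1 + 2 * r)) := by
      apply mul_nonneg (by linarith); have := mul_nonneg hc0 (sub_nonneg.2 hc1); linarith
    have hd1' : 0 ≤ (3 * d / 2) * (c ^ 2 + 2 * c - ((1 + 2 * r) / 3 + 2 / 3 * (V - 1))) := by
      apply mul_nonneg (by linarith); linarith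
    have e2 : 2 * c * e - c ^ 2 + 2 * e + d - ((1 - d) * (1 + 2 * r) + d * V)
      = (1 - 3 * d / 2) * ((2 * c - c ^ 2) + 2 - (1 + 2 * r)) + (3 * d / 2) * (c ^ 2 + 2 * c - ((1 + 2 * r) / 3 + 2 / 3 * (V - 1))) := by
      rw [he, hcb]; ring
    linarith
  -- middle case
  have h4 := h4 hk
  have hR := rpow_half_le (v / d) κ (by positivity) hκ hk
  obtain ⟨vb, hvb⟩ : ∃ vb, vb = (1 - d) * (1 + 2 * r) + d * V := ⟨_, rfl⟩
  rw [← hvb] at hv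
  obtain ⟨h, hh⟩ : ∃ h, h = vb ^ 2 / d / 4 - vb / 12 := ⟨_, rfl⟩
  have hup : v * (v / d) ^ (κ / 2) ≤ vb + κ * h := by
    have h5 : v ^ 2 / d ≤ vb ^ 2 / d := by gcongr
    have h6 : (vb - v) ≤ (vb ^ 2 / d - v ^ 2 / d) + (vb - v) := by linarith
    calc v * (v / d) ^ (κ / 2) ≤ v * (1 + κ * (v / d / 4 - 1 / 12)) := by gcongr
      _ = v + κ * (v ^ 2 / d / 4) - κ / 12 * v := by ring
      _ ≤ vb + κ * (vb ^ 2 / d / 4) - κ / 12 * vb := by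
        have : κ * (v ^ 2 / d / 4) ≤ κ * (vb ^ 2 / d / 4) := by gcongr
        have := mul_nonneg (sub_nonneg.2 hv) (show 0 ≤ 1 - κ / 12 by linarith)
        linarith
      _ = _ := by rw [hh]; ring
  obtain ⟨l1, hl1⟩ : ∃ l1, l1 = 3 * d - 2 := ⟨_, rfl⟩
  obtain ⟨l0, hl0⟩ : ∃ l0, l0 = 3 * (1 - d) := ⟨_, rfl⟩
  have hl1n : 0 ≤ l1 := by linarith
  have hl0n : 0 ≤ l0 := by linarith
  have hdl : d = l1 + 2/3 * l0 := by rw [hl1, hl0]; ring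
  have hel : e = l1 * t + l0 * c := by rw [he, hcb, hl1, hl0]; ring
  have hvl : vb = l1 * V + l0 * L := by rw [hvb, hL, hl1, hl0]; ring
  have hchord : vb ^ 2 / d ≤ l1 * V ^ 2 + 3/2 * l0 * L ^ 2 := by
    rw [div_le_iff₀ hd0, hvl, hdl]
    have : 0 ≤ l0 * l1 * (3 * L - 2 * V) ^ 2 / 6 := by positivity
    linarith
  obtain ⟨S0, hS0'⟩ : ∃ S0, S0 = 5577/10000 + 5303/5000 * (c - 1/3) := ⟨_, rfl⟩
  have hc0 : 1/3 ≤ c := by linarith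
  have hc1 : c ≤ 1 := by linarith
  have hS0n : 0 ≤ S0 := by linarith
  have hS02 : S0 ^ 2 ≤ c * (c + 3/5) := by
    rw [hS0']; linarith [mul_nonneg (sub_nonneg.2 hc0) (sub_nonneg.2 hc1)]
  rw [← hS0'] at hb2
  obtain ⟨l, hl⟩ : ∃ l, l = l0 * S0 + l1 * S := ⟨_, rfl⟩
  have hl2 : l ^ 2 ≤ e * (e + 3/5) := by
    have := cs_lin c (c + 3/5) t (t + 3/5) S0 S l0 l1 (by linarith) (by linarith) ht0 (by linarith) hl0n hl1n hS02 hS2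
    rw [← hl] at this
    refine this.trans (le_of_eq ?_)
    have : l0 + l1 = 1 := by rw [hl0, hl1]; ring
    rw [hel]; linear_combination (3/5) * (l0 * c + l1 * t) * this
  obtain ⟨s, hs⟩ : ∃ s, s = κ * 5 / 3 := ⟨_, rfl⟩
  have hs0 : 0 ≤ s := by rw [hs]; positivity
  have hs1 : s ≤ 1 := by rw [hs]; linarith
  have hκs : κ = 3/5 * s := by rw [hs]; ring
  have hι2 : (1 - s) * e + s * l < ι := by
    apply lt_of_pow_lt_pow_left₀ 2 hι0
    refine lt_of_le_of_lt ?_ hι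
    have := cs_lin e e e (e + 3/5) e l (1 - s) s he0 he0 he0 (by linarith) (by linarith) hs0 (by rw [sq]) hl2
    refine this.trans (le_of_eq ?_)
    rw [hκs]; ring
  have ha : e * (e + (1 - e) * κ * (5/8)) ≤ α - d := by
    have h7 : e * (e + (1 - e) * κ * (5/8)) * (1 + κ) ≤ e * (κ + e) := by
      have : 0 ≤ e * (1 - e) * (κ * (3/5 - κ)) := by
        apply mul_nonneg (mul_nonneg he0 (by linarith)) (mul_nonneg hκ (by linarith))
      linarith
    exact le_of_mul_le_mul_right (h7.trans hα) (by linarith)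
  have hκι : κ * e ≤ κ * ι := by gcongr
  have hs_0 : vb ≤ 2 * d + 2 * e + e ^ 2 := by
    rw [hvb, he]
    have : (1 - d) * (1 + 2 * r) ≤ (1 - d) * 2 := by
      apply mul_le_mul_of_nonneg_left <;> linarith
    have : d * V ≤ d * (2 + 2 * t) := by gcongr
    linarith [sq_nonneg (1 - d + d * t)]
  have hs_1 : vb + 3/5 * h ≤ 7/5 * d + e * (3/5 + e) * (5/8) + 2 * l + 3/5 * e := by
    have he2 : 2 * t * e - t ^ 2 ≤ e ^ 2 := by linarith [sq_nonneg (e - t)]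
    have k1 := mul_le_mul_of_nonneg_left hb1 hl1n
    have k2 := mul_le_mul_of_nonneg_left hb2 hl0n
    have hsum : l0 + l1 = 1 := by rw [hl0, hl1]; ring
    have e5 : t ^ 2 = (l0 + l1) * t ^ 2 := by rw [hsum, one_mul]
    have hte : t * e = l1 * t ^ 2 + l0 * (t * c) := by rw [hel]; ring
    linarith
  have m0 := mul_le_mul_of_nonneg_left hs_0 (show 0 ≤ 1 - s by linarith)
  have m1 := mul_le_mul_of_nonneg_left hs_1 hs0
  rw [hκs] at h4 hup ha hκι
  linarith


lemma chord_le (r d W : ℝ) (hr0 : 0 < r) (hr1 : r ≤ 1) (hd0 : 0 ≤ d) (hd1 : d ≤ 1) (hW : 0 ≤ W) :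
    (4 + 2 * (d ^ (1 / r) * W)) ^ r ≤ (1 - d) * 4 ^ r + d * (4 + 2 * W) ^ r := by
  have h := Real.Lp_add_le (Finset.univ : Finset (Fin 2)) ![(1 - d) * 4 ^ r, 0] ![d * 4 ^ r, d * (2 * W) ^ r]
    (p := 1 / r) (by rw [le_div_iff₀ hr0]; linarith)
  have hpw : ∀ c X : ℝ, 0 ≤ c → 0 ≤ X → (c * X ^ r) ^ (1 / r) = c ^ (1 / r) * X := by
    intro c X hc hX
    rw [Real.mul_rpow hc (by positivity), ← Real.rpow_mul hX, mul_one_div_cancel hr0.ne', Real.rpow_one]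
  have h1 : |(1 - d) * (4:ℝ) ^ r + d * 4 ^ r| = 1 * 4 ^ r := by
    rw [abs_of_nonneg] <;> ring_nf
    positivity
  have h2 : |d * (2 * W) ^ r| = d * (2 * W) ^ r := abs_of_nonneg (by positivity)
  have h3 : |(1 - d) * (4:ℝ) ^ r| = (1 - d) * 4 ^ r := abs_of_nonneg (mul_nonneg (by linarith) (by positivity))
  have h4 : |d * (4:ℝ) ^ r| = d * 4 ^ r := abs_of_nonneg (by positivity)
  simp only [Fin.sum_univ_two, Matrix.cons_val_zero, Matrix.cons_val_one, zero_add, abs_zero] at h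
  rw [h1, h2, h3, h4, Real.zero_rpow (by positivity), hpw _ _ (by norm_num) (by norm_num),
    hpw _ _ hd0 (by positivity), hpw _ _ (by linarith) (by norm_num), hpw _ _ hd0 (by norm_num), add_zero,
    Real.one_rpow, one_mul, one_div_one_div, ← mul_add,
    Real.mul_rpow (by apply Real.rpow_nonneg; linarith) (by norm_num), ← Real.rpow_mul (by linarith),
    one_div_mul_cancel hr0.ne', Real.rpow_one, Real.mul_rpow (by positivity) (by positivity), ← Real.rpow_mul hd0,
    one_div_mul_cancel hr0.ne', Real.rpow_one] at h
  refine le_trans (le_of_eq ?_) h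
  congr 1; ring

lemma chord2 (r w T Dp M : ℝ) (hr0 : 0 < r) (hr1 : r ≤ 1/2) (hw : 0 < w) (hT : 1 ≤ T)
    (hTc : T * Real.cos (Real.pi * r / 2) ^ 2 = 1) (hDp : Dp * T = w ^ r) (hDp0 : 0 < Dp) (hM : M = max 1 Dp) :
    (4 + 2 * w) ^ r / M ≤ (1 - Dp / M) * (1 + 2 * r) + Dp / M * Vb r := by
  have hV1 := V1_le r T hr0 hr1 (by linarith) hTc
  have hw' : w = Dp ^ (1 / r) * T ^ (1 / r) := by
    rw [← Real.mul_rpow hDp0.le (by linarith), hDp, ← Real.rpow_mul hw.le, mul_one_div_cancel hr0.ne', Real.rpow_one]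
  rcases le_total Dp 1 with h | h
  · rw [max_eq_left h] at hM
    rw [hM, div_one, div_one, hw']
    refine (chord_le r Dp _ hr0 (by linarith) hDp0.le h (by positivity)).trans ?_
    have := four_rpow r hr0.le hr1
    have h1 : 0 ≤ 1 - Dp := by linarith
    gcongr
  · rw [max_eq_right h] at hM
    rw [hM, div_self hDp0.ne', sub_self, zero_mul, zero_add, one_mul, div_le_iff₀ hDp0]
    have : (4 + 2 * w) ^ r ≤ (4 + 2 * T ^ (1 / r)) ^ r * Dp := by
      have e : Dp = (Dp ^ (1 / r)) ^ r := by
        rw [← Real.rpow_mul hDp0.le, one_div_mul_cancel hr0.ne', Real.rpow_one]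
      have h1 : 1 ≤ Dp ^ (1 / r) := Real.one_le_rpow h (by positivity)
      conv_rhs => rw [e]
      rw [← Real.mul_rpow (by positivity) (by positivity)]
      apply Real.rpow_le_rpow (by positivity) _ hr0.le
      rw [hw']; nlinarith
    refine this.trans ?_
    gcongr

lemma case2_scal (r κ w a b j A b' V Dp T M k : ℝ) (hr0 : 0 < r) (hr1 : r ≤ 1/2) (hκ : 0 ≤ κ) (hw : 0 < w)
    (hT : 1 ≤ T) (hT2 : T ≤ 2) (hTQ : Qb r ^ 2 ≤ T - 1)
    (hM0 : 0 < M) (hDp0 : 0 < Dp) (hMD : Dp ≤ M) (hMA : M ≤ A) (hMb : M ≤ b')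
    (hV0 : 0 < V) (hV : V / M ≤ (1 - Dp / M) * (1 + 2 * r) + Dp / M * Vb r)
    (hb : b ≤ b') (hj : 0 ≤ j) (haD : Dp ≤ a)
    (hS0 : j ^ 2 ≤ (a - Dp) * ((1 + κ) * b))
    (hL3 : a + 2 * j ≤ V)
    (hL4 : κ ≤ 3/5 → (2 + κ) * j + a + (1 - κ) * Dp ≤ V * (V / Dp) ^ (κ / 2)) :
    j ^ 2 ≤ (A - Dp * (2 - T)) * ((1 + κ) * b' - Dp * (2 - T)) := by
  by_contra hcon
  push Not at hcon
  obtain ⟨d, hd⟩ : ∃ d, d = Dp / M := ⟨_, rfl⟩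
  obtain ⟨v, hv⟩ : ∃ v, v = V / M := ⟨_, rfl⟩
  obtain ⟨α, hα⟩ : ∃ α, α = a / M := ⟨_, rfl⟩
  obtain ⟨ι, hι⟩ : ∃ ι, ι = j / M := ⟨_, rfl⟩
  obtain ⟨B, hB⟩ : ∃ B, B = b' / M := ⟨_, rfl⟩
  obtain ⟨A1, hA1⟩ : ∃ A1, A1 = A / M := ⟨_, rfl⟩
  have hd0 : 0 < d := by rw [hd]; positivity
  have hd1 : d ≤ 1 := by rw [hd, div_le_one hM0]; exact hMD
  have hB1 : 1 ≤ B := by rw [hB, le_div_iff₀ hM0]; linarith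
  have hA11 : 1 ≤ A1 := by rw [hA1, le_div_iff₀ hM0]; linarith
  have hv0 : 0 < v := by rw [hv]; positivity
  have hι0 : 0 ≤ ι := by rw [hι]; positivity
  have eD : Dp = d * M := by rw [hd]; field_simp
  have eV : V = v * M := by rw [hv]; field_simp
  have ea : a = α * M := by rw [hα]; field_simp
  have ej : j = ι * M := by rw [hι]; field_simp
  have eB : b' = B * M := by rw [hB]; field_simp
  have eA : A = A1 * M := by rw [hA1]; field_simp
  rw [← hv, ← hd] at hV
  have hVd : V / Dp = v / d := by rw [eD, eV]; field_simp
  have hS0' : j ^ 2 ≤ (a - Dp) * ((1 + κ) * b') := by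
    refine hS0.trans ?_
    have : 0 ≤ a - Dp := by linarith
    gcongr
  rw [hVd] at hL4
  rw [eA, eD, eB, ej] at hcon
  rw [ea, eD, eB, ej] at hS0'
  rw [ea, ej, eV] at hL3
  rw [ea, ej, eD, eV] at hL4
  obtain ⟨e, he⟩ : ∃ e, e = 1 - d + d * (T - 1) := ⟨_, rfl⟩
  have hM2 : 0 < M ^ 2 := by positivity
  have hc1 : (A1 - 1 + e) * ((1 + κ) * B - 1 + e) < ι ^ 2 := by
    have : ((A1 - 1 + e) * ((1 + κ) * B - 1 + e)) * M ^ 2 < ι ^ 2 * M ^ 2 := by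
      refine lt_of_le_of_lt (le_of_eq ?_) (hcon.trans_le (le_of_eq ?_))
      · rw [he]; ring
      · ring
    exact lt_of_mul_lt_mul_right this hM2.le
  have hc2 : ι ^ 2 ≤ (α - d) * (1 + κ) * B := by
    have : ι ^ 2 * M ^ 2 ≤ ((α - d) * (1 + κ) * B) * M ^ 2 := by
      refine le_trans (le_of_eq ?_) (hS0'.trans (le_of_eq ?_)) <;> ring
    exact le_of_mul_le_mul_right this hM2
  have hL3' : α + 2 * ι ≤ v := by
    have : (α + 2 * ι) * M ≤ v * M := by linarith
    exact le_of_mul_le_mul_right this hM0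
  have hL4' : κ ≤ 3/5 → (2 + κ) * ι + α + (1 - κ) * d ≤ v * (v / d) ^ (κ / 2) := by
    intro hk
    have h := hL4 hk
    have : ((2 + κ) * ι + α + (1 - κ) * d) * M ≤ (v * (v / d) ^ (κ / 2)) * M := by
      refine le_trans (le_of_eq ?_) (h.trans (le_of_eq ?_)) <;> ring
    exact le_of_mul_le_mul_right this hM0
  have he0 : 0 ≤ e := by
    have := mul_nonneg hd0.le (sub_nonneg.2 hT)
    linarith
  have he1 : e ≤ 1 := by
    have := mul_nonneg hd0.le (sub_nonneg.2 hT2)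
    linarith
  have hκB : 0 ≤ κ * (B - 1) := mul_nonneg hκ (by linarith)
  have hp : 0 ≤ (1 + κ) * B - 1 + e := by linarith
  have hc3 : e * ((1 + κ) * B - 1 + e) < ι ^ 2 := by
    refine lt_of_le_of_lt ?_ hc1
    apply mul_le_mul_of_nonneg_right _ hp; linarith
  have hc4 : e * (κ + e) * B ≤ e * ((1 + κ) * B - 1 + e) := by
    have : 0 ≤ e * ((1 - e) * (B - 1)) := mul_nonneg he0 (mul_nonneg (by linarith) (by linarith))
    linarith
  have hc5 : e * (κ + e) ≤ (α - d) * (1 + κ) := by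
    have : e * (κ + e) * B ≤ ((α - d) * (1 + κ)) * B := by linarith
    exact le_of_mul_le_mul_right this (by linarith)
  have hc6 : e * (κ + e) < ι ^ 2 := by
    have : 0 ≤ e * (κ + e) * (B - 1) := mul_nonneg (mul_nonneg he0 (by linarith)) (by linarith)
    linarith
  obtain ⟨e0, he0'⟩ : ∃ e0, e0 = 1 - d + d * Qb r ^ 2 := ⟨_, rfl⟩
  have h00 : 0 ≤ e0 := by
    have : 0 ≤ d * Qb r ^ 2 := by positivity
    linarith
  have hee : e0 ≤ e := by
    rw [he0', he]; gcongr
  have hmono : e0 * (κ + e0) ≤ e * (κ + e) := by gcongr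
  exact scal0 r κ d v α ι e0 (Qb r ^ 2) (Qb r) hr0.le hr1 hκ hd0 hd1 rfl rfl he0' hv0 hV
    (hmono.trans hc5) hι0 (hmono.trans_lt hc6) hL3' hL4'

section vec
variable {m : ℕ}

lemma case2 (r κ w : ℝ) (x y : Fin m → ℝ) (A b' : ℝ) (hr0 : 0 < r) (hr1 : r < 1/2) (hκ : 0 ≤ κ) (hw : 0 < w)
    (hlo : ∀ t : ℝ, w ^ r * Real.cos (Real.pi * r / 2) ^ 2 ≤ pnorm (2 + κ) (x + t • y) ^ 2)
    (hloy : w ^ r * Real.cos (Real.pi * r / 2) ^ 2 ≤ pnorm (2 + κ) y ^ 2)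
    (hup : pnorm (2 + κ) (x + y) ^ 2 ≤ (4 + 2 * w) ^ r)
    (hA : 1 ≤ A) (haA : pnorm (2 + κ) x ^ 2 ≤ A) (hb1 : 1 ≤ b') (hb : pnorm (2 + κ) y ^ 2 ≤ b')
    (hj : 0 ≤ jj (2 + κ) x y) :
    jj (2 + κ) x y ^ 2 ≤ (A - w ^ r * Real.cos (Real.pi * r)) * ((1 + κ) * b' - w ^ r * Real.cos (Real.pi * r)) := by
  have p1 := Real.pi_gt_three
  have hQ := Qb_le r hr0 hr1.le
  have hcd : Real.cos (Real.pi * r) = 2 * Real.cos (Real.pi * r / 2) ^ 2 - 1 := by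
    rw [← Real.cos_two_mul]; congr 1; ring
  have hcn : 0 ≤ Real.cos (Real.pi * r) :=
    Real.cos_nonneg_of_neg_pi_div_two_le_of_le (by nlinarith) (by nlinarith)
  have hcp : 0 < Real.cos (Real.pi * r / 2) :=
    Real.cos_pos_of_mem_Ioo ⟨by nlinarith, by nlinarith⟩
  have hsc := Real.sin_sq_add_cos_sq (Real.pi * r / 2)
  obtain ⟨C, hC⟩ : ∃ C, C = Real.cos (Real.pi * r / 2) := ⟨_, rfl⟩
  obtain ⟨T, hT⟩ : ∃ T, T = 1 / C ^ 2 := ⟨_, rfl⟩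
  rw [← hC] at hcd hcp hlo hloy hsc hQ
  have hC2 : 0 < C ^ 2 := by positivity
  have hC1 : C ^ 2 ≤ 1 := by nlinarith [sq_nonneg (Real.sin (Real.pi * r / 2))]
  have hTC : T * C ^ 2 = 1 := by rw [hT]; field_simp
  have hT1 : 1 ≤ T := by rw [hT, le_div_iff₀ hC2]; linarith
  have hT2 : T ≤ 2 := by rw [hT, div_le_iff₀ hC2]; linarith
  have hTQ : Qb r ^ 2 ≤ T - 1 := by
    have hq0 : 0 ≤ Qb r := by unfold Qb; positivity
    have h1 : (Qb r * C) ^ 2 ≤ Real.sin (Real.pi * r / 2) ^ 2 := pow_le_pow_left₀ (by positivity) hQ 2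
    have : Qb r ^ 2 * C ^ 2 ≤ (T - 1) * C ^ 2 := by nlinarith
    exact le_of_mul_le_mul_right this hC2
  obtain ⟨Dp, hDp⟩ : ∃ Dp, Dp = w ^ r * C ^ 2 := ⟨_, rfl⟩
  rw [← hDp] at hlo hloy
  have hwr : 0 < w ^ r := by positivity
  have hDp0 : 0 < Dp := by rw [hDp]; positivity
  have hDT : Dp * T = w ^ r := by rw [hDp, mul_assoc, mul_comm _ T, hTC, mul_one]
  have hDD : w ^ r * Real.cos (Real.pi * r) = Dp * (2 - T) := by
    rw [hcd, mul_sub Dp, hDT, hDp]; ring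
  rw [hDD]
  have hax : Dp ≤ pnorm (2 + κ) x ^ 2 := by simpa using hlo 0
  have hV0 : 0 < (4 + 2 * w) ^ r := by positivity
  refine case2_scal r κ w (pnorm (2 + κ) x ^ 2) (pnorm (2 + κ) y ^ 2) _ A b' ((4 + 2 * w) ^ r) Dp T (max 1 Dp) 0
    hr0 hr1.le hκ hw hT1 hT2 hTQ (by positivity) hDp0 (le_max_right _ _)
    (max_le hA (hax.trans haA)) (max_le hb1 (hloy.trans hb)) hV0
    (chord2 r w T Dp _ hr0 hr1.le hw hT1 (by rw [← hC]; exact hTC) hDT hDp0 rfl) hb hj hax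
    (S0 κ hκ x y Dp hlo) ((conv_le (2 + κ) (by linarith) x y).trans hup) ?_
  intro hk
  have hn : 0 < pnorm (2 + κ) x := by
    rcases (pn_nonneg (2 + κ) x).lt_or_eq with h | h
    · exact h
    · rw [← h] at hax; norm_num at hax; linarith
  have h4 := L4vec κ hκ (by linarith) x y hn
  have hpw : ∀ z : ℝ, 0 ≤ z → z ^ (2 + κ) = z ^ 2 * (z ^ 2) ^ (κ / 2) := by
    intro z hz
    rw [Real.rpow_add_of_nonneg hz (by norm_num) hκ, ← Real.rpow_natCast z 2, ← Real.rpow_mul hz]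
    norm_num
    left; congr 1; ring
  have hpk : ∀ z : ℝ, 0 ≤ z → z ^ κ = (z ^ 2) ^ (κ / 2) := by
    intro z hz
    rw [← Real.rpow_natCast z 2, ← Real.rpow_mul hz]
    congr 1; push_cast; ring
  rw [hpw _ hn.le, hpw _ (pn_nonneg _ _), hpw _ (pn_nonneg _ _), hpk _ hn.le] at h4
  have hN0 : 0 ≤ pnorm (2 + κ) (x + y) ^ 2 := sq_nonneg _
  generalize pnorm (2 + κ) (x + y) ^ 2 = N at *
  generalize pnorm (2 + κ) x ^ 2 = a at *
  generalize pnorm (2 + κ) y ^ 2 = b at *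
  generalize jj (2 + κ) x y = j at *
  generalize (4 + 2 * w) ^ r = V at *
  have hκ2 : 0 ≤ κ / 2 := by positivity
  have k1 : N * N ^ (κ / 2) ≤ V * V ^ (κ / 2) := by gcongr
  have hb0 : 0 ≤ b := hDp0.le.trans hloy
  have k2 : Dp * Dp ^ (κ / 2) ≤ b * b ^ (κ / 2) := by gcongr
  have k3 : Dp ^ (κ / 2) ≤ a ^ (κ / 2) := by gcongr
  have hDk : 0 < Dp ^ (κ / 2) := by positivity
  rw [Real.div_rpow hV0.le hDp0.le, ← mul_div_assoc, le_div_iff₀ hDk]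
  have ha0 : 0 ≤ a := hDp0.le.trans hax
  have k4 : Dp ^ (κ / 2) * (a + (2 + κ) * j) ≤ a ^ (κ / 2) * (a + (2 + κ) * j) := by
    gcongr
  have k5 : (1 - κ) * (Dp * Dp ^ (κ / 2)) ≤ (1 - κ) * (b * b ^ (κ / 2)) :=
    mul_le_mul_of_nonneg_left k2 (by linarith)
  linarith

end vec


lemma neg_rpow_cos (w y : ℝ) (hw : 0 < w) : (-w) ^ y = w ^ y * Real.cos (Real.pi * y) := by
  rw [Real.rpow_def_of_neg (by linarith), Real.rpow_def_of_pos hw, Real.log_neg_eq_log, mul_comm y]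

lemma sq_rpow_inv (z q : ℝ) (hz : 0 ≤ z) : (z ^ (1 / q)) ^ 2 = z ^ (2 / q) := by
  rw [← Real.rpow_natCast, ← Real.rpow_mul hz]; congr 1; push_cast; ring

section vec
variable {m : ℕ}

lemma jj_smul_left (p : ℝ) (hp : 2 ≤ p) (c : ℝ) (hc : 0 < c) (x y : Fin m → ℝ) :
    jj p (c • x) y = c * jj p x y := by
  unfold jj
  rw [Finset.mul_sum]
  apply Finset.sum_congr rfl
  intro i _
  unfold Jmap
  have hs : Real.sign ((c • x) i) = Real.sign (x i) := by
    simp only [Pi.smul_apply, smul_eq_mul]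
    rcases lt_trichotomy (x i) 0 with h | h | h
    · rw [Real.sign_of_neg h, Real.sign_of_neg (mul_neg_of_pos_of_neg hc h)]
    · rw [h, mul_zero]
    · rw [Real.sign_of_pos h, Real.sign_of_pos (mul_pos hc h)]
  have hcc : c ^ (2 - p) * c ^ (p - 1) = c := by
    rw [← Real.rpow_add hc]; ring_nf; exact Real.rpow_one c
  rw [hs, pn_smul p hp, abs_of_pos hc, Real.mul_rpow hc.le (pn_nonneg p x), Pi.smul_apply, smul_eq_mul, abs_mul,
    abs_of_pos hc, Real.mul_rpow hc.le (abs_nonneg _)]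
  linear_combination (pnorm p x ^ (2 - p) * |x i| ^ (p - 1) * Real.sign (x i) * y i) * hcc

lemma norm_core (p q : ℝ) (hp : 2 ≤ p) (hq : 2 ≤ q) (x y : Fin m → ℝ) (δs δs' δss : ℝ)
    (hδs : 0 < δs) (hδs' : 0 < δs') (hδss : 0 < δss)
    (hx : pnorm p x ≤ (1 + δs) ^ (1 / q)) (hy : pnorm p y ≤ (1 + δs') ^ (1 / q))
    (hyl : (1 - δss) ^ (1 / q) ≤ pnorm p y)
    (hz1 : ∀ t : ℝ, (1 - δss) ^ (1 / q) * (1 + |t| ^ q) ^ (1 / q) ≤ pnorm p (x + t • y))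
    (hz2 : ∀ t : ℝ, pnorm p (x + t • y) ≤ (1 + δss) ^ (1 / q) * (1 + |t| ^ q) ^ (1 / q))
    (hj : 0 ≤ jj p x y) :
    jj p x y ≤ Real.sqrt ((1 + δs) ^ (2 / q) - (1 - δss) ^ (2 / q)) *
          Real.sqrt ((p - 1) * (1 + δs') ^ (2 / q) - (1 - δss) ^ (2 / q)) := by
  obtain ⟨κ, hκ⟩ : ∃ κ, κ = p - 2 := ⟨_, rfl⟩
  have hκ0 : 0 ≤ κ := by linarith
  have hpκ : p = 2 + κ := by linarith
  obtain ⟨r, hr⟩ : ∃ r, r = 2 / q := ⟨_, rfl⟩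
  have hr0 : 0 < r := by rw [hr]; positivity
  have hr1 : r ≤ 1 := by rw [hr, div_le_one (by linarith)]; exact hq
  have hqr : Real.pi * (1 / q) = Real.pi * r / 2 := by rw [hr]; ring
  have hg1 : ∀ t : ℝ, 1 ≤ 1 + |t| ^ q := fun t => by
    have : 0 ≤ |t| ^ q := by positivity
    linarith
  have hx2 : pnorm p x ^ 2 ≤ (1 + δs) ^ r := by
    rw [hr, ← sq_rpow_inv _ _ (by linarith)]
    exact pow_le_pow_left₀ (pn_nonneg p x) hx 2
  have hy2 : pnorm p y ^ 2 ≤ (1 + δs') ^ r := by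
    rw [hr, ← sq_rpow_inv _ _ (by linarith)]
    exact pow_le_pow_left₀ (pn_nonneg p y) hy 2
  have hA1 : 1 ≤ (1 + δs) ^ r := Real.one_le_rpow (by linarith) hr0.le
  have hb1 : 1 ≤ (1 + δs') ^ r := Real.one_le_rpow (by linarith) hr0.le
  have hup : ∀ t : ℝ, pnorm p (x + t • y) ^ 2 ≤ (1 + δss) ^ r * (1 + |t| ^ q) ^ r := fun t => by
    rw [hr, ← sq_rpow_inv _ _ (by linarith), ← sq_rpow_inv (1 + |t| ^ q) _ (by linarith [hg1 t]), ← mul_pow]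
    exact pow_le_pow_left₀ (pn_nonneg p _) (hz2 t) 2
  rw [← hr]
  suffices h : (1 - δss) ^ r ≤ (1 + δs) ^ r ∧
      jj p x y ^ 2 ≤ ((1 + δs) ^ r - (1 - δss) ^ r) * ((p - 1) * (1 + δs') ^ r - (1 - δss) ^ r) by
    rw [← Real.sqrt_mul (by linarith [h.1])]
    exact Real.le_sqrt_of_sq_le h.2
  rw [show p - 1 = 1 + κ by linarith]
  rcases le_or_gt δss 1 with hle | hgt
  · have hD1 : (1 - δss) ^ r < 1 := Real.rpow_lt_one (by linarith) (by linarith) hr0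
    refine ⟨by linarith, ?_⟩
    subst hpκ
    refine case1 κ hκ0 x y ((1 - δss) ^ r) ((1 + δss) ^ r) _ _ (fun t => (1 + |t| ^ q) ^ r)
      (Real.rpow_nonneg (by linarith) _) hD1 ?_ (by positivity) hA1 hb1 hy2 ?_ ?_ ?_ ?_ hup hj
    · have h1 := rpow_one_add_le_one_add_mul_self (s := δss) (by linarith) hr0.le hr1
      have h2 := rpow_one_add_le_one_add_mul_self (s := -δss) (by linarith) hr0.le hr1
      rw [← sub_eq_add_neg] at h2
      linarith
    · exact fun t => Real.one_le_rpow (hg1 t) hr0.le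
    · intro t
      have h1 := Real.rpow_add_le_add_rpow (p := r) (show (0:ℝ) ≤ 1 by norm_num) (show 0 ≤ |t| ^ q by positivity) hr0.le hr1
      rw [Real.one_rpow, ← Real.rpow_mul (abs_nonneg t), hr, mul_div_cancel₀ _ (by linarith)] at h1
      rw [← sq_abs t, hr]
      exact_mod_cast h1
    · intro t
      simp only [abs_neg]
    · intro t
      rw [hr, ← sq_rpow_inv _ _ (by linarith), ← sq_rpow_inv (1 + |t| ^ q) _ (by linarith [hg1 t]), ← mul_pow]
      exact pow_le_pow_left₀ (mul_nonneg (Real.rpow_nonneg (by linarith) _) (Real.rpow_nonneg (by linarith [hg1 t]) _)) (hz1 t) 2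
  · obtain ⟨w, hw⟩ : ∃ w, w = δss - 1 := ⟨_, rfl⟩
    have hw0 : 0 < w := by linarith
    have hnw : 1 - δss = -w := by linarith
    rw [hnw] at hyl hz1 ⊢
    rw [neg_rpow_cos _ _ hw0] at hyl hz1
    rw [neg_rpow_cos _ _ hw0]
    rw [hqr] at hyl hz1
    have p1 := Real.pi_gt_three
    have hcd : Real.cos (Real.pi * r) = 2 * Real.cos (Real.pi * r / 2) ^ 2 - 1 := by
      rw [← Real.cos_two_mul]; congr 1; ring
    have hC0 : 0 ≤ Real.cos (Real.pi * r / 2) :=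
      Real.cos_nonneg_of_neg_pi_div_two_le_of_le (by nlinarith) (by nlinarith)
    have hC1 := Real.cos_sq_le_one (Real.pi * r / 2)
    have hwr : 0 < w ^ r := by positivity
    have hsq : w ^ r * Real.cos (Real.pi * r / 2) ^ 2 = (w ^ (1 / q) * Real.cos (Real.pi * r / 2)) ^ 2 := by
      rw [mul_pow, sq_rpow_inv _ _ hw0.le, hr]
    have hlo : ∀ t : ℝ, w ^ r * Real.cos (Real.pi * r / 2) ^ 2 ≤ pnorm p (x + t • y) ^ 2 := by
      intro t
      rw [hsq]
      apply pow_le_pow_left₀ (by positivity)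
      refine le_trans ?_ (hz1 t)
      exact le_mul_of_one_le_right (by positivity) (Real.one_le_rpow (hg1 t) (by positivity))
    have hloy : w ^ r * Real.cos (Real.pi * r / 2) ^ 2 ≤ pnorm p y ^ 2 := by
      rw [hsq]
      exact pow_le_pow_left₀ (by positivity) hyl 2
    have hD : w ^ r * Real.cos (Real.pi * r) ≤ (1 + δs) ^ r := by
      have h0 := hlo 0
      rw [zero_smul, add_zero] at h0
      refine le_trans ?_ (h0.trans hx2)
      apply mul_le_mul_of_nonneg_left _ hwr.le
      linarith
    refine ⟨hD, ?_⟩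
    rcases lt_or_ge r (1/2) with hrh | hrh
    · subst hpκ
      refine case2 r κ w x y _ _ hr0 hrh hκ0 hw0 hlo hloy ?_ hA1 hx2 hb1 hy2 hj
      have := hup 1
      rw [one_smul, abs_one, Real.one_rpow, ← Real.mul_rpow (by linarith) (by norm_num)] at this
      rw [show 4 + 2 * w = (1 + δss) * (1 + 1) by rw [hw]; ring]
      exact this
    · have hcn : Real.cos (Real.pi * r) ≤ 0 :=
        Real.cos_nonpos_of_pi_div_two_le_of_le (by nlinarith) (by nlinarith)
      have hDn : w ^ r * Real.cos (Real.pi * r) ≤ 0 := mul_nonpos_of_nonneg_of_nonpos hwr.le hcn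
      have hc := jj_abs_le p hp x y
      rw [abs_of_nonneg hj] at hc
      generalize w ^ r * Real.cos (Real.pi * r) = D at *
      generalize (1 + δs) ^ r = A at *
      generalize (1 + δs') ^ r = b' at *
      calc jj p x y ^ 2 ≤ (pnorm p x * pnorm p y) ^ 2 := pow_le_pow_left₀ hj hc 2
        _ = pnorm p x ^ 2 * pnorm p y ^ 2 := by ring
        _ ≤ A * b' := by gcongr
        _ ≤ (A - D) * ((1 + κ) * b' - D) := by
          have h1 : A ≤ A - D := by linarith
          have h2 : b' ≤ (1 + κ) * b' - D := by
            have : 0 ≤ κ * b' := mul_nonneg hκ0 (by linarith)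
            linarith
          gcongr

end vec

lemma pn_disj {N : ℕ} (q : ℝ) (hq : 2 ≤ q) (u v : Fin N → ℝ) (hdisj : ∀ i, u i = 0 ∨ v i = 0)
    (hu : pnorm q u = 1) (hv : pnorm q v = 1) (t : ℝ) :
    pnorm q (u + t • v) = (1 + |t| ^ q) ^ (1 / q) := by
  have h1 : ∑ i, |u i| ^ q = 1 := by rw [← pn_rpow q hq, hu, Real.one_rpow]
  have h2 : ∑ i, |v i| ^ q = 1 := by rw [← pn_rpow q hq, hv, Real.one_rpow]
  have h3 : ∑ i, |(u + t • v) i| ^ q = 1 + |t| ^ q := by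
    have : ∀ i, |(u + t • v) i| ^ q = |u i| ^ q + |t| ^ q * |v i| ^ q := by
      intro i
      have hq0 : q ≠ 0 := by linarith
      simp only [Pi.add_apply, Pi.smul_apply, smul_eq_mul]
      rcases hdisj i with h | h
      · rw [h, zero_add, abs_zero, Real.zero_rpow hq0, zero_add, abs_mul, Real.mul_rpow (abs_nonneg _) (abs_nonneg _)]
      · rw [h, mul_zero, add_zero, abs_zero, Real.zero_rpow hq0, mul_zero, add_zero]
    rw [Finset.sum_congr rfl (fun i _ => this i), Finset.sum_add_distrib, ← Finset.mul_sum, h1, h2, mul_one]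
  unfold pnorm
  rw [h3]

lemma sparse_comb {N : ℕ} (s s' : ℕ) (u v : Fin N → ℝ)
    (hu : (Finset.univ.filter fun i => u i ≠ 0).card = s)
    (hv : (Finset.univ.filter fun i => v i ≠ 0).card = s') (a b : ℝ) :
    Sparse (s + s') (a • u + b • v) := by
  unfold Sparse
  rw [← hu, ← hv]
  refine le_trans (Finset.card_le_card ?_) (Finset.card_union_le _ _)
  intro i
  simp only [Finset.mem_filter, Finset.mem_univ, true_and, Finset.mem_union, Pi.add_apply, Pi.smul_apply, smul_eq_mul]
  intro h
  by_contra hc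
  push Not at hc
  rw [hc.1, hc.2] at h
  simp at h

lemma sparse_smul {N : ℕ} (s : ℕ) (u : Fin N → ℝ)
    (hu : (Finset.univ.filter fun i => u i ≠ 0).card = s) (a : ℝ) :
    Sparse s (a • u) := by
  unfold Sparse
  rw [← hu]
  apply Finset.card_le_card
  intro i
  simp only [Finset.mem_filter, Finset.mem_univ, true_and, Pi.smul_apply, smul_eq_mul]
  intro h hc
  rw [hc] at h
  simp at h

lemma main_sgn {m N : ℕ} (p q : ℝ) (hp : 2 ≤ p) (hq : 2 ≤ q)
    (Φ : Matrix (Fin m) (Fin N) ℝ) (μ δs δs' δss : ℝ) (hμ : 0 < μ)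
    (hδs : 0 < δs) (hδs' : 0 < δs') (hδss : 0 < δss) (s s' : ℕ)
    (hRIPs : RIPpq p q μ δs s Φ) (hRIPs' : RIPpq p q μ δs' s' Φ)
    (hRIPss : RIPpq p q μ δss (s + s') Φ)
    (u v : Fin N → ℝ)
    (hu : (Finset.univ.filter fun i => u i ≠ 0).card = s)
    (hv : (Finset.univ.filter fun i => v i ≠ 0).card = s')
    (hdisj : ∀ i, u i = 0 ∨ v i = 0) (hj : 0 ≤ jj p (Φ.mulVec u) (Φ.mulVec v)) :
    jj p (Φ.mulVec u) (Φ.mulVec v) ≤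
      μ ^ 2 *
        (Real.sqrt ((1 + δs) ^ (2 / q) - (1 - δss) ^ (2 / q)) *
          Real.sqrt ((p - 1) * (1 + δs') ^ (2 / q) - (1 - δss) ^ (2 / q))) *
        pnorm q u * pnorm q v := by
  rcases (pn_nonneg q u).eq_or_lt with hu0 | hu0
  · have h := pn_eq_zero q hq u hu0.symm
    rw [← hu0, h, Matrix.mulVec_zero, jj_zero]; simp
  rcases (pn_nonneg q v).eq_or_lt with hv0 | hv0
  · have h := pn_eq_zero q hq v hv0.symm
    rw [← hv0, h, Matrix.mulVec_zero]; simp [jj]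
  obtain ⟨a, ha⟩ : ∃ a, a = pnorm q u := ⟨_, rfl⟩
  obtain ⟨b, hb⟩ : ∃ b, b = pnorm q v := ⟨_, rfl⟩
  rw [← ha] at hu0
  rw [← hb] at hv0
  have hnu : pnorm q (a⁻¹ • u) = 1 := by
    rw [pn_smul q hq, ← ha, abs_of_pos (by positivity)]; field_simp
  have hnv : pnorm q (b⁻¹ • v) = 1 := by
    rw [pn_smul q hq, ← hb, abs_of_pos (by positivity)]; field_simp
  have hd : ∀ i, (a⁻¹ • u) i = 0 ∨ (b⁻¹ • v) i = 0 := by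
    intro i
    rcases hdisj i with h | h
    · left; simp [h]
    · right; simp [h]
  have hsc : ∀ z : Fin N → ℝ, pnorm p (μ⁻¹ • Φ.mulVec z) = μ⁻¹ * pnorm p (Φ.mulVec z) := by
    intro z
    rw [pn_smul p hp, abs_of_pos (by positivity)]
  have hcan : ∀ X n : ℝ, μ⁻¹ * (μ * X * n) = X * n := by
    intro X n; field_simp
  have hlow : ∀ (σ : ℕ) (δ : ℝ) (z : Fin N → ℝ), RIPpq p q μ δ σ Φ → Sparse σ z →
      (1 - δ) ^ (1 / q) * pnorm q z ≤ pnorm p (μ⁻¹ • Φ.mulVec z) ∧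
      pnorm p (μ⁻¹ • Φ.mulVec z) ≤ (1 + δ) ^ (1 / q) * pnorm q z := by
    intro σ δ z hR hS
    have h := hR z hS
    rw [hsc]
    constructor
    · rw [← hcan]
      exact mul_le_mul_of_nonneg_left h.1 (by positivity)
    · rw [← hcan ((1 + δ) ^ (1 / q))]
      exact mul_le_mul_of_nonneg_left h.2 (by positivity)
  have hlin : ∀ t : ℝ, μ⁻¹ • Φ.mulVec (a⁻¹ • u) + t • (μ⁻¹ • Φ.mulVec (b⁻¹ • v)) =
      μ⁻¹ • Φ.mulVec (a⁻¹ • u + t • (b⁻¹ • v)) := by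
    intro t
    rw [Matrix.mulVec_add, Matrix.mulVec_smul Φ t, smul_add, smul_comm t]
  have hjj : jj p (μ⁻¹ • Φ.mulVec (a⁻¹ • u)) (μ⁻¹ • Φ.mulVec (b⁻¹ • v)) =
      μ⁻¹ * a⁻¹ * μ⁻¹ * b⁻¹ * jj p (Φ.mulVec u) (Φ.mulVec v) := by
    rw [Matrix.mulVec_smul, Matrix.mulVec_smul, jj_smul, jj_smul, jj_smul_left p hp _ (by positivity),
      jj_smul_left p hp _ (by positivity)]
    ring
  have h1 := (hlow s δs (a⁻¹ • u) hRIPs (sparse_smul s u hu _)).2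
  have h2 := (hlow s' δs' (b⁻¹ • v) hRIPs' (sparse_smul s' v hv _)).2
  have hsv : Sparse (s + s') (b⁻¹ • v) := by
    have := sparse_comb s s' u v hu hv 0 b⁻¹
    simpa using this
  have h3 := (hlow (s + s') δss (b⁻¹ • v) hRIPss hsv).1
  have h4 : ∀ t : ℝ, _ := fun t => hlow (s + s') δss (a⁻¹ • u + t • (b⁻¹ • v)) hRIPss
    (by rw [smul_smul]; exact sparse_comb s s' u v hu hv _ _)
  rw [hnu, mul_one] at h1
  rw [hnv, mul_one] at h2 h3
  have key := norm_core p q hp hq (μ⁻¹ • Φ.mulVec (a⁻¹ • u)) (μ⁻¹ • Φ.mulVec (b⁻¹ • v)) δs δs' δss hδs hδs' hδss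
    h1 h2 h3
    (fun t => by
      rw [hlin, ← pn_disj q hq _ _ hd hnu hnv t]; exact (h4 t).1)
    (fun t => by
      rw [hlin, ← pn_disj q hq _ _ hd hnu hnv t]; exact (h4 t).2)
    (by rw [hjj]; positivity)
  rw [hjj] at key
  rw [← ha, ← hb]
  have h5 := mul_le_mul_of_nonneg_left key (show 0 ≤ μ * a * μ * b by positivity)
  refine le_trans (le_of_eq ?_) (h5.trans (le_of_eq ?_))
  · field_simp
  · ring

/-- disjoint-support inner product bound under RIP_{p,q}. -/
theorem disjoint_support_inner_bound {m N : ℕ} (p q : ℝ) (hp : 2 ≤ p) (hq : 2 ≤ q)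
    (Φ : Matrix (Fin m) (Fin N) ℝ) (μ δs δs' δss : ℝ) (hμ : 0 < μ)
    (hδs : 0 < δs) (hδs' : 0 < δs') (hδss : 0 < δss) (s s' : ℕ)
    (hRIPs : RIPpq p q μ δs s Φ) (hRIPs' : RIPpq p q μ δs' s' Φ)
    (hRIPss : RIPpq p q μ δss (s + s') Φ)
    (u v : Fin N → ℝ)
    (hu : (Finset.univ.filter fun i => u i ≠ 0).card = s)
    (hv : (Finset.univ.filter fun i => v i ≠ 0).card = s')
    (hdisj : ∀ i, u i = 0 ∨ v i = 0) :
    |∑ i, Jmap p (Φ.mulVec u) i * Φ.mulVec v i| ≤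
      μ ^ 2 *
        (Real.sqrt ((1 + δs) ^ (2 / q) - (1 - δss) ^ (2 / q)) *
          Real.sqrt ((p - 1) * (1 + δs') ^ (2 / q) - (1 - δss) ^ (2 / q))) *
        pnorm q u * pnorm q v := by
  change |jj p (Φ.mulVec u) (Φ.mulVec v)| ≤ _
  rcases le_total 0 (jj p (Φ.mulVec u) (Φ.mulVec v)) with h | h
  · rw [abs_of_nonneg h]
    exact main_sgn p q hp hq Φ μ δs δs' δss hμ hδs hδs' hδss s s' hRIPs hRIPs' hRIPss u v hu hv hdisj h
  · rw [abs_of_nonpos h, ← jj_neg, ← Matrix.mulVec_neg]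
    have hvn : pnorm q v = pnorm q (-v) := by unfold pnorm; simp
    rw [hvn]
    refine main_sgn p q hp hq Φ μ δs δs' δss hμ hδs hδs' hδss s s' hRIPs hRIPs' hRIPss u (-v) hu ?_ ?_ ?_
    · simpa using hv
    · intro i; simpa using hdisj i
    · rw [Matrix.mulVec_neg, jj_neg]; linarith

end
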